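/- Assume GCH. Let μ be a singular strong limit cardinal and let λ = μ⁺. Suppose there exists a λ-free non-free abelian group of cardinality λ, and suppose that every θ-free non-free abelian group of cardinality θ, for every infinite cardinal θ < λ, is not a Whitehead group. Then there exists a strongly λ-free abelian group G* of cardinality λ with Hom(G*, ℤ) = 0, i.e., the only group homomorphism from G* to ℤ is the zero homomorphism. -/

import Mathlib

universe u

/-- An abelian group is free if it is a free `ℤ`-module. -/
def IsFreeAbelian (G : Type u) [AddCommGroup G] : Prop :=
  Module.Free ℤ G

/-- `G` is `κ`-free: every subgroup of cardinality `< κ` is free. -/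
def IsKappaFree (κ : Cardinal.{u}) (G : Type u) [AddCommGroup G] : Prop :=
  ∀ H : AddSubgroup G, Cardinal.mk H < κ → IsFreeAbelian H

/-- `G` is a Whitehead group. -/
def IsWhitehead (G : Type u) [AddCommGroup G] : Prop :=
  ∀ (H : Type u) [AddCommGroup H] (π : H →+ G),
    Function.Surjective π → Nonempty (π.ker ≃+ ℤ) →
      ∃ s : G →+ H, π.comp s = AddMonoidHom.id G

/-- strongly κ-free -/
def IsStronglyKappaFree (κ : Cardinal.{u}) (G : Type u) [AddCommGroup G] : Prop :=
  IsKappaFree κ G ∧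
    ∀ H : AddSubgroup G, Cardinal.mk H < κ →
      ∃ K : AddSubgroup G, H ≤ K ∧ Cardinal.mk K < κ ∧ IsKappaFree κ (G ⧸ K)

open Cardinal

theorem free_of_filtration {F : Type*} [AddCommGroup F] (U : AddSubgroup F) {ι : Type*}
    [LinearOrder ι] [WellFoundedLT ι] (N : ι → AddSubgroup F) (hN : Monotone N)
    {Φ : ι → Type*} [∀ i, AddCommGroup (Φ i)] (P : ∀ i, F →+ Φ i)
    (hfree : ∀ i, Module.Free ℤ ((N i).map (P i)))
    (hker : ∀ i, ∀ y ∈ N i, P i y = 0 ↔ (y ∈ U ∨ ∃ j < i, ∃ y' ∈ N j, y - y' ∈ U))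
    (hcov : ∀ y, ∃ i, ∃ y' ∈ N i, y - y' ∈ U) : Module.Free ℤ (F ⧸ U) := by
  classical
  let b : ∀ i, Module.Basis (Module.Free.ChooseBasisIndex ℤ ((N i).map (P i))) ℤ
    ((N i).map (P i)) := fun i => Module.Free.chooseBasis ℤ _
  have hb : ∀ i k, ∃ t ∈ N i, P i t = b i k := fun i k => (b i k).2
  choose t ht htb using hb
  let κ := Σ i, Module.Free.ChooseBasisIndex ℤ ((N i).map (P i))
  let v : κ → F ⧸ U := fun x => QuotientAddGroup.mk' U (t x.1 x.2)
  have hli : LinearIndependent ℤ v := by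
    rw [linearIndependent_iff]
    intro l hl
    by_contra hne
    have hsne : l.support.Nonempty := Finsupp.support_nonempty_iff.mpr hne
    obtain ⟨⟨i, k0⟩, hmem, hmax⟩ := Finset.exists_max_image l.support (fun x : κ => x.1) hsne
    let Q : N i →+ (N i).map (P i) := (P i).addSubgroupMap (N i)
    let q : N i →+ ℤ := (((b i).coord k0).toAddMonoidHom).comp Q
    let t' : κ → N i := fun x => if h : x.1 ≤ i then ⟨t x.1 x.2, hN h (ht _ _)⟩ else 0
    have hq : ∀ x : κ, x ∈ l.support → q (t' x) = if x = ⟨i, k0⟩ then 1 else 0 := by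
      rintro ⟨j, k⟩ hx
      have hji : j ≤ i := hmax _ hx
      have h1 : t' ⟨j, k⟩ = ⟨t j k, hN hji (ht _ _)⟩ := dif_pos hji
      rcases hji.lt_or_eq with hlt | rfl
      · have h0 : P i (t j k) = 0 := by
          rw [hker i _ (hN hji (ht _ _))]
          exact Or.inr ⟨j, hlt, t j k, ht _ _, by simp [U.zero_mem]⟩
        have : Q (t' ⟨j, k⟩) = 0 := by
          rw [h1]; exact Subtype.ext h0
        have hne' : (⟨j, k⟩ : κ) ≠ ⟨i, k0⟩ := fun h => hlt.ne (congrArg Sigma.fst h)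
        simp [q, this, hne']
      · have : Q (t' ⟨j, k⟩) = b j k := by
          rw [h1]; exact Subtype.ext (htb j k)
        simp only [q, AddMonoidHom.comp_apply, this, LinearMap.toAddMonoidHom_coe,
          Module.Basis.coord_apply, Module.Basis.repr_self, Finsupp.single_apply]
        congr 1
        exact propext ⟨fun h => h ▸ rfl, fun h => eq_of_heq (Sigma.mk.inj_iff.mp h).2⟩
    let y : N i := ∑ x ∈ l.support, l x • t' x
    have hqy : q y = l ⟨i, k0⟩ := by
      simp only [y, map_sum, map_zsmul]
      rw [Finset.sum_congr rfl (fun x hx => by rw [hq x hx])]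
      simp only [smul_eq_mul, mul_ite, mul_one, mul_zero]
      rw [Finset.sum_ite_eq' ]
      simp [hmem]
    have hyU : (y : F) ∈ U := by
      rw [← QuotientAddGroup.eq_zero_iff, ← hl, Finsupp.linearCombination_apply, Finsupp.sum]
      have : (y : F) = ∑ x ∈ l.support, l x • t x.1 x.2 := by
        simp only [y, AddSubgroup.val_finsetSum, AddSubgroup.coe_zsmul]
        refine Finset.sum_congr rfl fun x hx => ?_
        have hji : x.1 ≤ i := hmax _ hx
        simp only [t', dif_pos hji]
      rw [this]
      change QuotientAddGroup.mk' U _ = _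
      rw [map_sum]
      exact Finset.sum_congr rfl fun x _ => map_zsmul _ _ _
    have hPy : P i y = 0 := (hker i _ y.2).mpr (Or.inl hyU)
    have : Q y = 0 := Subtype.ext hPy
    have : q y = 0 := by simp [q, this]
    rw [hqy] at this
    exact Finsupp.mem_support_iff.mp hmem this
  have hsp : ∀ i, ∀ y ∈ N i, (QuotientAddGroup.mk' U y) ∈ Submodule.span ℤ (Set.range v) := by
    intro i
    induction i using WellFoundedLT.induction with
    | ind i ih =>
      intro y hy
      let Py : (N i).map (P i) := ⟨P i y, y, hy, rfl⟩
      let s : F := ((b i).repr Py).sum fun k c => c • t i k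
      have hs : s ∈ N i := AddSubgroup.sum_mem _ fun k _ => AddSubgroup.zsmul_mem _ (ht i k) _
      have hPs : P i s = P i y := by
        have h1 := (b i).linearCombination_repr Py
        rw [Finsupp.linearCombination_apply] at h1
        have h2 := congrArg Subtype.val h1
        simp only [Finsupp.sum, AddSubgroup.val_finsetSum, AddSubgroup.coe_zsmul, Py] at h2
        rw [← h2]
        simp only [s, Finsupp.sum, map_sum, map_zsmul, htb, Py]
      have hssp : QuotientAddGroup.mk' U s ∈ Submodule.span ℤ (Set.range v) := by
        simp only [s, Finsupp.sum, map_sum, map_zsmul]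
        exact Submodule.sum_mem _ fun k _ =>
          Submodule.smul_mem _ _ (Submodule.subset_span ⟨⟨i, k⟩, rfl⟩)
      have h0 : P i (y - s) = 0 := by simp [hPs]
      have key : QuotientAddGroup.mk' U (y - s) ∈ Submodule.span ℤ (Set.range v) := by
        rcases (hker i _ (sub_mem hy hs)).mp h0 with h | ⟨j, hj, y', hy', h⟩
        · have : QuotientAddGroup.mk' U (y - s) = 0 := (QuotientAddGroup.eq_zero_iff _).mpr h
          rw [this]; exact zero_mem _
        · have : QuotientAddGroup.mk' U (y - s - y') = 0 := (QuotientAddGroup.eq_zero_iff _).mpr h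
          rw [map_sub, sub_eq_zero] at this
          rw [this]; exact ih j hj y' hy'
      have := add_mem key hssp
      rwa [← map_add, sub_add_cancel] at this
  refine Module.Free.of_basis (Module.Basis.mk hli ?_)
  rintro x -
  obtain ⟨y, rfl⟩ := QuotientAddGroup.mk'_surjective U x
  obtain ⟨i, y', hy', h⟩ := hcov y
  have : QuotientAddGroup.mk' U (y - y') = 0 := (QuotientAddGroup.eq_zero_iff _).mpr h
  rw [map_sub, sub_eq_zero] at this
  rw [this]
  exact hsp i y' hy'

theorem free_of_addEquiv {A B : Type*} [AddCommGroup A] [AddCommGroup B] (e : A ≃+ B)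
    (h : Module.Free ℤ A) : Module.Free ℤ B :=
  Module.Free.of_equiv e.toIntLinearEquiv

theorem free_addSubgroup_int (K : AddSubgroup ℤ) : Module.Free ℤ K :=
  have : Module.Free ℤ (AddSubgroup.toIntSubmodule K) := inferInstance
  free_of_addEquiv (AddEquiv.refl K : AddSubgroup.toIntSubmodule K ≃+ K) this

theorem free_subgroup_finsupp {X : Type*} (K : AddSubgroup (X →₀ ℤ)) : Module.Free ℤ K := by
  classical
  obtain ⟨_, _⟩ := exists_wellFoundedLT X
  let N : WithTop X → AddSubgroup K := fun i =>
    { carrier := {y | ∀ x : X, i < (x : WithTop X) → (y : X →₀ ℤ) x = 0}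
      add_mem' := fun {a b} ha hb x hx => by
        simp only [AddSubgroup.coe_add, Finsupp.add_apply, ha x hx, hb x hx, add_zero]
      zero_mem' := fun x _ => rfl
      neg_mem' := fun {a} ha x hx => by
        simp only [AddSubgroup.coe_neg, Finsupp.neg_apply, ha x hx, neg_zero] }
  let P : WithTop X → K →+ ℤ := fun i =>
    match i with
    | none => 0
    | some x => (Finsupp.applyAddHom x).comp K.subtype
  have hP : ∀ x : X, ∀ y : K, P (x : WithTop X) y = (y : X →₀ ℤ) x := fun x y => rfl
  have hPt : ∀ y : K, P ⊤ y = 0 := fun y => rfl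
  have hzero : ∀ y : K, y ≠ 0 → ∃ m : X, (y : X →₀ ℤ) m ≠ 0 ∧ y ∈ N m := by
    intro y hy
    have : (y : X →₀ ℤ).support.Nonempty := by
      rw [Finsupp.support_nonempty_iff]; exact fun h => hy (Subtype.ext h)
    refine ⟨_, Finsupp.mem_support_iff.mp (Finset.max'_mem _ this), fun x hx => ?_⟩
    by_contra hne
    exact (WithTop.coe_lt_coe.mp hx).not_ge
      (Finset.le_max' _ _ (Finsupp.mem_support_iff.mpr hne))
  have h := free_of_filtration (F := K) ⊥ N
    (fun i j hij y hy x hx => hy x (lt_of_le_of_lt hij hx)) P (fun i => free_addSubgroup_int _)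
    ?_ ?_
  · exact free_of_addEquiv QuotientAddGroup.quotientBot h
  · intro i y hy
    constructor
    · intro h0
      by_cases hy0 : y = 0
      · exact Or.inl (by simp [hy0])
      obtain ⟨m, hm, hmN⟩ := hzero y hy0
      refine Or.inr ⟨m, ?_, y, hmN, by simp⟩
      refine lt_of_le_of_ne (not_lt.mp fun hlt => hm (hy m hlt)) ?_
      rintro rfl
      exact hm h0
    · rintro (h | ⟨j, hj, y', hy', h⟩)
      · rw [AddSubgroup.mem_bot] at h
        rw [h, map_zero]
      · rw [AddSubgroup.mem_bot, sub_eq_zero] at h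
        subst h
        induction i using WithTop.recTopCoe with
        | top => exact hPt y
        | coe x => exact hy' x hj
  · intro y
    exact ⟨⊤, y, fun x hx => by simp at hx, by simp⟩

theorem free_of_injective_finsupp {A X : Type*} [AddCommGroup A] (f : A →+ (X →₀ ℤ))
    (hf : Function.Injective f) : Module.Free ℤ A :=
  free_of_addEquiv (AddMonoidHom.ofInjective hf).symm (free_subgroup_finsupp _)

theorem free_of_injective {A B : Type*} [AddCommGroup A] [AddCommGroup B] (hB : Module.Free ℤ B)
    (f : A →+ B) (hf : Function.Injective f) : Module.Free ℤ A := by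
  let b := Module.Free.chooseBasis ℤ B
  exact free_of_injective_finsupp (b.repr.toLinearMap.toAddMonoidHom.comp f)
    (b.repr.injective.comp hf)

theorem free_subgroup {B : Type*} [AddCommGroup B] (hB : Module.Free ℤ B) (K : AddSubgroup B) :
    Module.Free ℤ K := free_of_injective hB K.subtype Subtype.val_injective

theorem free_subgroup_mono {B : Type*} [AddCommGroup B] {K L : AddSubgroup B} (h : K ≤ L)
    (hB : Module.Free ℤ L) :
    Module.Free ℤ K := free_of_injective hB (AddSubgroup.inclusion h)
      (AddSubgroup.inclusion_injective h)

/-- The pure closure of a subgroup. -/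
def pureClosure {Y : Type*} [AddCommGroup Y] (A : AddSubgroup Y) : AddSubgroup Y where
  carrier := {y | ∃ m : ℤ, m ≠ 0 ∧ m • y ∈ A}
  add_mem' := by
    rintro a b ⟨m, hm, ha⟩ ⟨n, hn, hb⟩
    refine ⟨m * n, mul_ne_zero hm hn, ?_⟩
    rw [smul_add]
    refine add_mem ?_ ?_
    · rw [mul_comm, mul_smul]; exact A.zsmul_mem ha n
    · rw [mul_smul]; exact A.zsmul_mem hb m
  zero_mem' := ⟨1, one_ne_zero, by simp⟩
  neg_mem' := by
    rintro a ⟨m, hm, ha⟩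
    exact ⟨m, hm, by simpa using ha⟩

theorem mem_pureClosure {Y : Type*} [AddCommGroup Y] {A : AddSubgroup Y} {y : Y} :
    y ∈ pureClosure A ↔ ∃ m : ℤ, m ≠ 0 ∧ m • y ∈ A := Iff.rfl

theorem le_pureClosure {Y : Type*} [AddCommGroup Y] (A : AddSubgroup Y) : A ≤ pureClosure A :=
  fun y hy => ⟨1, one_ne_zero, by simpa using hy⟩

theorem pureClosure_mono {Y : Type*} [AddCommGroup Y] {A B : AddSubgroup Y} (h : A ≤ B) :
    pureClosure A ≤ pureClosure B :=
  fun _ ⟨m, hm, hy⟩ => ⟨m, hm, h hy⟩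

/-- `A` is pure with torsion-free quotient. -/
def IsPure {Y : Type*} [AddCommGroup Y] (A : AddSubgroup Y) : Prop :=
  ∀ m : ℤ, m ≠ 0 → ∀ y : Y, m • y ∈ A → y ∈ A

theorem isPure_pureClosure {Y : Type*} [AddCommGroup Y] (A : AddSubgroup Y) :
    IsPure (pureClosure A) := by
  rintro m hm y ⟨n, hn, hy⟩
  exact ⟨n * m, mul_ne_zero hn hm, by rwa [mul_smul]⟩

theorem pureClosure_le {Y : Type*} [AddCommGroup Y] {A B : AddSubgroup Y} (h : A ≤ B)
    (hB : IsPure B) : pureClosure A ≤ B :=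
  fun y ⟨m, hm, hy⟩ => hB m hm y (h hy)

theorem finite_pureClosure {Y : Type*} [AddCommGroup Y] (s : Finset Y) (M : AddSubgroup Y)
    (hsM : (s : Set Y) ⊆ M) (hM : Module.Free ℤ M) (hp : IsPure M) :
    Module.Finite ℤ (pureClosure (AddSubgroup.closure (s : Set Y))) := by
  classical
  let b := Module.Free.chooseBasis ℤ M
  let T : Finset (Module.Free.ChooseBasisIndex ℤ M) :=
    s.attach.biUnion fun x => (b.repr ⟨x.1, hsM x.2⟩).support
  have hle : pureClosure (AddSubgroup.closure (s : Set Y)) ≤ M :=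
    pureClosure_le ((AddSubgroup.closure_le _).mpr hsM) hp
  have hout : ∀ k ∉ T, ∀ y : M, (y : Y) ∈ pureClosure (AddSubgroup.closure (s : Set Y)) →
      b.repr y k = 0 := by
    intro k hk y hy
    obtain ⟨m, hm, hmy⟩ := hy
    have h1 : ∀ x (hx : x ∈ AddSubgroup.closure (s : Set Y)) (hxM : x ∈ M),
        b.repr ⟨x, hxM⟩ k = 0 := by
      intro x hx
      induction hx using AddSubgroup.closure_induction with
      | mem x hx =>
        intro hxM
        by_contra hne
        exact hk (Finset.mem_biUnion.mpr ⟨⟨x, hx⟩, Finset.mem_attach _ _,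
          Finsupp.mem_support_iff.mpr hne⟩)
      | zero => intro h; exact DFunLike.congr_fun (map_zero b.repr) k
      | add x y hx hy ihx ihy =>
        intro h
        have hxM := (AddSubgroup.closure_le M).mpr hsM hx
        have hyM := (AddSubgroup.closure_le M).mpr hsM hy
        have : b.repr ⟨x + y, h⟩ = b.repr ⟨x, hxM⟩ + b.repr ⟨y, hyM⟩ :=
          map_add b.repr ⟨x, hxM⟩ ⟨y, hyM⟩
        rw [this, Finsupp.add_apply, ihx hxM, ihy hyM, add_zero]
      | neg x hx ihx =>
        intro h
        have hxM := (AddSubgroup.closure_le M).mpr hsM hx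
        have : b.repr ⟨-x, h⟩ = - b.repr ⟨x, hxM⟩ := map_neg b.repr ⟨x, hxM⟩
        rw [this, Finsupp.neg_apply, ihx hxM, neg_zero]
    have h2 := h1 _ hmy (M.zsmul_mem y.2 m)
    have h3 : b.repr ⟨m • (y : Y), M.zsmul_mem y.2 m⟩ = m • b.repr y := map_zsmul b.repr m y
    rw [h3] at h2
    simpa [hm] using h2
  let f : pureClosure (AddSubgroup.closure (s : Set Y)) →+ (T → ℤ) :=
    { toFun := fun y k => b.repr ⟨y.1, hle y.2⟩ k
      map_zero' := by
        ext k
        exact DFunLike.congr_fun (map_zero b.repr) k.1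
      map_add' := by
        intro x y
        ext k
        exact DFunLike.congr_fun (map_add b.repr ⟨x.1, hle x.2⟩ ⟨y.1, hle y.2⟩) k.1 }
  have hf : Function.Injective f := by
    rw [injective_iff_map_eq_zero]
    intro y hy
    have : b.repr ⟨y.1, hle y.2⟩ = 0 := by
      ext k
      by_cases hk : k ∈ T
      · exact congrFun hy ⟨k, hk⟩
      · exact hout k hk _ y.2
    have := b.repr.map_eq_zero_iff.mp this
    exact Subtype.ext (congrArg (fun z : M => (z : Y)) this)
  exact Module.Finite.of_injective f.toIntLinearMap hf

theorem free_of_finite_of_pure {A : Type*} [AddCommGroup A] [Module.Finite ℤ A]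
    (h : ∀ m : ℤ, m ≠ 0 → ∀ y : A, m • y = 0 → y = 0) : Module.Free ℤ A := by
  have : Module.IsTorsionFree ℤ A := Module.IsTorsionFree.of_smul_eq_zero fun m y hy =>
    or_iff_not_imp_left.mpr fun hm => h m hm y hy
  exact (Module.free_of_finite_type_torsion_free' : Module.Free ℤ A)

/-- A version of Pontryagin's criterion. -/
theorem free_of_countable {Y : Type*} [AddCommGroup Y] [Countable Y]
    (h : ∀ s : Finset Y, ∃ M : AddSubgroup Y, (s : Set Y) ⊆ M ∧ Module.Free ℤ M ∧ IsPure M) :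
    Module.Free ℤ Y := by
  classical
  obtain ⟨g, hg⟩ := exists_surjective_nat Y
  let P : ℕ → AddSubgroup Y := fun n =>
    pureClosure (AddSubgroup.closure ((Finset.range n).image g : Finset Y))
  have hPmono : Monotone P := by
    intro a b hab
    refine pureClosure_mono (AddSubgroup.closure_mono ?_)
    exact_mod_cast Finset.image_subset_image (Finset.range_mono hab)
  have hP0 : P 0 = ⊥ := by
    rw [eq_bot_iff]
    rintro y ⟨m, hm, hy⟩
    have hy : m • y = 0 := by simpa using hy
    obtain ⟨M, hsM, hfree, -⟩ := h {y}
    have hyM : y ∈ M := hsM (by simp)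
    have : m • (⟨y, hyM⟩ : M) = 0 := Subtype.ext hy
    have := (smul_eq_zero.mp this).resolve_left hm
    exact congrArg Subtype.val this
  have hfin : ∀ n, Module.Finite ℤ (P n) := by
    intro n
    obtain ⟨M, hsM, hfree, hp⟩ := h ((Finset.range n).image g)
    exact finite_pureClosure _ M hsM hfree hp
  refine free_of_addEquiv QuotientAddGroup.quotientBot
    (free_of_filtration (F := Y) ⊥ (fun n => P (n + 1)) (fun a b hab => hPmono (by omega))
    (fun n => QuotientAddGroup.mk' (P n)) ?_ ?_ ?_)
  · intro n
    have : Module.Finite ℤ ((P (n + 1)).map (QuotientAddGroup.mk' (P n))) :=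
      Module.Finite.of_surjective
        ((QuotientAddGroup.mk' (P n)).addSubgroupMap (P (n + 1))).toIntLinearMap
        ((QuotientAddGroup.mk' (P n)).addSubgroupMap_surjective _)
    apply free_of_finite_of_pure
    rintro m hm ⟨_, y, hy, rfl⟩ h0
    have h0 : QuotientAddGroup.mk' (P n) (m • y) = 0 := by
      have := congrArg Subtype.val h0
      rw [map_zsmul]; exact this
    have h1 : m • y ∈ P n := (QuotientAddGroup.eq_zero_iff _).mp h0
    have : y ∈ P n := isPure_pureClosure _ m hm y h1
    exact Subtype.ext ((QuotientAddGroup.eq_zero_iff _).mpr this)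
  · intro n y hy
    change ((y : Y ⧸ P n) = 0) ↔ _
    rw [QuotientAddGroup.eq_zero_iff]
    constructor
    · intro h0
      rcases n with _ | n
      · left; rw [hP0] at h0; exact h0
      · exact Or.inr ⟨n, Nat.lt_succ_self n, y, h0, by simp⟩
    · rintro (h0 | ⟨j, hj, y', hy', h0⟩)
      · rw [AddSubgroup.mem_bot] at h0; rw [h0]; exact zero_mem _
      · rw [AddSubgroup.mem_bot, sub_eq_zero] at h0
        rw [h0]; exact hPmono hj hy'
  · intro y
    obtain ⟨n, rfl⟩ := hg y
    refine ⟨n, g n, le_pureClosure _ (AddSubgroup.subset_closure ?_), by simp⟩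
    exact_mod_cast Finset.mem_image_of_mem g (Finset.mem_range.mpr (Nat.lt_succ_self n))

/-- Evaluation of formal integer combinations. -/
noncomputable def ev {G : Type*} [AddCommGroup G] : (G →₀ ℤ) →+ G :=
  (Finsupp.linearCombination ℤ (id : G → G)).toAddMonoidHom

theorem ev_single {G : Type*} [AddCommGroup G] (g : G) (n : ℤ) :
    ev (Finsupp.single g n) = n • g := by
  simp [ev]

theorem ev_eq_sum {G : Type*} [AddCommGroup G] (c : G →₀ ℤ) :
    ev c = c.sum fun g n => n • g := rfl

theorem exists_tower {G : Type*} [AddCommGroup G] (M L : AddSubgroup G)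
    (htf : ∀ m : ℤ, m ≠ 0 → ∀ y ∈ L, m • y ∈ M → y ∈ M) :
    ∃ E : ℕ → Set G, (∀ n, E n ⊆ L) ∧
      (∀ n (c : G →₀ ℤ), (c.support : Set G) ⊆ E n → ev c ∈ M → c = 0) ∧
      (∀ n, ∀ e ∈ E n, ∃ c : G →₀ ℤ, (c.support : Set G) ⊆ E (n + 1) ∧ e - ev c ∈ M) ∧
      ∀ g ∈ L, ∃ n, ∃ c : G →₀ ℤ, (c.support : Set G) ⊆ E n ∧ g - ev c ∈ M := by
  classical
  let Q : AddSubgroup (G ⧸ M) := L.map (QuotientAddGroup.mk' M)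
  have hQtf : ∀ m : ℤ, m ≠ 0 → ∀ q : Q, m • q = 0 → q = 0 := by
    rintro m hm ⟨_, y, hy, rfl⟩ h
    have h1 : QuotientAddGroup.mk' M (m • y) = 0 := by
      rw [map_zsmul]; exact congrArg Subtype.val h
    have h2 := htf m hm y hy ((QuotientAddGroup.eq_zero_iff _).mp h1)
    exact Subtype.ext ((QuotientAddGroup.eq_zero_iff _).mpr h2)
  obtain ⟨B, hBli, hBmax⟩ := exists_maximal_linearIndepOn ℤ (id : Q → Q)
  let S : Submodule ℤ Q := Submodule.span ℤ B
  have hSfree : Module.Free ℤ S := by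
    have := Module.Free.of_basis (Module.Basis.span hBli)
    have hr : Set.range (fun x : B => id (x : Q)) = B := Subtype.range_coe
    rw [hr] at this
    exact this
  let R : ℕ → Submodule ℤ Q := fun n => S.comap (LinearMap.lsmul ℤ Q (n.factorial : ℤ))
  have hfac : ∀ n : ℕ, ((n.factorial : ℕ) : ℤ) ≠ 0 := fun n =>
    by exact_mod_cast n.factorial_ne_zero
  have hRfree : ∀ n, Module.Free ℤ (R n) := by
    intro n
    let f : R n →ₗ[ℤ] S := (LinearMap.lsmul ℤ Q (n.factorial : ℤ)).restrict (fun x hx => hx)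
    refine free_of_injective hSfree f.toAddMonoidHom ?_
    rw [injective_iff_map_eq_zero]
    intro x hx
    exact Subtype.ext (hQtf _ (hfac n) _ (congrArg Subtype.val hx))
  let b := fun n => Module.Free.chooseBasis ℤ (R n)
  have hlift : ∀ n k, ∃ t ∈ L, QuotientAddGroup.mk' M t = ((b n k : Q) : G ⧸ M) :=
    fun n k => (b n k : Q).2
  choose t htL htb using hlift
  have hR : ∀ n, ∀ g, ∀ hgL : g ∈ L,
      (⟨QuotientAddGroup.mk' M g, AddSubgroup.mem_map_of_mem _ hgL⟩ : Q) ∈ R n →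
      ∃ c : G →₀ ℤ, (c.support : Set G) ⊆ Set.range (t n) ∧ g - ev c ∈ M := by
    intro n g hgL hg
    let r := (b n).repr ⟨_, hg⟩
    refine ⟨r.mapDomain (t n), ?_, ?_⟩
    · intro x hx
      have := Finsupp.mapDomain_support hx
      simp only [Finset.mem_image] at this
      obtain ⟨k, -, rfl⟩ := this
      exact ⟨k, rfl⟩
    · rw [← QuotientAddGroup.eq_zero_iff]
      change QuotientAddGroup.mk' M _ = 0
      have h1 := (b n).linearCombination_repr ⟨_, hg⟩
      rw [Finsupp.linearCombination_apply] at h1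
      have h2 := congrArg (fun z : R n => ((z : Q) : G ⧸ M)) h1
      have h3 : ev (r.mapDomain (t n)) = r.sum fun k z => z • t n k := by
        simp only [ev, LinearMap.toAddMonoidHom_coe, Finsupp.linearCombination_mapDomain]
        rfl
      rw [map_sub, h3, sub_eq_zero, Finsupp.sum, map_sum]
      simp only [map_zsmul, htb]
      refine Eq.trans h2.symm ?_
      simp [Finsupp.sum, r, b]
  refine ⟨fun n => Set.range (t n), ?_, ?_, ?_, ?_⟩
  · rintro n _ ⟨k, rfl⟩; exact htL n k
  · intro n c hc hcM
    have hli : LinearIndependent ℤ (fun k => QuotientAddGroup.mk' M (t n k)) := by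
      have h1 := (b n).linearIndependent
      have h2 := h1.map' (R n).subtype (Submodule.ker_subtype _)
      have h3 := h2.map' Q.subtype.toIntLinearMap
        (LinearMap.ker_eq_bot.mpr Subtype.val_injective)
      have h4 : (fun k => QuotientAddGroup.mk' M (t n k)) =
          Q.subtype.toIntLinearMap ∘ (R n).subtype ∘ b n := funext (htb n)
      rw [h4]
      exact h3
    have hinj : Function.Injective (t n) := by
      intro a b hab
      exact hli.injective (congrArg (QuotientAddGroup.mk' M) hab)
    have h4 : LinearIndepOn ℤ (QuotientAddGroup.mk' M) (Set.range (t n)) :=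
      (linearIndepOn_range_iff hinj _).mpr hli
    rw [linearIndepOn_iff] at h4
    refine h4 c ((Finsupp.mem_supported _ _).mpr hc) ?_
    rw [Finsupp.linearCombination_apply, Finsupp.sum]
    have : QuotientAddGroup.mk' M (ev c) = 0 := (QuotientAddGroup.eq_zero_iff _).mpr hcM
    rw [ev_eq_sum, Finsupp.sum, map_sum] at this
    simpa only [map_zsmul] using this
  · rintro n _ ⟨k, rfl⟩
    refine hR (n + 1) _ (htL n k) ?_
    have h1 : (⟨QuotientAddGroup.mk' M (t n k), AddSubgroup.mem_map_of_mem _ (htL n k)⟩ : Q)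
        = (b n k : Q) := Subtype.ext (htb n k)
    rw [h1]
    have h2 : ((n.factorial : ℕ) : ℤ) • (b n k : Q) ∈ S := (b n k).2
    change (((n + 1).factorial : ℕ) : ℤ) • (b n k : Q) ∈ S
    rw [Nat.factorial_succ, Nat.cast_mul, mul_smul]
    exact S.smul_mem _ h2
  · intro g hg
    let q : Q := ⟨QuotientAddGroup.mk' M g, AddSubgroup.mem_map_of_mem _ hg⟩
    have : ∃ a : ℤ, a ≠ 0 ∧ a • q ∈ S := by
      by_cases hq : q ∈ B
      · exact ⟨1, one_ne_zero, by rw [one_smul]; exact Submodule.subset_span hq⟩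
      · obtain ⟨a, ha, h⟩ := hBmax q hq
        exact ⟨a, ha, by simpa [S] using h⟩
    obtain ⟨a, ha, haS⟩ := this
    obtain ⟨c, hc⟩ : a ∣ ((a.natAbs.factorial : ℕ) : ℤ) := by
      rw [← Int.natAbs_dvd]
      exact_mod_cast Nat.dvd_factorial (Int.natAbs_pos.mpr ha) le_rfl
    refine ⟨a.natAbs, hR _ g hg ?_⟩
    change ((a.natAbs.factorial : ℕ) : ℤ) • q ∈ S
    rw [hc, mul_comm, mul_smul]
    exact S.smul_mem _ haS

/-- The witnesses of the pigeonhole gadget at each level. -/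
def GadW (C : Type u) : ℕ → Type u
  | 0 => PUnit
  | n + 1 => GadW C n × {p : C × C // p.1 ≠ p.2}

/-- The points of the pigeonhole gadget at each level. -/
def GadV (C : Type u) : ℕ → Type u
  | 0 => PEmpty
  | n + 1 => (GadV C n × (C × C)) ⊕ (C × GadW C n)

/-- Forming a witness of the next level. -/
def gadPair {C : Type u} {n : ℕ} (w : GadW C n) (p : {p : C × C // p.1 ≠ p.2}) :
    GadW C (n + 1) := (w, p)

/-- The underlying witness of the previous level. -/
def gadFst {C : Type u} {n : ℕ} (w : GadW C (n + 1)) : GadW C n := w.1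

/-- The pair of colours of a witness. -/
def gadSnd {C : Type u} {n : ℕ} (w : GadW C (n + 1)) : {p : C × C // p.1 ≠ p.2} := w.2

/-- The copies of the points of the previous level. -/
def gadInl {C : Type u} {n : ℕ} (y : GadV C n) (p : C × C) : GadV C (n + 1) := Sum.inl (y, p)

/-- The new points. -/
def gadInr {C : Type u} {n : ℕ} (c : C) (w : GadW C n) : GadV C (n + 1) := Sum.inr (c, w)

/-- Functions on the points of the next level. -/
def gadElim {C : Type u} {n : ℕ} {α : Type*} (f : GadV C n → C × C → α) (g : C → GadW C n → α) :
    GadV C (n + 1) → α := Sum.elim (fun x => f x.1 x.2) (fun x => g x.1 x.2)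

theorem gadElim_inl {C : Type u} {n : ℕ} {α : Type*} (f : GadV C n → C × C → α)
    (g : C → GadW C n → α) (y : GadV C n) (p : C × C) : gadElim f g (gadInl y p) = f y p := rfl

theorem gadElim_inr {C : Type u} {n : ℕ} {α : Type*} (f : GadV C n → C × C → α)
    (g : C → GadW C n → α) (c : C) (w : GadW C n) : gadElim f g (gadInr c w) = g c w := rfl

theorem gadW_ext {C : Type u} {n : ℕ} {w w' : GadW C (n + 1)} (h1 : gadFst w = gadFst w')
    (h2 : gadSnd w = gadSnd w') : w = w' := Prod.ext h1 h2

/-- The formal combination of points attached to a witness. -/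
noncomputable def gadBd (C : Type u) : (n : ℕ) → GadW C n → (GadV C n →₀ ℤ)
  | 0, _ => 0
  | n + 1, w =>
    (gadBd C n (gadFst w)).mapDomain (fun y => gadInl y (gadSnd w).1) +
      Finsupp.single (gadInr (gadSnd w).1.1 (gadFst w)) 1 -
      Finsupp.single (gadInr (gadSnd w).1.2 (gadFst w)) 1

theorem gadBd_succ (C : Type u) (n : ℕ) (w : GadW C (n + 1)) :
    gadBd C (n + 1) w =
    (gadBd C n (gadFst w)).mapDomain (fun y => gadInl y (gadSnd w).1) +
      Finsupp.single (gadInr (gadSnd w).1.1 (gadFst w)) 1 -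
      Finsupp.single (gadInr (gadSnd w).1.2 (gadFst w)) 1 := rfl

theorem exists_potential (C : Type u) (n : ℕ) (T : Finset (GadW C n)) (hT : T.card ≤ n) :
    ∃ φ : GadV C n → ℤ, ∀ w ∈ T, Finsupp.linearCombination ℤ φ (gadBd C n w) = 1 := by
  classical
  induction n with
  | zero =>
    have : T = ∅ := Finset.card_eq_zero.mp (by omega)
    exact ⟨fun _ => 0, by simp [this]⟩
  | succ n ih =>
    by_cases hp : ∃ p : {p : C × C // p.1 ≠ p.2}, ∀ w ∈ T, gadSnd w = p
    · obtain ⟨p, hp⟩ := hp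
      refine ⟨gadElim (fun _ _ => 0) (fun d _ => if d = p.1.1 then 1 else 0), ?_⟩
      intro w hw
      have hq := hp _ hw
      rw [gadBd_succ, map_sub, map_add, Finsupp.linearCombination_mapDomain, hq]
      simp only [Finsupp.linearCombination_single, gadElim_inr]
      have h2 : p.1.2 ≠ p.1.1 := fun h => p.2 h.symm
      rw [if_neg h2]
      simp [Finsupp.linearCombination_apply, Function.comp_def, gadElim_inl]
    · push Not at hp
      let T' : {p : C × C // p.1 ≠ p.2} → Finset (GadW C n) := fun p =>
        (T.filter fun w => gadSnd w = p).image gadFst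
      have hcard : ∀ p, (T' p).card ≤ n := by
        intro p
        obtain ⟨w, hw, hne⟩ := hp p
        have h1 : (T.filter fun w => gadSnd w = p).card < T.card := by
          refine Finset.card_lt_card (Finset.filter_ssubset.mpr ⟨w, hw, hne⟩)
        have h2 : (T' p).card ≤ (T.filter fun w => gadSnd w = p).card := Finset.card_image_le
        omega
      choose φ hφ using fun p => ih (T' p) (hcard p)
      refine ⟨gadElim (fun y q => if h : q.1 ≠ q.2 then φ ⟨q, h⟩ y else 0) (fun _ _ => 0), ?_⟩
      intro w hw
      rw [gadBd_succ, map_sub, map_add, Finsupp.linearCombination_mapDomain]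
      simp only [Finsupp.linearCombination_single, smul_zero, sub_zero, add_zero, gadElim_inr]
      rw [← hφ (gadSnd w) (gadFst w)
        (Finset.mem_image.mpr ⟨w, Finset.mem_filter.mpr ⟨hw, rfl⟩, rfl⟩)]
      congr 2
      funext y
      simp only [Function.comp, gadElim_inl]
      rw [dif_pos (gadSnd w).2]

theorem power_lt_of_strongLimit {μ : Cardinal.{u}} (hinf : ℵ₀ ≤ μ)
    (hstrong : ∀ θ < μ, (2 : Cardinal.{u}) ^ θ < μ) {a b : Cardinal.{u}} (ha : a < μ) (hb : b < μ) :
    a ^ b < μ := by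
  calc a ^ b ≤ (2 ^ a) ^ b := Cardinal.power_le_power_right (Cardinal.cantor a).le
    _ = 2 ^ (a * b) := by rw [Cardinal.power_mul]
    _ < μ := hstrong _ (Cardinal.mul_lt_of_lt hinf ha hb)

theorem exists_monochromatic {μ : Cardinal.{u}} (hinf : ℵ₀ ≤ μ)
    (hstrong : ∀ θ < μ, (2 : Cardinal.{u}) ^ θ < μ) (C : Type u) (hC : μ ≤ #C) (n : ℕ) (Θ : Type u)
    (hΘ : #Θ < μ) : ∃ S : Set (GadW C n), #S < μ ∧
      ∀ c : GadV C n → Θ, ∃ w ∈ S, (gadBd C n w).mapDomain c = 0 := by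
  classical
  induction n with
  | zero =>
    refine ⟨Set.univ, ?_, fun c => ⟨PUnit.unit, trivial, rfl⟩⟩
    refine lt_of_lt_of_le ?_ hinf
    have : Finite (GadW C 0) := inferInstanceAs (Finite PUnit)
    exact Cardinal.lt_aleph0_of_finite _
  | succ n ih =>
    obtain ⟨S, hS, hSc⟩ := ih
    have hΞ : #(S → Θ) < μ := by
      rw [← Cardinal.power_def]
      exact power_lt_of_strongLimit hinf hstrong hΘ hS
    obtain ⟨D, hD⟩ := Cardinal.le_mk_iff_exists_set.mp ((hstrong _ hΞ).le.trans hC)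
    refine ⟨{w | gadFst w ∈ S ∧ (gadSnd w).1.1 ∈ D ∧ (gadSnd w).1.2 ∈ D}, ?_, ?_⟩
    · have hDμ : #D < μ := by rw [hD]; exact hstrong _ hΞ
      refine lt_of_le_of_lt ?_ (Cardinal.mul_lt_of_lt hinf hS (Cardinal.mul_lt_of_lt hinf hDμ hDμ))
      simp only [Cardinal.mul_def]
      refine Cardinal.mk_le_of_injective
        (f := fun w => (⟨gadFst w.1, w.2.1⟩, ⟨(gadSnd w.1).1.1, w.2.2.1⟩,
          ⟨(gadSnd w.1).1.2, w.2.2.2⟩)) ?_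
      rintro ⟨w, h1⟩ ⟨w', h1'⟩ h
      simp only [Prod.mk.injEq, Subtype.mk.injEq] at h
      exact Subtype.ext (gadW_ext h.1 (Subtype.ext (Prod.ext h.2.1 h.2.2)))
    · intro c
      have : ∃ d d' : D, d ≠ d' ∧ ∀ w : S, c (gadInr d.1 w.1) = c (gadInr d'.1 w.1) := by
        by_contra hcon
        push Not at hcon
        have hinj : Function.Injective (fun (d : D) (w : S) => c (gadInr d.1 w.1)) := by
          intro d d' h
          by_contra hne
          obtain ⟨w, hw⟩ := hcon d d' hne
          exact hw (congrFun h w)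
        have := Cardinal.mk_le_of_injective hinj
        rw [hD] at this
        exact absurd this (not_le.mpr (Cardinal.cantor _))
      obtain ⟨d, d', hne, hdd⟩ := this
      obtain ⟨w, hw, h0⟩ := hSc (fun y => c (gadInl y (d.1, d'.1)))
      have hne' : d.1 ≠ d'.1 := fun h => hne (Subtype.ext h)
      refine ⟨gadPair w ⟨(d.1, d'.1), hne'⟩, ⟨hw, d.2, d'.2⟩, ?_⟩
      rw [gadBd_succ]
      have hsub : ∀ a b : GadV C (n + 1) →₀ ℤ, (a - b).mapDomain c =
          a.mapDomain c - b.mapDomain c := fun a b => map_sub (Finsupp.mapDomain.addMonoidHom c) a b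
      rw [hsub, Finsupp.mapDomain_add, Finsupp.mapDomain_single, Finsupp.mapDomain_single,
        ← Finsupp.mapDomain_comp]
      have h1 : c (gadInr d.1 w) = c (gadInr d'.1 w) := hdd ⟨w, hw⟩
      change Finsupp.mapDomain _ (gadBd C n w) + Finsupp.single (c (gadInr d.1 w)) 1 -
        Finsupp.single (c (gadInr d'.1 w)) 1 = 0
      rw [h1, add_sub_cancel_right]
      exact h0

theorem mk_gad_le {μ : Cardinal.{u}} (hinf : ℵ₀ ≤ μ) (C : Type u) (hC : #C ≤ μ) (n : ℕ) :
    #(GadW C n) ≤ μ ∧ #(GadV C n) ≤ μ := by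
  induction n with
  | zero =>
    constructor
    · have : Finite (GadW C 0) := inferInstanceAs (Finite PUnit)
      exact (Cardinal.lt_aleph0_of_finite _).le.trans hinf
    · have : Finite (GadV C 0) := inferInstanceAs (Finite PEmpty)
      exact (Cardinal.lt_aleph0_of_finite _).le.trans hinf
  | succ n ih =>
    have hCC : #(C × C) ≤ μ := by
      rw [← Cardinal.mul_def]
      exact (mul_le_mul' hC hC).trans (Cardinal.mul_eq_self hinf).le
    constructor
    · change #(GadW C n × {p : C × C // p.1 ≠ p.2}) ≤ μ
      rw [← Cardinal.mul_def]
      exact (mul_le_mul' ih.1 ((Cardinal.mk_subtype_le _).trans hCC)).trans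
        (Cardinal.mul_eq_self hinf).le
    · change #((GadV C n × (C × C)) ⊕ (C × GadW C n)) ≤ μ
      rw [← Cardinal.add_def, ← Cardinal.mul_def, ← Cardinal.mul_def]
      refine (add_le_add ?_ ?_).trans (Cardinal.add_eq_self hinf).le
      · rw [Cardinal.mul_def]
        exact (mul_le_mul' ih.2 hCC).trans (Cardinal.mul_eq_self hinf).le
      · exact (mul_le_mul' hC ih.1).trans (Cardinal.mul_eq_self hinf).le

theorem aleph0_le_of_singular (μ : Cardinal.{u}) (hsing : μ.ord.cof < μ)
    (hstrong : ∀ θ < μ, (2 : Cardinal.{u}) ^ θ < μ) : ℵ₀ ≤ μ := by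
  by_contra h
  obtain ⟨n, rfl⟩ := Cardinal.lt_aleph0.mp (not_le.mp h)
  rcases n with _ | n
  · simp at hsing
  · have h1 := hstrong (n : Cardinal) (by exact_mod_cast Nat.lt_succ_self n)
    have h2 : 2 ^ n < n + 1 := by exact_mod_cast h1
    have := Nat.lt_two_pow_self (n := n)
    omega

theorem isWhitehead_of_extend {F Q : Type u} [AddCommGroup F] [AddCommGroup Q] (π : F →+ Q)
    (hπ : Function.Surjective π) (hF : Module.Free ℤ F)
    (hext : ∀ κ : π.ker →+ ℤ, ∃ f : F →+ ℤ, ∀ x : π.ker, f x = κ x) (A : AddSubgroup Q) :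
    IsWhitehead A := by
  intro H _ p hp ⟨i⟩
  let A' := A.comap π
  have hA' : Module.Free ℤ A' := free_subgroup hF _
  let πA : A' →+ A := π.addSubgroupComap A
  have hπA : Function.Surjective πA := by
    rintro ⟨a, ha⟩
    obtain ⟨x, rfl⟩ := hπ a
    exact ⟨⟨x, ha⟩, rfl⟩
  obtain ⟨g, hg⟩ : ∃ g : A' →+ H, ∀ x, p (g x) = πA x := by
    obtain ⟨g, hg⟩ := Module.projective_lifting_property p.toIntLinearMap πA.toIntLinearMap hp
    exact ⟨g.toAddMonoidHom, fun x => LinearMap.congr_fun hg x⟩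
  have hkA : ∀ x : π.ker, (x : F) ∈ A' := fun x => by
    change π x ∈ A
    rw [x.2]; exact zero_mem _
  let j : π.ker →+ A' := AddSubgroup.inclusion (fun x hx => hkA ⟨x, hx⟩)
  have hgj : ∀ x, g (j x) ∈ p.ker := fun x => by
    change p (g (j x)) = 0
    rw [hg]
    exact Subtype.ext x.2
  let κ : π.ker →+ ℤ :=
    { toFun := fun x => i ⟨g (j x), hgj x⟩
      map_zero' := by
        rw [← map_zero i]
        exact congrArg i (Subtype.ext (by simp))
      map_add' := fun x y => by
        rw [← map_add i]
        exact congrArg i (Subtype.ext (by simp)) }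
  obtain ⟨f, hf⟩ := hext κ
  let g' : A' →+ H := g - (p.ker.subtype.comp i.symm.toAddMonoidHom).comp (f.comp A'.subtype)
  have hpg' : ∀ x, p (g' x) = πA x := by
    intro x
    have h1 : p ((i.symm (f x) : p.ker) : H) = 0 := (i.symm (f x)).2
    simp only [g', AddMonoidHom.sub_apply, map_sub, hg]
    change πA x - p ((i.symm (f x) : p.ker) : H) = πA x
    rw [h1, sub_zero]
  have hker : πA.ker ≤ g'.ker := by
    intro x hx
    have hx0 : (x : F) ∈ π.ker := congrArg Subtype.val hx
    have h1 : κ ⟨x, hx0⟩ = f x := (hf _).symm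
    have h2 : i.symm (f x) = ⟨g (j ⟨x, hx0⟩), hgj _⟩ := by
      rw [← h1]; exact i.symm_apply_apply _
    change g x - ((i.symm (f x) : p.ker) : H) = 0
    rw [h2]
    exact sub_self _
  let s := AddMonoidHom.liftOfSurjective πA hπA ⟨g', hker⟩
  refine ⟨s, ?_⟩
  ext a
  obtain ⟨x, rfl⟩ := hπA a
  have h1 : s (πA x) = g' x := AddMonoidHom.liftOfRightInverse_comp_apply _ _ _ ⟨g', hker⟩ x
  simp only [AddMonoidHom.comp_apply, AddMonoidHom.id_apply, h1, hpg']

theorem exists_not_extend {lam : Cardinal.{u}}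
    (hsmallnotW : ∀ (θ : Cardinal.{u}), Cardinal.aleph0 ≤ θ → θ < lam →
      ∀ (G : Type u) (inst : AddCommGroup G),
        Cardinal.mk G = θ → @IsKappaFree θ G inst → ¬ @IsFreeAbelian G inst →
          ¬ @IsWhitehead G inst)
    {F Q : Type u} [AddCommGroup F] [AddCommGroup Q] (π : F →+ Q)
    (hπ : Function.Surjective π) (hF : Module.Free ℤ F) (hQ : #Q < lam)
    (htf : ∀ m : ℤ, m ≠ 0 → ∀ y : Q, m • y = 0 → y = 0) (hnf : ¬ Module.Free ℤ Q) :
    ∃ κ : π.ker →+ ℤ, ∀ f : F →+ ℤ, ∃ x : π.ker, f x ≠ κ x := by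
  by_contra hcon
  push Not at hcon
  have hW := isWhitehead_of_extend π hπ hF hcon
  let S : Set Cardinal.{u} := {θ | ∃ A : AddSubgroup Q, #A = θ ∧ ¬ Module.Free ℤ A}
  have hS : S.Nonempty := ⟨_, ⊤, rfl, fun h => hnf (free_of_addEquiv AddSubgroup.topEquiv h)⟩
  obtain ⟨A, hA, hAnf⟩ := csInf_mem hS
  refine hsmallnotW (#A) ?_ ((Cardinal.mk_subtype_le _).trans_lt hQ) A _ rfl ?_ hAnf (hW A)
  · by_contra hlt
    have : Finite A := Cardinal.lt_aleph0_iff_finite.mp (not_le.mp hlt)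
    exact hAnf (free_of_finite_of_pure fun m hm y hy =>
      Subtype.ext (htf m hm y (congrArg Subtype.val hy)))
  · intro B hB
    by_contra hBnf
    have e : B ≃+ B.map A.subtype := AddSubgroup.equivMapOfInjective _ _ Subtype.val_injective
    have h1 : #(B.map A.subtype) ∈ S :=
      ⟨_, rfl, fun h => hBnf (free_of_addEquiv e.symm h)⟩
    have h2 := csInf_le' h1
    rw [← hA, ← Cardinal.mk_congr e.toEquiv] at h2
    exact absurd hB (not_lt.mpr h2)

/-- Elements of a free group supported in a set of generators. -/
def suppS {X : Type*} (C : Set X) : AddSubgroup (X →₀ ℤ) where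
  carrier := {y | ∀ x ∉ C, y x = 0}
  add_mem' := fun {a b} ha hb x hx => by rw [Finsupp.add_apply, ha x hx, hb x hx, add_zero]
  zero_mem' := fun _ _ => rfl
  neg_mem' := fun {a} ha x hx => by rw [Finsupp.neg_apply, ha x hx, neg_zero]

theorem mem_suppS_iff_support {X : Type*} {C : Set X} {y : X →₀ ℤ} :
    y ∈ suppS C ↔ (y.support : Set X) ⊆ C := by
  constructor
  · intro h x hx
    by_contra hxC
    exact Finsupp.mem_support_iff.mp hx (h x hxC)
  · intro h x hx
    by_contra hne
    exact hx (h (Finsupp.mem_support_iff.mpr hne))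

theorem suppS_mono {X : Type*} {C D : Set X} (h : C ⊆ D) : suppS C ≤ suppS D :=
  fun _ hy x hx => hy x fun hxC => hx (h hxC)

theorem single_mem_suppS {X : Type*} {C : Set X} {x : X} (hx : x ∈ C) (n : ℤ) :
    Finsupp.single x n ∈ suppS C := by
  classical
  intro y hy
  rw [Finsupp.single_apply, if_neg]
  rintro rfl
  exact hy hx

theorem suppS_induction {X : Type*} {C : Set X} {p : (X →₀ ℤ) → Prop} (h0 : p 0)
    (hadd : ∀ a b, p a → p b → p (a + b)) (hs : ∀ x ∈ C, ∀ n, p (Finsupp.single x n))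
    {y : X →₀ ℤ} (hy : y ∈ suppS C) : p y := by
  classical
  rw [mem_suppS_iff_support] at hy
  induction y using Finsupp.induction with
  | zero => exact h0
  | single_add x n f hxf hn ih =>
    have hsup : (Finsupp.single x n + f).support = insert x f.support := by
      rw [Finsupp.support_add_eq, Finsupp.support_single _ hn]
      · rfl
      · rw [Finsupp.support_single _ hn]
        simpa using hxf
    rw [hsup] at hy
    refine hadd _ _ (hs x (hy (by simp)) n) (ih fun z hz => hy ?_)
    simp only [Finset.coe_insert]
    exact Set.mem_insert_of_mem _ hz

theorem suppS_le {X : Type*} {C : Set X} {K : AddSubgroup (X →₀ ℤ)}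
    (h : ∀ x ∈ C, Finsupp.single x 1 ∈ K) : suppS C ≤ K := by
  intro y hy
  refine suppS_induction (p := fun y => y ∈ K) K.zero_mem (fun a b => K.add_mem) ?_ hy
  intro x hx n
  have := K.zsmul_mem (h x hx) n
  rwa [Finsupp.smul_single, smul_eq_mul, mul_one] at this

theorem free_range_of_ker {A B C : Type*} [AddCommGroup A] [AddCommGroup B] [AddCommGroup C]
    (f : A →+ B) (g : A →+ C) (h : ∀ x, f x = 0 ↔ g x = 0) (hC : Module.Free ℤ C) :
    Module.Free ℤ f.range := by
  have hle : f.rangeRestrict.ker ≤ g.ker := by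
    intro x hx
    exact (h x).mp (congrArg Subtype.val hx)
  let k := AddMonoidHom.liftOfSurjective f.rangeRestrict f.rangeRestrict_surjective ⟨g, hle⟩
  have hk : ∀ x, k (f.rangeRestrict x) = g x := fun x =>
    AddMonoidHom.liftOfRightInverse_comp_apply _ _ _ ⟨g, hle⟩ x
  refine free_of_injective hC k ?_
  rw [injective_iff_map_eq_zero]
  intro y hy
  obtain ⟨x, rfl⟩ := f.rangeRestrict_surjective y
  rw [hk] at hy
  exact Subtype.ext ((h x).mpr hy)

/-- A leveled system of relations `x = tail x` (for `x ∈ R`) between generators. -/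
structure RelSys (X : Type u) where
  /-- the generators carrying a relation -/
  R : Set X
  /-- the level of a generator -/
  lev : X → ℕ
  /-- the right hand side of a relation -/
  tail : X → (X →₀ ℤ)
  lev_lt : ∀ v ∈ R, ∀ u ∈ R, tail v u ≠ 0 → lev v < lev u

namespace RelSys

variable {X : Type u} (P : RelSys X)

/-- The relation attached to a generator. -/
noncomputable def rho (v : X) : X →₀ ℤ := Finsupp.single v 1 - P.tail v

/-- The linear extension of `rho`. -/
noncomputable def rel : (X →₀ ℤ) →+ (X →₀ ℤ) :=
  (Finsupp.linearCombination ℤ P.rho).toAddMonoidHom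

theorem rel_single (v : X) (n : ℤ) : P.rel (Finsupp.single v n) = n • P.rho v := by
  simp [rel]

theorem rel_apply (c : X →₀ ℤ) (u : X) : P.rel c u = c.sum fun v n => n * P.rho v u := by
  simp [rel, Finsupp.linearCombination_apply, Finsupp.sum, Finsupp.finsetSum_apply]

/-- Kill the generators outside `D` and impose the relations of the generators in `D`. -/
noncomputable def U (D : Set X) : AddSubgroup (X →₀ ℤ) where
  carrier := {y | ∃ c ∈ suppS (D ∩ P.R), ∀ x ∈ D, (y - P.rel c) x = 0}
  add_mem' := by
    rintro a b ⟨c, hc, ha⟩ ⟨d, hd, hb⟩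
    refine ⟨c + d, add_mem hc hd, fun x hx => ?_⟩
    have h1 := ha x hx
    have h2 := hb x hx
    rw [map_add, add_sub_add_comm, Finsupp.add_apply, h1, h2, add_zero]
  zero_mem' := ⟨0, zero_mem _, fun x _ => by simp⟩
  neg_mem' := by
    rintro a ⟨c, hc, ha⟩
    refine ⟨-c, neg_mem hc, fun x hx => ?_⟩
    have h1 := ha x hx
    rw [map_neg, ← neg_sub', Finsupp.neg_apply, h1, neg_zero]

theorem mem_U_of_vanish {D : Set X} {y : X →₀ ℤ} (h : ∀ x ∈ D, y x = 0) : y ∈ P.U D :=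
  ⟨0, zero_mem _, fun x hx => by simp [h x hx]⟩

theorem rel_mem_U {D : Set X} {c : X →₀ ℤ} (hc : c ∈ suppS (D ∩ P.R)) : P.rel c ∈ P.U D :=
  ⟨c, hc, fun x _ => by simp⟩

theorem single_mem_U {D : Set X} {x : X} (hx : x ∉ D) (n : ℤ) : Finsupp.single x n ∈ P.U D := by
  classical
  refine P.mem_U_of_vanish fun y hy => ?_
  rw [Finsupp.single_apply, if_neg]
  rintro rfl
  exact hx hy

theorem rho_mem_U {D : Set X} {v : X} (hv : v ∈ D) (hR : v ∈ P.R) : P.rho v ∈ P.U D := by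
  have := P.rel_mem_U (single_mem_suppS (C := D ∩ P.R) ⟨hv, hR⟩ 1)
  rwa [rel_single, one_smul] at this

theorem U_le {D : Set X} {K : AddSubgroup (X →₀ ℤ)} (h1 : ∀ x ∉ D, Finsupp.single x 1 ∈ K)
    (h2 : ∀ v ∈ D, v ∈ P.R → P.rho v ∈ K) : P.U D ≤ K := by
  rintro y ⟨c, hc, hy⟩
  have h3 : y - P.rel c ∈ suppS Dᶜ := fun x hx => hy x (not_not.mp hx)
  have h4 : y - P.rel c ∈ K := suppS_le h1 h3
  have h5 : P.rel c ∈ K := by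
    refine suppS_induction (p := fun c => P.rel c ∈ K) (by simp) ?_ ?_ hc
    · intro a b ha hb; rw [map_add]; exact add_mem ha hb
    · intro x hx n; rw [rel_single]; exact K.zsmul_mem (h2 x hx.1 hx.2) n
  simpa using add_mem h4 h5

theorem sub_filter_mem_U (D : Set X) [DecidablePred (· ∈ D)] (y : X →₀ ℤ) :
    y - y.filter (· ∈ D) ∈ P.U D :=
  P.mem_U_of_vanish fun x hx => by rw [Finsupp.sub_apply, Finsupp.filter_apply_pos _ _ hx, sub_self]

theorem filter_mem_suppS (D : Set X) [DecidablePred (· ∈ D)] (y : X →₀ ℤ) :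
    y.filter (· ∈ D) ∈ suppS D := fun _ hx => Finsupp.filter_apply_neg _ _ hx

/-- `C` is a part of `D` closed under the tails. -/
def Cl (C D : Set X) : Prop :=
  C ⊆ D ∧ ∀ v ∈ C, v ∈ P.R → ∀ u ∈ D, P.tail v u ≠ 0 → u ∈ C

theorem rho_apply_of_ne {v u : X} (h : v ≠ u) : P.rho v u = - P.tail v u := by
  simp [rho, Finsupp.single_eq_of_ne' h]

theorem mem_U_of_closed {C D : Set X} (h : P.Cl C D) {y : X →₀ ℤ} (hy : y ∈ suppS C)
    (hyD : y ∈ P.U D) : y ∈ P.U C := by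
  classical
  obtain ⟨c, hc, hcy⟩ := hyD
  have hcC : ∀ v, v ∉ C → c v = 0 := by
    by_contra hcon
    push Not at hcon
    let T := c.support.filter (· ∉ C)
    have hT : T.Nonempty := by
      obtain ⟨v, hv, hne⟩ := hcon
      exact ⟨v, Finset.mem_filter.mpr ⟨Finsupp.mem_support_iff.mpr hne, hv⟩⟩
    obtain ⟨v, hvT, hmin⟩ := Finset.exists_min_image T P.lev hT
    obtain ⟨hvs, hvC⟩ := Finset.mem_filter.mp hvT
    have hDR : ∀ u ∈ c.support, u ∈ D ∩ P.R := fun u hu => mem_suppS_iff_support.mp hc hu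
    have h1 := hcy v (hDR v hvs).1
    rw [Finsupp.sub_apply, hy v hvC, zero_sub, neg_eq_zero, rel_apply, Finsupp.sum,
      Finset.sum_eq_single v] at h1
    · have htv : P.tail v v = 0 := by
        by_contra hne
        exact lt_irrefl _ (P.lev_lt v (hDR v hvs).2 v (hDR v hvs).2 hne)
      rw [rho, Finsupp.sub_apply, htv, Finsupp.single_eq_same] at h1
      exact Finsupp.mem_support_iff.mp hvs (by simpa using h1)
    · intro u hu huv
      rw [P.rho_apply_of_ne huv]
      suffices P.tail u v = 0 by rw [this]; simp
      by_contra hne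
      by_cases huC : u ∈ C
      · exact hvC (h.2 u huC (hDR u hu).2 v (hDR v hvs).1 hne)
      · have h2 := P.lev_lt u (hDR u hu).2 v (hDR v hvs).2 hne
        have h3 := hmin u (Finset.mem_filter.mpr ⟨hu, huC⟩)
        omega
    · intro h; exact absurd hvs h
  refine ⟨c, ?_, fun x hx => hcy x (h.1 hx)⟩
  intro x hx
  by_cases hxC : x ∈ C
  · exact hc x fun hx' => hx ⟨hxC, hx'.2⟩
  · exact hcC x hxC

theorem U_le_diff {A D : Set X} (h : P.Cl A D) : P.U D ≤ P.U (D \ A) := by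
  apply P.U_le
  · intro x hx
    exact P.single_mem_U (fun hx' => hx hx'.1) 1
  · intro v hv hR
    by_cases hvA : v ∈ A
    · refine P.mem_U_of_vanish fun u hu => ?_
      rw [P.rho_apply_of_ne (v := v) (u := u) (fun h => hu.2 (h ▸ hvA)), neg_eq_zero]
      by_contra hne
      exact hu.2 (h.2 v hvA hR u hu.1 hne)
    · exact P.rho_mem_U ⟨hv, hvA⟩ hR

theorem free_image_of_closed {C D : Set X} (h : P.Cl C D)
    (hC : Module.Free ℤ ((X →₀ ℤ) ⧸ P.U C)) :
    Module.Free ℤ ((suppS C).map (QuotientAddGroup.mk' (P.U D))) := by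
  have h1 := free_range_of_ker ((QuotientAddGroup.mk' (P.U D)).comp (suppS C).subtype)
    ((QuotientAddGroup.mk' (P.U C)).comp (suppS C).subtype) ?_ hC
  · have : ((QuotientAddGroup.mk' (P.U D)).comp (suppS C).subtype).range =
        (suppS C).map (QuotientAddGroup.mk' (P.U D)) := by
      rw [AddMonoidHom.range_comp, AddSubgroup.range_subtype]
    rw [this] at h1
    exact h1
  · rintro ⟨y, hy⟩
    change ((y : (X →₀ ℤ) ⧸ P.U D) = 0) ↔ ((y : (X →₀ ℤ) ⧸ P.U C) = 0)
    rw [QuotientAddGroup.eq_zero_iff, QuotientAddGroup.eq_zero_iff]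
    refine ⟨P.mem_U_of_closed h hy, ?_⟩
    rintro ⟨c, hc, hcy⟩
    have hcD : c ∈ suppS (D ∩ P.R) := suppS_mono (Set.inter_subset_inter_left _ h.1) hc
    refine ⟨c, hcD, fun x hx => ?_⟩
    by_cases hxC : x ∈ C
    · exact hcy x hxC
    · rw [Finsupp.sub_apply, hy x hxC, zero_sub, neg_eq_zero, rel_apply, Finsupp.sum]
      refine Finset.sum_eq_zero fun v hv => ?_
      have hvC := mem_suppS_iff_support.mp hc hv
      rw [P.rho_apply_of_ne (v := v) (u := x) (fun h => hxC (h ▸ hvC.1))]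
      suffices P.tail v x = 0 by rw [this]; simp
      by_contra hne
      exact hxC (h.2 v hvC.1 hvC.2 x hx hne)

theorem free_of_closed_filtration {ι : Type*} [LinearOrder ι] [WellFoundedLT ι] [Nonempty ι]
    (D : Set X) (C : ι → Set X) (hC : Monotone C) (hcov : D = ⋃ i, C i) (hcl : ∀ i, P.Cl (C i) D)
    (hfree : ∀ i, Module.Free ℤ ((X →₀ ℤ) ⧸ P.U (C i \ ⋃ j : Set.Iio i, C j))) :
    Module.Free ℤ ((X →₀ ℤ) ⧸ P.U D) := by
  classical
  have hfin : ∀ s : Finset X, ∀ i, s.Nonempty → (s : Set X) ⊆ (⋃ j : Set.Iio i, C j) →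
      ∃ j < i, (s : Set X) ⊆ C j := by
    intro s i hs
    induction hs using Finset.Nonempty.cons_induction with
    | singleton a =>
      intro h
      obtain ⟨⟨j, hj⟩, ha⟩ := Set.mem_iUnion.mp (h (by simp : a ∈ _))
      exact ⟨j, hj, by simpa using ha⟩
    | cons a s has hs ih =>
      intro h
      simp only [Finset.coe_cons, Set.insert_subset_iff] at h ⊢
      obtain ⟨⟨j, hj⟩, ha⟩ := Set.mem_iUnion.mp h.1
      obtain ⟨j', hj', hs'⟩ := ih h.2
      exact ⟨max j j', max_lt hj hj', hC (le_max_left _ _) ha,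
        hs'.trans (hC (le_max_right _ _))⟩
  have hltcl : ∀ i, P.Cl (⋃ j : Set.Iio i, C j) (C i) := by
    intro i
    refine ⟨Set.iUnion_subset fun j => hC j.2.le, fun v hv hR u hu hne => ?_⟩
    obtain ⟨j, hj⟩ := Set.mem_iUnion.mp hv
    exact Set.mem_iUnion.mpr ⟨j, (hcl j).2 v hj hR u ((hcl i).1 hu) hne⟩
  have hUle : ∀ i y, y ∈ suppS (C i) → y ∈ P.U D → y ∈ P.U (C i \ ⋃ j : Set.Iio i, C j) :=
    fun i y hy hyD => P.U_le_diff (hltcl i) (P.mem_U_of_closed (hcl i) hy hyD)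
  refine free_of_filtration (P.U D) (fun i => suppS (C i)) (fun i j hij => suppS_mono (hC hij))
    (fun i => QuotientAddGroup.mk' (P.U (C i \ ⋃ j : Set.Iio i, C j)))
    (fun i => free_subgroup (hfree i) _) ?_ ?_
  · intro i y hy
    change ((y : (X →₀ ℤ) ⧸ P.U (C i \ ⋃ j : Set.Iio i, C j)) = 0) ↔ _
    rw [QuotientAddGroup.eq_zero_iff]
    constructor
    · rintro ⟨c, hc, hcy⟩
      have hcD : c ∈ suppS (D ∩ P.R) :=
        suppS_mono (Set.inter_subset_inter_left _ (Set.sdiff_subset.trans (hcl i).1)) hc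
      let κ := y - P.rel c
      let κ1 := κ.filter (· ∈ ⋃ j : Set.Iio i, C j)
      have hrelc : ∀ x ∈ D, x ∉ C i → P.rel c x = 0 := by
        intro x hx hxC
        rw [rel_apply, Finsupp.sum]
        refine Finset.sum_eq_zero fun v hv => ?_
        have hvC := mem_suppS_iff_support.mp hc hv
        rw [P.rho_apply_of_ne (v := v) (u := x) (fun h => hxC (h ▸ hvC.1.1))]
        suffices P.tail v x = 0 by rw [this]; simp
        by_contra hne
        exact hxC ((hcl i).2 v hvC.1.1 hvC.2 x hx hne)
      have hyκ : y - κ1 ∈ P.U D := by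
        have h1 : κ - κ1 ∈ P.U D := by
          refine P.mem_U_of_vanish fun x hx => ?_
          by_cases hxl : x ∈ ⋃ j : Set.Iio i, C j
          · rw [Finsupp.sub_apply, Finsupp.filter_apply_pos _ _ hxl, sub_self]
          · rw [Finsupp.sub_apply, Finsupp.filter_apply_neg _ _ hxl, sub_zero]
            by_cases hxC : x ∈ C i
            · exact hcy x ⟨hxC, hxl⟩
            · rw [Finsupp.sub_apply, hy x hxC, hrelc x hx hxC, sub_self]
        have h2 := add_mem h1 (P.rel_mem_U hcD)
        have h3 : κ - κ1 + P.rel c = y - κ1 := by simp only [κ]; abel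
        rwa [h3] at h2
      by_cases h0 : κ1 = 0
      · left; simpa [h0] using hyκ
      · right
        have h1 : (κ1.support : Set X) ⊆ ⋃ j : Set.Iio i, C j :=
          mem_suppS_iff_support.mp (filter_mem_suppS _ _)
        obtain ⟨j, hj, hs⟩ := hfin _ i (Finsupp.support_nonempty_iff.mpr h0) h1
        exact ⟨j, hj, κ1, mem_suppS_iff_support.mpr hs, hyκ⟩
    · rintro (h | ⟨j, hj, y', hy', h⟩)
      · exact hUle i y hy h
      · have h1 := hUle i _ (sub_mem hy (suppS_mono (hC hj.le) hy')) h
        have h2 : y' ∈ P.U (C i \ ⋃ j : Set.Iio i, C j) := by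
          refine P.mem_U_of_vanish fun x hx => ?_
          exact hy' x fun hxj => hx.2 (Set.mem_iUnion.mpr ⟨⟨j, hj⟩, hxj⟩)
        simpa using add_mem h1 h2
  · intro y
    let y' := y.filter (· ∈ D)
    have hy' : y - y' ∈ P.U D := P.sub_filter_mem_U D y
    by_cases h0 : y' = 0
    · obtain ⟨i⟩ := ‹Nonempty ι›
      exact ⟨i, 0, zero_mem _, by simpa [h0] using hy'⟩
    · have hsub : (y'.support : Set X) ⊆ ⋃ i, C i := by
        rw [← hcov]; exact mem_suppS_iff_support.mp (filter_mem_suppS _ _)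
      obtain ⟨i, hi⟩ := (hC.directed_le).exists_mem_subset_of_finset_subset_biUnion
        (s := y'.support) hsub
      exact ⟨i, y', mem_suppS_iff_support.mpr hi, hy'⟩

end RelSys

theorem exists_push {G Y : Type*} [AddCommGroup Y] {Q : ℕ → Set G} {x : ℕ → G → (G →₀ ℤ)}
    {t : ℕ → G → Y} {K : AddSubgroup Y} (hQ : ∀ n, ∀ e ∈ Q n, x n e ∈ suppS (Q (n + 1)))
    (ht : ∀ n, ∀ e ∈ Q n, t n e - Finsupp.linearCombination ℤ (t (n + 1)) (x n e) ∈ K)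
    {n m : ℕ} (h : n ≤ m) {c : G →₀ ℤ} (hc : c ∈ suppS (Q n)) :
    ∃ c' ∈ suppS (Q m),
      Finsupp.linearCombination ℤ (t n) c - Finsupp.linearCombination ℤ (t m) c' ∈ K := by
  induction m, h using Nat.le_induction with
  | base => exact ⟨c, hc, by simp⟩
  | succ m _ ih =>
    obtain ⟨c', hc', hK⟩ := ih
    have key : ∃ c'' ∈ suppS (Q (m + 1)), Finsupp.linearCombination ℤ (t m) c' -
        Finsupp.linearCombination ℤ (t (m + 1)) c'' ∈ K := by
      refine suppS_induction (p := fun c' => ∃ c'' ∈ suppS (Q (m + 1)),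
        Finsupp.linearCombination ℤ (t m) c' -
        Finsupp.linearCombination ℤ (t (m + 1)) c'' ∈ K) ⟨0, zero_mem _, by simp⟩ ?_ ?_ hc'
      · rintro a b ⟨a', ha', ha⟩ ⟨b', hb', hb⟩
        refine ⟨a' + b', add_mem ha' hb', ?_⟩
        rw [map_add, map_add, add_sub_add_comm]
        exact add_mem ha hb
      · intro e he k
        refine ⟨k • x m e, (suppS _).zsmul_mem (hQ m e he) k, ?_⟩
        rw [Finsupp.linearCombination_single, map_smul, ← smul_sub]
        exact K.zsmul_mem (ht m e he) k
    obtain ⟨c'', hc'', hK'⟩ := key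
    exact ⟨c'', hc'', by simpa using add_mem hK hK'⟩

theorem exists_normal {G Y : Type*} [AddCommGroup Y] {Q : ℕ → Set G} {x : ℕ → G → (G →₀ ℤ)}
    {t : ℕ → G → Y} {K : AddSubgroup Y} (hQ : ∀ n, ∀ e ∈ Q n, x n e ∈ suppS (Q (n + 1)))
    (ht : ∀ n, ∀ e ∈ Q n, t n e - Finsupp.linearCombination ℤ (t (n + 1)) (x n e) ∈ K)
    {y : Y} (hy : y ∈ AddSubgroup.closure ({w | ∃ n, ∃ e ∈ Q n, w = t n e} ∪ K)) :
    ∃ M, ∃ c ∈ suppS (Q M), y - Finsupp.linearCombination ℤ (t M) c ∈ K := by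
  induction hy using AddSubgroup.closure_induction with
  | mem w hw =>
    rcases hw with ⟨n, e, he, rfl⟩ | hw
    · exact ⟨n, Finsupp.single e 1, single_mem_suppS he 1, by simp⟩
    · exact ⟨0, 0, zero_mem _, by simpa using hw⟩
  | zero => exact ⟨0, 0, zero_mem _, by simp⟩
  | add a b _ _ ha hb =>
    obtain ⟨M, c, hc, h1⟩ := ha
    obtain ⟨M', c', hc', h2⟩ := hb
    obtain ⟨d, hd, h3⟩ := exists_push hQ ht (le_max_left M M') hc
    obtain ⟨d', hd', h4⟩ := exists_push hQ ht (le_max_right M M') hc'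
    refine ⟨max M M', d + d', add_mem hd hd', ?_⟩
    have := add_mem (add_mem h1 h3) (add_mem h2 h4)
    rw [map_add]
    convert this using 1
    abel
  | neg a _ ha =>
    obtain ⟨M, c, hc, h1⟩ := ha
    refine ⟨M, -c, neg_mem hc, ?_⟩
    rw [map_neg, ← neg_sub']
    exact neg_mem h1

/-- The union of the members of an increasing chain strictly below an index. -/
def below {G Λ : Type*} [AddCommGroup G] [LinearOrder Λ] (N : Λ → AddSubgroup G) (δ : Λ) :
    AddSubgroup G := ⨆ γ : Set.Iio δ, N γ

theorem mem_below {G Λ : Type*} [AddCommGroup G] [LinearOrder Λ] {N : Λ → AddSubgroup G}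
    (hN : Monotone N) {δ : Λ} {a : G} : a ∈ below N δ ↔ a = 0 ∨ ∃ γ < δ, a ∈ N γ := by
  constructor
  · intro h
    by_cases hne : Nonempty (Set.Iio δ)
    · obtain ⟨γ, hγ⟩ := (AddSubgroup.mem_iSup_of_directed (K := fun γ : Set.Iio δ => N γ)
        (Monotone.directed_le fun a b hab => hN hab)).mp h
      exact Or.inr ⟨γ, γ.2, hγ⟩
    · have := not_nonempty_iff.mp hne
      left
      rw [below, iSup_of_empty] at h
      simpa using h
  · rintro (rfl | ⟨γ, hγ, h⟩)
    · exact zero_mem _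
    · exact (le_iSup (fun γ : Set.Iio δ => N γ) ⟨γ, hγ⟩) h

theorem le_below {G Λ : Type*} [AddCommGroup G] [LinearOrder Λ] {N : Λ → AddSubgroup G}
    {γ δ : Λ} (h : γ < δ) : N γ ≤ below N δ :=
  le_iSup (fun γ : Set.Iio δ => N γ) ⟨γ, h⟩

theorem below_le {G Λ : Type*} [AddCommGroup G] [LinearOrder Λ] {N : Λ → AddSubgroup G}
    (hN : Monotone N) (δ : Λ) : below N δ ≤ N δ :=
  iSup_le fun γ => hN γ.2.le

/-- A filtration of a group by towers, with the data of a system of relations. -/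
structure Frame (G Λ : Type u) [AddCommGroup G] [LinearOrder Λ] where
  /-- the filtration -/
  N : Λ → AddSubgroup G
  mono : Monotone N
  /-- the active indices -/
  S : Set Λ
  /-- towers of independent sets -/
  E : Λ → ℕ → Set G
  /-- expressions in the next set of the tower -/
  x : Λ → ℕ → G → (G →₀ ℤ)
  /-- gadget symbols -/
  V : ℕ → Type u
  /-- levels of the remainders -/
  ζ : Λ → ℕ → G → Λ
  /-- gadget relations -/
  bd : Λ → Λ → (n : ℕ) → G → (V n →₀ ℤ)
  /-- constants -/
  g : Λ → ℕ → G → ℤ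
  E_sub : ∀ δ n, E δ n ⊆ N δ
  E_ind : ∀ δ n, ∀ c ∈ suppS (E δ n), ev c ∈ below N δ → c = 0
  x_supp : ∀ δ n, ∀ e ∈ E δ n, x δ n e ∈ suppS (E δ (n + 1))
  x_mem : ∀ δ n, ∀ e ∈ E δ n, e - ev (x δ n e) ∈ below N δ
  E_span : ∀ δ, ∀ a ∈ N δ, ∃ n, ∃ c ∈ suppS (E δ n), a - ev c ∈ below N δ
  ζ_lt : ∀ δ ∈ S, ∀ n, ∀ e ∈ E δ n, ζ δ n e < δ
  ζ_mem : ∀ δ ∈ S, ∀ n, ∀ e ∈ E δ n, e - ev (x δ n e) ∈ N (ζ δ n e)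
  pot : ∀ n k ζ (T : Finset Λ), T.card ≤ n →
    ∃ φ : V n → ℤ, ∀ δ ∈ T, Finsupp.linearCombination ℤ φ (bd δ ζ n k) = 1

/-- Generators: one constant, gadget symbols, and copies of the towers. -/
inductive Item (G Λ : Type u) (V : ℕ → Type u) : Type u
  | z : Item G Λ V
  | sym (k : G) (ζ : Λ) (n : ℕ) (y : V n) : Item G Λ V
  | real (δ : Λ) (n : ℕ) (e : G) : Item G Λ V

theorem Item.real_injective {G Λ : Type u} {V : ℕ → Type u} (δ : Λ) (n : ℕ) :
    Function.Injective (Item.real δ n : G → Item G Λ V) :=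
  fun a b h => by injection h

theorem Item.sym_injective {G Λ : Type u} {V : ℕ → Type u} (k : G) (ζ : Λ) (n : ℕ) :
    Function.Injective (Item.sym k ζ n : V n → Item G Λ V) :=
  fun a b h => by injection h

namespace Frame

variable {G Λ : Type u} [AddCommGroup G] [LinearOrder Λ] (P : Frame G Λ)

/-- The generators of a frame. -/
abbrev X := Item G Λ P.V

/-- The remainder of an expression in the tower. -/
noncomputable def k (δ : Λ) (n : ℕ) (e : G) : G := e - ev (P.x δ n e)

/-- The right hand sides of the relations of a frame. -/
noncomputable def tail : P.X → (P.X →₀ ℤ)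
  | .z => 0
  | .sym _ _ _ _ => 0
  | .real δ n e => (P.x δ n e).mapDomain (Item.real δ (n + 1)) +
      (P.bd δ (P.ζ δ n e) n (P.k δ n e)).mapDomain (Item.sym (P.k δ n e) (P.ζ δ n e) n) +
      Finsupp.single Item.z (P.g δ n e)

/-- The level of a generator. -/
def lev : P.X → ℕ
  | .z => 0
  | .sym _ _ _ _ => 0
  | .real _ n _ => n

/-- Generators at indices in a set. -/
def items (J : Set Λ) : Set P.X
  | .z => True
  | .sym k ζ _ _ => ζ ∈ J ∧ k ∈ P.N ζ
  | .real δ n e => δ ∈ J ∧ δ ∈ P.S ∧ e ∈ P.E δ n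

/-- The generators carrying a relation. -/
def rset : Set P.X
  | .z => False
  | .sym _ _ _ _ => False
  | .real δ n e => δ ∈ P.S ∧ e ∈ P.E δ n

theorem z_mem_items (J : Set Λ) : Item.z ∈ P.items J := trivial

theorem sym_mem_items {J : Set Λ} {k ζ n y} :
    Item.sym k ζ n y ∈ P.items J ↔ ζ ∈ J ∧ k ∈ P.N ζ := Iff.rfl

theorem real_mem_items {J : Set Λ} {δ n e} :
    Item.real δ n e ∈ P.items J ↔ δ ∈ J ∧ δ ∈ P.S ∧ e ∈ P.E δ n := Iff.rfl

theorem real_mem_rset {δ n e} : Item.real δ n e ∈ P.rset ↔ δ ∈ P.S ∧ e ∈ P.E δ n := Iff.rfl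

theorem exists_real_of_mem_rset {v : P.X} (hv : v ∈ P.rset) :
    ∃ δ n e, v = Item.real δ n e ∧ δ ∈ P.S ∧ e ∈ P.E δ n := by
  match v, hv with
  | .real δ n e, hv => exact ⟨δ, n, e, rfl, hv⟩

theorem items_mono {J J' : Set Λ} (h : J ⊆ J') : P.items J ⊆ P.items J' := by
  intro v hv
  match v, hv with
  | .z, _ => trivial
  | .sym _ _ _ _, hv => exact ⟨h hv.1, hv.2⟩
  | .real _ _ _, hv => exact ⟨h hv.1, hv.2⟩

theorem tail_real_real_ne {δ n e δ' n' e'}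
    (h : P.tail (Item.real δ n e) (Item.real δ' n' e') ≠ 0) :
    δ' = δ ∧ n' = n + 1 ∧ P.x δ n e e' ≠ 0 := by
  classical
  simp only [tail, Finsupp.add_apply] at h
  have h2 : (P.bd δ (P.ζ δ n e) n (P.k δ n e)).mapDomain (Item.sym (P.k δ n e) (P.ζ δ n e) n)
      (Item.real δ' n' e') = 0 := Finsupp.mapDomain_of_notMem_range _ _ (by rintro ⟨y, hy⟩; cases hy)
  have h3 : (Finsupp.single Item.z (P.g δ n e) : P.X →₀ ℤ) (Item.real δ' n' e') = 0 :=
    Finsupp.single_eq_of_ne (by intro h; cases h)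
  rw [h2, h3, add_zero, add_zero] at h
  by_cases hr : ∃ a, (Item.real δ (n + 1) a : P.X) = Item.real δ' n' e'
  · obtain ⟨a, ha⟩ := hr
    injection ha with e1 e2 e3
    subst e1 e2 e3
    rw [Finsupp.mapDomain_apply (Item.real_injective _ _)] at h
    exact ⟨rfl, rfl, h⟩
  · exact absurd (Finsupp.mapDomain_of_notMem_range _ _ (by simpa using hr)) h

theorem tail_real_sym_ne {δ n e k' ζ' n' y}
    (h : P.tail (Item.real δ n e) (Item.sym k' ζ' n' y) ≠ 0) :
    k' = P.k δ n e ∧ ζ' = P.ζ δ n e := by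
  classical
  simp only [tail, Finsupp.add_apply] at h
  have h2 : (P.x δ n e).mapDomain (Item.real δ (n + 1))
      (Item.sym k' ζ' n' y : P.X) = 0 :=
    Finsupp.mapDomain_of_notMem_range _ _ (by rintro ⟨y, hy⟩; cases hy)
  have h3 : (Finsupp.single Item.z (P.g δ n e) : P.X →₀ ℤ) (Item.sym k' ζ' n' y) = 0 :=
    Finsupp.single_eq_of_ne (by intro h; cases h)
  rw [h2, h3, zero_add, add_zero] at h
  by_cases hr : ∃ a, (Item.sym (P.k δ n e) (P.ζ δ n e) n a : P.X) = Item.sym k' ζ' n' y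
  · obtain ⟨a, ha⟩ := hr
    injection ha with h1 h2 h3
    exact ⟨h1.symm, h2.symm⟩
  · exact absurd (Finsupp.mapDomain_of_notMem_range _ _ (by simpa using hr)) h

/-- The system of relations of a frame. -/
noncomputable def sys : RelSys P.X where
  R := P.rset
  lev := P.lev
  tail := P.tail
  lev_lt := by
    intro v hv u hu h
    obtain ⟨δ, n, e, rfl, -⟩ := P.exists_real_of_mem_rset hv
    obtain ⟨δ', n', e', rfl, -⟩ := P.exists_real_of_mem_rset hu
    obtain ⟨-, rfl, -⟩ := P.tail_real_real_ne h
    exact Nat.lt_succ_self n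

end Frame

namespace Frame

variable {G Λ : Type u} [AddCommGroup G] [LinearOrder Λ] (P : Frame G Λ)

theorem tail_real_real (δ : Λ) (n : ℕ) (e e' : G) :
    P.tail (Item.real δ n e) (Item.real δ (n + 1) e') = P.x δ n e e' := by
  classical
  simp only [tail, Finsupp.add_apply]
  rw [Finsupp.mapDomain_apply (Item.real_injective _ _), Finsupp.mapDomain_of_notMem_range,
    Finsupp.single_eq_of_ne, add_zero, add_zero]
  · intro h; cases h
  · rintro ⟨y, hy⟩; cases hy

theorem tail_real_sym (δ : Λ) (n : ℕ) (e : G) (y : P.V n) :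
    P.tail (Item.real δ n e) (Item.sym (P.k δ n e) (P.ζ δ n e) n y) =
      P.bd δ (P.ζ δ n e) n (P.k δ n e) y := by
  classical
  simp only [tail, Finsupp.add_apply]
  rw [Finsupp.mapDomain_apply (Item.sym_injective _ _ _), Finsupp.mapDomain_of_notMem_range,
    Finsupp.single_eq_of_ne, add_zero, zero_add]
  · intro h; cases h
  · rintro ⟨y, hy⟩; cases hy

/-- The part of a tower whose generators lie in a given set. -/
def tw (A : Set P.X) (δ : Λ) (n : ℕ) : Set G := {e | e ∈ P.E δ n ∧ Item.real δ n e ∈ A}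

/-- The subgroup generated by the tower elements in a set of generators. -/
def Lg (A : Set P.X) (J : Set Λ) : AddSubgroup G :=
  AddSubgroup.closure {e | ∃ γ ∈ J, ∃ n, e ∈ P.tw A γ n}

theorem tw_mono {A A' : Set P.X} (h : A ⊆ A') (δ : Λ) (n : ℕ) : P.tw A δ n ⊆ P.tw A' δ n :=
  fun _ he => ⟨he.1, h he.2⟩

theorem Lg_mono {A A' : Set P.X} (h : A ⊆ A') {J J' : Set Λ} (hJ : J ⊆ J') :
    P.Lg A J ≤ P.Lg A' J' := by
  apply AddSubgroup.closure_mono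
  rintro e ⟨γ, hγ, n, he⟩
  exact ⟨γ, hJ hγ, n, P.tw_mono h γ n he⟩

theorem mem_Lg {A : Set P.X} {J : Set Λ} {γ : Λ} (hγ : γ ∈ J) {n : ℕ} {e : G}
    (he : e ∈ P.tw A γ n) : e ∈ P.Lg A J :=
  AddSubgroup.subset_closure ⟨γ, hγ, n, he⟩

theorem ev_mem {C : Set G} {K : AddSubgroup G} (h : C ⊆ K) {c : G →₀ ℤ} (hc : c ∈ suppS C) :
    ev c ∈ K := by
  refine suppS_induction (p := fun c => ev c ∈ K) (by simp) ?_ ?_ hc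
  · intro a b ha hb; rw [map_add]; exact add_mem ha hb
  · intro x hx n; rw [ev_single]; exact K.zsmul_mem (h hx) n

theorem Lg_Iic_le (A : Set P.X) (γ : Λ) : P.Lg A (Set.Iic γ) ≤ P.N γ := by
  rw [Lg, AddSubgroup.closure_le]
  rintro e ⟨γ', hγ', n, he⟩
  exact P.mono hγ' (P.E_sub _ _ he.1)

theorem Lg_Iio_le (A : Set P.X) (γ : Λ) : P.Lg A (Set.Iio γ) ≤ below P.N γ := by
  rw [Lg, AddSubgroup.closure_le]
  rintro e ⟨γ', hγ', n, he⟩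
  exact le_below hγ' (P.E_sub _ _ he.1)

theorem exists_of_mem_Lg_Iio {A : Set P.X} {γ δ : Λ} (hδ : δ < γ) {a : G}
    (ha : a ∈ P.Lg A (Set.Iio γ)) : ∃ γ' < γ, a ∈ P.Lg A (Set.Iic γ') := by
  induction ha using AddSubgroup.closure_induction with
  | mem a ha =>
    obtain ⟨γ', hγ', n, he⟩ := ha
    exact ⟨γ', hγ', P.mem_Lg (J := Set.Iic γ') (le_refl γ') he⟩
  | zero => exact ⟨δ, hδ, zero_mem _⟩
  | add a b _ _ ha hb =>
    obtain ⟨γ', hγ', h1⟩ := ha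
    obtain ⟨γ'', hγ'', h2⟩ := hb
    refine ⟨max γ' γ'', max_lt hγ' hγ'', add_mem
      (P.Lg_mono le_rfl (Set.Iic_subset_Iic.mpr (le_max_left _ _)) h1)
      (P.Lg_mono le_rfl (Set.Iic_subset_Iic.mpr (le_max_right _ _)) h2)⟩
  | neg a _ ha =>
    obtain ⟨γ', hγ', h1⟩ := ha
    exact ⟨γ', hγ', neg_mem h1⟩

/-- A set of generators closed under tails, whose tower elements generate the remainders. -/
structure OC (A : Set P.X) : Prop where
  tail : ∀ v ∈ A, ∀ u, P.tail v u ≠ 0 → u ∈ A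
  real : ∀ γ n, ∀ e ∈ P.tw A γ n, P.k γ n e ∈ P.Lg A (Set.Iio γ)
  sym : ∀ k ζ n y, Item.sym k ζ n y ∈ A → k ∈ P.N ζ → k ∈ P.Lg A (Set.Iic ζ)

variable {P}

theorem OC.x_mem {A : Set P.X} (h : P.OC A) (δ : Λ) (n : ℕ) {e : G} (he : e ∈ P.tw A δ n) :
    P.x δ n e ∈ suppS (P.tw A δ (n + 1)) := by
  intro u hu
  by_contra hne
  refine hu ⟨?_, h.tail _ he.2 _ (by rwa [P.tail_real_real])⟩
  by_contra hE
  exact hne (P.x_supp δ n e he.1 u hE)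

theorem OC.normal {A : Set P.X} (h : P.OC A) {γ : Λ} {a : G} (ha : a ∈ P.Lg A (Set.Iic γ)) :
    ∃ M, ∃ c ∈ suppS (P.tw A γ M), a - ev c ∈ P.Lg A (Set.Iio γ) := by
  refine exists_normal (Q := P.tw A γ) (x := P.x γ) (t := fun _ => id)
    (fun n e he => h.x_mem γ n he) (fun n e he => h.real γ n e he) ?_
  revert a
  change P.Lg A (Set.Iic γ) ≤ _
  rw [Lg, AddSubgroup.closure_le]
  rintro e ⟨γ', hγ', n, he⟩
  apply AddSubgroup.subset_closure
  rcases (show γ' ≤ γ from hγ').lt_or_eq with h1 | rfl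
  · exact Or.inr (P.mem_Lg (J := Set.Iio γ) h1 he)
  · exact Or.inl ⟨n, e, he, rfl⟩

theorem OC.mem_Lg_of_mem [WellFoundedLT Λ] {A : Set P.X} (h : P.OC A) {γ δ : Λ} {a : G}
    (ha : a ∈ P.Lg A (Set.Iic γ)) (haδ : a ∈ P.N δ) : a ∈ P.Lg A (Set.Iic δ) := by
  induction γ using WellFoundedLT.induction with
  | ind γ ih =>
    rcases le_or_gt γ δ with h1 | h1
    · exact P.Lg_mono le_rfl (Set.Iic_subset_Iic.mpr h1) ha
    · obtain ⟨M, c, hc, hac⟩ := h.normal ha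
      have h2 : ev c ∈ below P.N γ := by
        have := sub_mem (le_below h1 haδ) (P.Lg_Iio_le A γ hac)
        simpa using this
      have h3 := P.E_ind γ M c (suppS_mono (fun e he => he.1) hc) h2
      rw [h3, map_zero, sub_zero] at hac
      obtain ⟨γ', hγ', h4⟩ := P.exists_of_mem_Lg_Iio h1 hac
      exact ih γ' hγ' h4

theorem OC.normal_of_mem [WellFoundedLT Λ] {A : Set P.X} (h : P.OC A) {β δ : Λ}
    {R : AddSubgroup G} (hRδ : R ≤ below P.N δ) {a : G} (ha : a ∈ P.N δ)
    (haL : a ∈ R ⊔ P.Lg A (Set.Iic β)) :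
    ∃ M, ∃ c ∈ suppS (P.tw A δ M), a - ev c ∈ below P.N δ := by
  obtain ⟨r, hr, l, hl, rfl⟩ := AddSubgroup.mem_sup.mp haL
  have hr' := hRδ hr
  have hlδ : l ∈ P.N δ := by
    have := sub_mem ha (below_le P.mono δ hr')
    simpa using this
  obtain ⟨M, c, hc, hlc⟩ := h.normal (h.mem_Lg_of_mem hl hlδ)
  refine ⟨M, c, hc, ?_⟩
  rw [add_sub_assoc]
  exact add_mem hr' (P.Lg_Iio_le A δ hlc)

theorem push_below {δ : Λ} {n m : ℕ} (h : n ≤ m) {c : G →₀ ℤ} (hc : c ∈ suppS (P.E δ n)) :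
    ∃ c' ∈ suppS (P.E δ m), ev c - ev c' ∈ below P.N δ :=
  exists_push (Q := P.E δ) (x := P.x δ) (t := fun _ => id) (fun n e he => P.x_supp δ n e he)
    (fun n e he => P.x_mem δ n e he) h hc

theorem OC.push_below {A : Set P.X} (hA : P.OC A) {δ : Λ} {n m : ℕ} (h : n ≤ m) {c : G →₀ ℤ}
    (hc : c ∈ suppS (P.tw A δ n)) : ∃ c' ∈ suppS (P.tw A δ m), ev c - ev c' ∈ below P.N δ :=
  exists_push (Q := P.tw A δ) (x := P.x δ) (t := fun _ => id) (fun n _ he => hA.x_mem δ n he)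
    (fun n e he => P.x_mem δ n e he.1) h hc

theorem OC.pure [WellFoundedLT Λ] {A : Set P.X} (h : P.OC A) {β δ : Λ} (hδβ : δ ≤ β)
    {R : AddSubgroup G} (hRδ : R ≤ below P.N δ) {m : ℤ} (hm : m ≠ 0) {a : G} (ha : a ∈ P.N δ)
    (hma : m • a ∈ below P.N δ ⊔ (R ⊔ P.Lg A (Set.Iic β))) :
    a ∈ below P.N δ ⊔ (R ⊔ P.Lg A (Set.Iic β)) := by
  obtain ⟨b, hb, l, hl, hbl⟩ := AddSubgroup.mem_sup.mp hma
  have hlδ : l ∈ P.N δ := by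
    have := sub_mem ((P.N δ).zsmul_mem ha m) (below_le P.mono δ hb)
    rw [← hbl] at this
    simpa using this
  obtain ⟨M, c, hc, hlc⟩ := h.normal_of_mem hRδ hlδ hl
  obtain ⟨n, d, hd, had⟩ := P.E_span δ a ha
  obtain ⟨c', hc', h1⟩ := h.push_below (le_max_left M n) hc
  obtain ⟨d', hd', h2⟩ := Frame.push_below (le_max_right M n) hd
  have h3 : m • d' - c' = 0 := by
    refine P.E_ind δ (max M n) _ (sub_mem ((suppS _).zsmul_mem hd' m)
      (suppS_mono (fun e he => he.1) hc')) ?_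
    have h4 := sub_mem (add_mem (add_mem hb hlc) h1)
      ((below P.N δ).zsmul_mem (add_mem had h2) m)
    have h5 : ev (m • d' - c') = b + (l - ev c) + (ev c - ev c') -
        m • (a - ev d + (ev d - ev d')) := by
      have : m • a = b + l := hbl.symm
      rw [map_sub, map_zsmul, sub_add_sub_cancel, smul_sub, this]; abel
    rw [h5]; exact h4
  have h4 : d' ∈ suppS (P.tw A δ (max M n)) := by
    intro e he
    have h5 := hc' e he
    rw [← sub_eq_zero.mp h3, Finsupp.smul_apply, smul_eq_mul] at h5
    exact (mul_eq_zero.mp h5).resolve_left hm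
  have h5 : ev d' ∈ P.Lg A (Set.Iic β) := ev_mem (fun e he => P.mem_Lg (J := Set.Iic β) hδβ he) h4
  have h6 : a = (a - ev d + (ev d - ev d')) + ev d' := by abel
  rw [h6]
  exact AddSubgroup.add_mem_sup (add_mem had h2) (AddSubgroup.mem_sup_right h5)

theorem exists_finite_Lg [WellFoundedLT Λ] (P : Frame G Λ) {γ : Λ} {a : G} (ha : a ∈ P.N γ) :
    ∃ T : Set P.X, T.Finite ∧ a ∈ P.Lg T (Set.Iic γ) := by
  induction γ using WellFoundedLT.induction generalizing a with
  | ind γ ih =>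
    obtain ⟨n, c, hc, hac⟩ := P.E_span γ a ha
    have h1 : ev c ∈ P.Lg (Item.real γ n '' (c.support : Set G)) (Set.Iic γ) := by
      refine ev_mem (C := c.support) ?_ (mem_suppS_iff_support.mpr le_rfl)
      intro e he
      exact P.mem_Lg (J := Set.Iic γ) (le_refl γ) (n := n)
        ⟨mem_suppS_iff_support.mp hc he, e, he, rfl⟩
    have hf : (Item.real γ n '' (c.support : Set G) : Set P.X).Finite :=
      c.support.finite_toSet.image _
    rcases (mem_below P.mono).mp hac with h0 | ⟨γ', hγ', h2⟩
    · exact ⟨_, hf, by rwa [sub_eq_zero.mp h0]⟩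
    · obtain ⟨T, hT, h3⟩ := ih γ' hγ' h2
      refine ⟨_, hT.union hf, ?_⟩
      rw [← sub_add_cancel a (ev c)]
      exact add_mem (P.Lg_mono Set.subset_union_left (Set.Iic_subset_Iic.mpr hγ'.le) h3)
        (P.Lg_mono Set.subset_union_right le_rfl h1)

/-- The tower elements generate all of the filtration modulo a subgroup compatible with a basis. -/
theorem free_map_of_basis {ι : Type*} {R : AddSubgroup G} {β : Λ} (hRβ : R ≤ P.N β)
    (f : P.N β →+ (ι →₀ ℤ)) (hf : ∀ a, f a = 0 ↔ (a : G) ∈ R) (b : ι → P.N β)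
    (hb : ∀ i, f (b i) = Finsupp.single i 1) (A : Set P.X)
    (hA : ∀ γ ≤ β, ∀ n, ∀ e (he : e ∈ P.N β), e ∈ P.tw A γ n → ∀ i, f ⟨e, he⟩ i ≠ 0 →
      (b i : G) ∈ P.Lg A (Set.Iic β)) :
    Module.Free ℤ ((P.N β).map (QuotientAddGroup.mk' (R ⊔ P.Lg A (Set.Iic β)))) := by
  classical
  let L := R ⊔ P.Lg A (Set.Iic β)
  have hLβ : L ≤ P.N β := sup_le hRβ (P.Lg_Iic_le A β)
  let B : Set ι := {i | (b i : G) ∈ L}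
  let F : (ι →₀ ℤ) →+ (ι →₀ ℤ) := Finsupp.filterAddHom (· ∉ B)
  have h1 : ∀ a : P.N β, (a : G) ∈ L → f a ∈ suppS B := by
    have h2 : (L.addSubgroupOf (P.N β)) ≤ (suppS B).comap f := by
      have h3 : (R.addSubgroupOf (P.N β)) ⊔ ((P.Lg A (Set.Iic β)).addSubgroupOf (P.N β)) =
          L.addSubgroupOf (P.N β) :=
        (AddSubgroup.addSubgroupOf_sup hRβ (P.Lg_Iic_le A β)).symm
      rw [← h3]
      refine sup_le ?_ ?_
      · intro a ha
        have : f a = 0 := (hf a).mpr ha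
        change f a ∈ suppS B
        rw [this]; exact zero_mem _
      · have : ∀ g ∈ P.Lg A (Set.Iic β), ∀ h : g ∈ P.N β, f ⟨g, h⟩ ∈ suppS B := by
          intro g hg
          induction hg using AddSubgroup.closure_induction with
          | mem g hg =>
            obtain ⟨γ, hγ, n, he⟩ := hg
            intro h i hi
            by_contra hne
            exact hi (AddSubgroup.mem_sup_right (hA γ hγ n g h he i hne))
          | zero => intro h; exact (map_zero f) ▸ zero_mem _
          | add g g' hg hg' h1 h2 =>
            intro h
            have e1 := P.Lg_Iic_le A β hg
            have e2 := P.Lg_Iic_le A β hg'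
            have := add_mem (h1 e1) (h2 e2)
            rwa [← map_add] at this
          | neg g hg h1 =>
            intro h
            have := neg_mem (h1 (P.Lg_Iic_le A β hg))
            rwa [← map_neg] at this
        intro a ha
        exact this a.1 ha a.2
    intro a ha
    exact h2 (show a ∈ L.addSubgroupOf (P.N β) from ha)
  have h2 : ∀ a : P.N β, f a ∈ suppS B → (a : G) ∈ L := by
    intro a ha
    let c : P.N β := (Finsupp.linearCombination ℤ b) (f a)
    have hc : f c = f a := by
      have : f.toIntLinearMap.comp (Finsupp.linearCombination ℤ b) = LinearMap.id := by
        ext i : 2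
        simp [hb]
      exact LinearMap.congr_fun this (f a)
    have h3 : ((a - c : P.N β) : G) ∈ R := by
      rw [← hf, map_sub, hc, sub_self]
    have h4 : (c : G) ∈ L := by
      refine suppS_induction
        (p := fun v => ((Finsupp.linearCombination ℤ b v : P.N β) : G) ∈ L) ?_ ?_ ?_ ha
      · simp
      · intro u v hu hv
        rw [map_add]; exact add_mem hu hv
      · intro i hi n
        rw [Finsupp.linearCombination_single]
        exact L.zsmul_mem hi n
    have h5 := add_mem (AddSubgroup.mem_sup_left (T := P.Lg A (Set.Iic β)) h3) h4
    simpa using h5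
  have h3 := free_range_of_ker ((QuotientAddGroup.mk' L).comp (P.N β).subtype) (F.comp f) ?_
    inferInstance
  · rw [AddMonoidHom.range_comp, AddSubgroup.range_subtype] at h3
    exact h3
  · intro a
    change (((a : G) : G ⧸ L) = 0) ↔ (f a).filter (· ∉ B) = 0
    rw [QuotientAddGroup.eq_zero_iff, Finsupp.filter_eq_zero_iff]
    exact ⟨fun h => h1 a h, fun h => h2 a h⟩

end Frame

theorem mapDomain_mem_suppS {α X : Type*} {f : α → X} {C : Set α} {D : Set X}
    (h : ∀ a ∈ C, f a ∈ D) {c : α →₀ ℤ} (hc : c ∈ suppS C) : c.mapDomain f ∈ suppS D := by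
  refine suppS_induction (p := fun c => c.mapDomain f ∈ suppS D) (by simp) ?_ ?_ hc
  · intro a b ha hb; rw [Finsupp.mapDomain_add]; exact add_mem ha hb
  · intro x hx n; rw [Finsupp.mapDomain_single]; exact single_mem_suppS (h x hx) n

theorem linearCombination_congr {α M : Type*} [AddCommGroup M] {f g : α → M} {C : Set α}
    (h : ∀ a ∈ C, f a = g a) {c : α →₀ ℤ} (hc : c ∈ suppS C) :
    Finsupp.linearCombination ℤ f c = Finsupp.linearCombination ℤ g c := by
  rw [mem_suppS_iff_support] at hc
  rw [Finsupp.linearCombination_apply, Finsupp.linearCombination_apply]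
  exact Finsupp.sum_congr fun a ha => by rw [h a (hc ha)]

theorem map_ev {G M : Type*} [AddCommGroup G] [AddCommGroup M] (f : G →+ M) (c : G →₀ ℤ) :
    f (ev c) = Finsupp.linearCombination ℤ (fun e => f e) c := by
  rw [ev_eq_sum, Finsupp.linearCombination_apply, map_finsuppSum]
  simp

namespace Frame

variable {G Λ : Type u} [AddCommGroup G] [LinearOrder Λ]

/-- A piece of the set of generators between two closed sets. -/
structure Piece (P : Frame G Λ) where
  /-- the levels that are killed -/
  I : Set Λ
  /-- the subgroup that is killed -/
  R : AddSubgroup G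
  /-- the upper bound of the levels -/
  β : Λ
  /-- the lower closed set -/
  A : Set P.X
  /-- the upper closed set -/
  A' : Set P.X
  R_below : ∀ δ ∈ P.S, δ ∉ I → R ≤ below P.N δ
  fin : ∀ δ ∈ P.S, δ ∉ I → ∃ ν, ∀ n ≥ ν, ∀ e ∈ P.E δ n, P.ζ δ n e ∈ I → P.N (P.ζ δ n e) ≤ R
  hA : P.OC A
  hA' : P.OC A'
  free : Module.Free ℤ ((P.N β).map (QuotientAddGroup.mk' (R ⊔ P.Lg A (Set.Iic β))))

namespace Piece

variable {P : Frame G Λ} (Q : P.Piece)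

/-- The subgroup generated by what is killed. -/
abbrev L : AddSubgroup G := Q.R ⊔ P.Lg Q.A (Set.Iic Q.β)

/-- The generators of a piece. -/
def D : Set P.X := (P.items (Set.Iic Q.β) \ P.items Q.I) ∩ (Q.A' \ Q.A)

/-- The generators of a piece, with blocks restricted to a given set. -/
def DW (W : Set Λ) : Set P.X := {v | v ∈ Q.D ∧ ∀ δ n e, v = Item.real δ n e → δ ∈ W}

theorem real_mem_D {δ n e} : Item.real δ n e ∈ Q.D ↔
    (δ ≤ Q.β ∧ δ ∉ Q.I ∧ δ ∈ P.S) ∧ e ∈ P.tw Q.A' δ n ∧ e ∉ P.tw Q.A δ n := by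
  constructor
  · rintro ⟨⟨⟨h1, h2, h3⟩, h4⟩, h5, h6⟩
    exact ⟨⟨h1, fun h => h4 ⟨h, h2, h3⟩, h2⟩, ⟨h3, h5⟩, fun h => h6 h.2⟩
  · rintro ⟨⟨h1, h2, h3⟩, ⟨h4, h5⟩, h6⟩
    exact ⟨⟨⟨h1, h3, h4⟩, fun h => h2 h.1⟩, h5, fun h => h6 ⟨h4, h⟩⟩

theorem real_mem_DW {W : Set Λ} {δ n e} :
    Item.real δ n e ∈ Q.DW W ↔ Item.real δ n e ∈ Q.D ∧ δ ∈ W := by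
  constructor
  · rintro ⟨h1, h2⟩; exact ⟨h1, h2 _ _ _ rfl⟩
  · rintro ⟨h1, h2⟩
    refine ⟨h1, fun δ' n' e' h => ?_⟩
    injection h with h
    exact h ▸ h2

theorem sym_mem_DW {W : Set Λ} {k ζ n y} :
    Item.sym k ζ n y ∈ Q.DW W ↔ Item.sym k ζ n y ∈ Q.D :=
  ⟨fun h => h.1, fun h => ⟨h, fun _ _ _ h => by cases h⟩⟩

theorem z_not_mem_D : Item.z ∉ Q.D := fun h => h.1.2 (P.z_mem_items _)

theorem DW_univ : Q.DW Set.univ = Q.D :=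
  Set.ext fun _ => ⟨fun h => h.1, fun h => ⟨h, fun _ _ _ _ => trivial⟩⟩

theorem cl_DW (W : Set Λ) : P.sys.Cl (Q.DW W) Q.D := by
  refine ⟨fun _ h => h.1, fun v hv hR u hu hne => ?_⟩
  obtain ⟨δ, n, e, rfl, -⟩ := P.exists_real_of_mem_rset hR
  refine ⟨hu, fun δ' n' e' h => ?_⟩
  subst h
  obtain ⟨rfl, -, -⟩ := P.tail_real_real_ne hne
  exact hv.2 _ _ _ rfl

open Classical in
/-- The value of a generator in a block. -/
noncomputable def evFun (P : Frame G Λ) (δ : Λ) : P.X → G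
  | .z => 0
  | .sym _ _ _ _ => 0
  | .real δ' _ e => if δ' = δ then e else 0

/-- Evaluation of the generators of a block. -/
noncomputable def evR (P : Frame G Λ) (δ : Λ) : (P.X →₀ ℤ) →+ G :=
  (Finsupp.linearCombination ℤ (evFun P δ)).toAddMonoidHom

theorem evR_real (δ : Λ) (n : ℕ) (e : G) (k : ℤ) :
    evR P δ (Finsupp.single (Item.real δ n e) k) = k • e := by
  simp [evR, evFun]

/-- The gadget symbols of a piece occurring below an index. -/
def symBelow (δ : Λ) : Set P.X :=
  {v | v ∈ Q.D ∧ ∃ k ζ n y, v = Item.sym k ζ n y ∧ ∃ γ < δ, k ∈ P.N γ}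

/-- The generators of a block in a piece. -/
def block (δ : Λ) : Set P.X := {v | v ∈ Q.D ∧ ∃ n e, v = Item.real δ n e}

theorem rho_real (δ n e) : P.sys.rho (Item.real δ n e) = Finsupp.single (Item.real δ n e) 1 -
    ((P.x δ n e).mapDomain (Item.real δ (n + 1)) +
      (P.bd δ (P.ζ δ n e) n (P.k δ n e)).mapDomain (Item.sym (P.k δ n e) (P.ζ δ n e) n) +
      Finsupp.single Item.z (P.g δ n e)) := rfl

theorem suppS_compl_le_U {X : Type u} (P : RelSys X) (D : Set X) : suppS Dᶜ ≤ P.U D :=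
  suppS_le fun _ hx => P.single_mem_U hx 1

theorem mem_of_evR_mem [WellFoundedLT Λ] {W : Set Λ} {δ : Λ} (hW : δ ∈ W) (hS : δ ∈ P.S)
    (hI : δ ∉ Q.I) (hβ : δ ≤ Q.β) {r : P.X →₀ ℤ} (hr : r ∈ suppS (Q.block δ))
    (hev : evR P δ r ∈ below P.N δ ⊔ Q.L) :
    r ∈ suppS (Q.symBelow δ) ⊔ P.sys.U (Q.DW W) := by
  let K2 := suppS (Q.symBelow δ) ⊔ P.sys.U (Q.DW W)
  let t : ℕ → G → G × (P.X →₀ ℤ) := fun n e => (e, Finsupp.single (Item.real δ n e) 1)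
  have hlc : ∀ n c, Finsupp.linearCombination ℤ (t n) c =
      (ev c, c.mapDomain (Item.real δ n)) := by
    intro n c
    induction c using Finsupp.induction_linear with
    | zero => simp; rfl
    | add a b ha hb =>
      rw [map_add, ha, hb, Prod.mk_add_mk, map_add, Finsupp.mapDomain_add]
    | single e k =>
      rw [Finsupp.linearCombination_single, ev_single, Finsupp.mapDomain_single, Prod.smul_mk,
        Finsupp.smul_single, smul_eq_mul, mul_one]
  let K := (below P.N δ).prod K2
  have hU : ∀ v ∉ Q.DW W, ∀ k, Finsupp.single v k ∈ K2 := fun v hv k =>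
    AddSubgroup.mem_sup_right (P.sys.single_mem_U hv k)
  have hAK : ∀ n c, c ∈ suppS (P.tw Q.A δ n) → c.mapDomain (Item.real δ n) ∈ K2 := by
    intro n c hc
    refine AddSubgroup.mem_sup_right (suppS_compl_le_U _ _ (mapDomain_mem_suppS ?_ hc))
    intro e he h
    exact h.1.2.2 he.2
  have ht : ∀ n, ∀ e ∈ P.tw Q.A' δ n,
      t n e - Finsupp.linearCombination ℤ (t (n + 1)) (P.x δ n e) ∈ K := by
    intro n e he
    rw [hlc]
    refine ⟨P.x_mem δ n e he.1, ?_⟩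
    change Finsupp.single (Item.real δ n e) 1 - (P.x δ n e).mapDomain (Item.real δ (n + 1)) ∈ K2
    by_cases heA : e ∈ P.tw Q.A δ n
    · refine sub_mem ?_ (hAK _ _ (Q.hA.x_mem δ n heA))
      exact hU _ (fun h => h.1.2.2 heA.2) 1
    · have hD : Item.real δ n e ∈ Q.DW W :=
        Q.real_mem_DW.mpr ⟨Q.real_mem_D.mpr ⟨⟨hβ, hI, hS⟩, he, heA⟩, hW⟩
      have h1 := P.sys.rho_mem_U hD (P.real_mem_rset.mpr ⟨hS, he.1⟩)
      rw [rho_real] at h1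
      have h2 : (P.bd δ (P.ζ δ n e) n (P.k δ n e)).mapDomain
          (Item.sym (P.k δ n e) (P.ζ δ n e) n) ∈ K2 := by
        have h3 := mapDomain_mem_suppS (f := Item.sym (P.k δ n e) (P.ζ δ n e) n)
          (C := Set.univ) (D := Set.range (Item.sym (P.k δ n e) (P.ζ δ n e) n : _ → P.X))
          (fun a _ => ⟨a, rfl⟩) (c := P.bd δ (P.ζ δ n e) n (P.k δ n e))
          (fun x hx => absurd trivial hx)
        refine suppS_le ?_ h3
        rintro _ ⟨y, rfl⟩
        by_cases hy : Item.sym (P.k δ n e) (P.ζ δ n e) n y ∈ Q.D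
        · refine AddSubgroup.mem_sup_left (single_mem_suppS ?_ 1)
          exact ⟨hy, _, _, _, _, rfl, _, P.ζ_lt δ hS n e he.1, P.ζ_mem δ hS n e he.1⟩
        · exact hU _ (fun h => hy h.1) 1
      have h3 : Finsupp.single Item.z (P.g δ n e) ∈ K2 := hU _ (fun h => Q.z_not_mem_D h.1) _
      have h4 := add_mem (AddSubgroup.mem_sup_right (S := suppS (Q.symBelow δ)) h1)
        (add_mem h2 h3)
      convert h4 using 1
      abel
  have hcl : (evR P δ r, r) ∈
      AddSubgroup.closure
      ({w | ∃ n, ∃ e ∈ P.tw Q.A' δ n, w = t n e} ∪ (K : Set (G × (P.X →₀ ℤ)))) := by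
    refine suppS_induction (p := fun r => (evR P δ r, r) ∈ AddSubgroup.closure
      ({w | ∃ n, ∃ e ∈ P.tw Q.A' δ n, w = t n e} ∪ (K : Set (G × (P.X →₀ ℤ))))) ?_ ?_ ?_ hr
    · rw [map_zero]; exact zero_mem _
    · intro a b ha hb
      rw [map_add, ← Prod.mk_add_mk]; exact add_mem ha hb
    · rintro _ ⟨hv, n, e, rfl⟩ k
      have h1 : (evR P δ (Finsupp.single (Item.real δ n e) k),
          Finsupp.single (Item.real δ n e) k) = k • t n e := by
        rw [evR_real]
        simp [t]
      rw [h1]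
      have h2 : t n e ∈ AddSubgroup.closure
          ({w | ∃ n, ∃ e ∈ P.tw Q.A' δ n, w = t n e} ∪ (K : Set (G × (P.X →₀ ℤ)))) :=
        AddSubgroup.subset_closure (Or.inl ⟨n, e, (Q.real_mem_D.mp hv).2.1, rfl⟩)
      exact zsmul_mem h2 k
  obtain ⟨M, c, hc, h1⟩ := exists_normal (fun n e he => Q.hA'.x_mem δ n he) ht hcl
  obtain ⟨b, hb, l, hl, hbl⟩ := AddSubgroup.mem_sup.mp hev
  rw [hlc] at h1
  have hcN : ev c ∈ P.N δ := ev_mem (fun e he => P.E_sub δ M he.1) hc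
  have h1f : evR P δ r - ev c ∈ below P.N δ := h1.1
  have h1s : r - c.mapDomain (Item.real δ M) ∈ K2 := h1.2
  have hlN : l ∈ P.N δ := by
    have := add_mem (below_le P.mono δ (sub_mem h1f hb)) hcN
    rw [← hbl] at this
    convert this using 1
    abel
  obtain ⟨M', c', hc', hlc'⟩ := Q.hA.normal_of_mem (Q.R_below δ hS hI) hlN hl
  obtain ⟨d, hd, h2⟩ := exists_push (fun n e he => Q.hA'.x_mem δ n he) ht (le_max_left M M') hc
  obtain ⟨d', hd', h3⟩ := Q.hA.push_below (le_max_right M M') hc'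
  rw [hlc, hlc] at h2
  have h2f : ev c - ev d ∈ below P.N δ := h2.1
  have h2s : c.mapDomain (Item.real δ M) - d.mapDomain (Item.real δ (max M M')) ∈ K2 := h2.2
  have hdd : d - d' = 0 := by
    refine P.E_ind δ (max M M') _ (sub_mem (suppS_mono (fun e he => he.1) hd)
      (suppS_mono (fun e he => he.1) hd')) ?_
    have h4 := sub_mem (add_mem hb (add_mem hlc' h3)) (add_mem h1f h2f)
    rw [← hbl] at h4
    rw [map_sub]
    convert h4 using 1
    abel
  rw [sub_eq_zero] at hdd
  subst hdd
  have := add_mem (add_mem h1s h2s) (hAK _ _ hd')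
  simpa using this

open Classical in
/-- The value of a generator in the quotient attached to a block. -/
noncomputable def quotFun (δ : Λ) (v : P.X) : G ⧸ (below P.N δ ⊔ Q.L) :=
  if v ∈ Q.D then QuotientAddGroup.mk' (below P.N δ ⊔ Q.L) (evFun P δ v) else 0

theorem evR_mem_of_mem_U {δ : Λ} {y : P.X →₀ ℤ} (hy : y ∈ P.sys.U Q.D) :
    Finsupp.linearCombination ℤ (Q.quotFun δ) y = 0 := by
  classical
  change y ∈ (Finsupp.linearCombination ℤ (Q.quotFun δ)).toAddMonoidHom.ker
  refine P.sys.U_le ?_ ?_ hy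
  · intro v hv
    change Finsupp.linearCombination ℤ (Q.quotFun δ) _ = 0
    simp [quotFun, hv]
  · intro v hv hR
    change Finsupp.linearCombination ℤ (Q.quotFun δ) _ = 0
    obtain ⟨δ', n, e, rfl, hS, he⟩ := P.exists_real_of_mem_rset hR
    obtain ⟨⟨hβ, hI, -⟩, heA', -⟩ := Q.real_mem_D.mp hv
    rw [rho_real, map_sub, map_add, map_add, Finsupp.linearCombination_mapDomain,
      Finsupp.linearCombination_mapDomain]
    have h1 : Finsupp.linearCombination ℤ (Q.quotFun δ ∘ Item.sym (P.k δ' n e) (P.ζ δ' n e) n)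
        (P.bd δ' (P.ζ δ' n e) n (P.k δ' n e)) = 0 := by
      rw [linearCombination_congr (g := fun _ => 0) (C := Set.univ) (c := _)]
      · simp [Finsupp.linearCombination_apply]
      · intro y _
        simp [quotFun, evFun]
      · exact fun x hx => absurd trivial hx
    rw [h1, Finsupp.linearCombination_single, Finsupp.linearCombination_single]
    have h2 : Q.quotFun δ Item.z = 0 := by simp [quotFun, evFun]
    rw [h2, smul_zero, add_zero, add_zero, one_smul]
    by_cases hδ : δ' = δ
    · subst hδ
      have h3 : ∀ m, ∀ e ∈ P.tw Q.A' δ' m, 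
          Q.quotFun δ' (Item.real δ' m e) = QuotientAddGroup.mk' (below P.N δ' ⊔ Q.L) e := by
        intro m e he
        by_cases hD : Item.real δ' m e ∈ Q.D
        · simp [quotFun, hD, evFun]
        · simp only [quotFun, hD, if_false]
          symm
          rw [QuotientAddGroup.mk'_apply, QuotientAddGroup.eq_zero_iff]
          refine AddSubgroup.mem_sup_right (AddSubgroup.mem_sup_right ?_)
          refine P.mem_Lg (γ := δ') hβ (n := m) ?_
          by_contra hcon
          exact hD (Q.real_mem_D.mpr ⟨⟨hβ, hI, hS⟩, he, hcon⟩)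
      rw [h3 n e heA']
      change _ - Finsupp.linearCombination ℤ (fun e => Q.quotFun δ' (Item.real δ' (n + 1) e)) _ = 0
      rw [linearCombination_congr (h3 (n + 1)) (Q.hA'.x_mem δ' n heA'), ← map_ev, ← map_sub,
        QuotientAddGroup.mk'_apply, QuotientAddGroup.eq_zero_iff]
      exact AddSubgroup.mem_sup_left (P.x_mem δ' n e he)
    · have h3 : ∀ m e, Q.quotFun δ (Item.real δ' m e) = 0 := by
        intro m e; simp [quotFun, evFun, hδ]
      rw [h3, linearCombination_congr (g := fun _ => 0) (C := Set.univ) (c := _)]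
      · simp [Finsupp.linearCombination_apply]
      · intro y _; exact h3 _ _
      · exact fun x hx => absurd trivial hx

end Piece

end Frame

theorem linearCombination_sub_mem {α M : Type*} [AddCommGroup M] {f g : α → M} {C : Set α}
    {K : AddSubgroup M} (h : ∀ a ∈ C, f a - g a ∈ K) {c : α →₀ ℤ} (hc : c ∈ suppS C) :
    Finsupp.linearCombination ℤ f c - Finsupp.linearCombination ℤ g c ∈ K := by
  refine suppS_induction (p := fun c => Finsupp.linearCombination ℤ f c -
    Finsupp.linearCombination ℤ g c ∈ K) (by simp) ?_ ?_ hc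
  · intro a b ha hb
    rw [map_add, map_add, add_sub_add_comm]
    exact add_mem ha hb
  · intro a ha n
    rw [Finsupp.linearCombination_single, Finsupp.linearCombination_single, ← smul_sub]
    exact K.zsmul_mem (h a ha) n

theorem linearCombination_mem {α M : Type*} [AddCommGroup M] {f : α → M} {C : Set α}
    {K : AddSubgroup M} (h : ∀ a ∈ C, f a ∈ K) {c : α →₀ ℤ} (hc : c ∈ suppS C) :
    Finsupp.linearCombination ℤ f c ∈ K := by
  have := linearCombination_sub_mem (f := f) (g := fun _ => 0) (K := K)
    (fun a ha => by simpa using h a ha) hc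
  simpa [Finsupp.linearCombination_apply] using this

theorem mem_suppS_iUnion {X ι : Type*} [LinearOrder ι] {C : ι → Set X} (hC : Monotone C) {i : ι}
    {y : X →₀ ℤ} (hy : y ∈ suppS {x | ∃ j < i, x ∈ C j}) :
    y = 0 ∨ ∃ j < i, y ∈ suppS (C j) := by
  refine suppS_induction (p := fun y => y = 0 ∨ ∃ j < i, y ∈ suppS (C j)) (Or.inl rfl) ?_ ?_ hy
  · rintro a b (rfl | ⟨j, hj, ha⟩) (rfl | ⟨j', hj', hb⟩)
    · left; rw [add_zero]
    · right; exact ⟨j', hj', by rwa [zero_add]⟩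
    · right; exact ⟨j, hj, by rwa [add_zero]⟩
    · right
      exact ⟨max j j', max_lt hj hj', add_mem (suppS_mono (hC (le_max_left _ _)) ha)
        (suppS_mono (hC (le_max_right _ _)) hb)⟩
  · rintro x ⟨j, hj, hx⟩ n
    exact Or.inr ⟨j, hj, single_mem_suppS hx n⟩

namespace Frame

variable {G Λ : Type u} [AddCommGroup G] [LinearOrder Λ]

/-- Push an element of a tower up a number of times and evaluate. -/
noncomputable def vl (P : Frame G Λ) (δ : Λ) : ℕ → ℕ → G → G
  | 0, _, e => e
  | d + 1, n, e => Finsupp.linearCombination ℤ (P.vl δ d (n + 1)) (P.x δ n e)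

theorem vl_sub_mem (P : Frame G Λ) (δ : Λ) (d n : ℕ) {e : G} (he : e ∈ P.E δ n) :
    P.vl δ d n e - e ∈ below P.N δ := by
  induction d generalizing n e with
  | zero => simp [vl]
  | succ d ih =>
    have h1 := linearCombination_sub_mem (g := id) (fun a ha => ih (n + 1) ha) (P.x_supp δ n e he)
    have h2 := sub_mem h1 (P.x_mem δ n e he)
    have h3 : ∀ a b c : G, a - b - (c - b) = a - c := by intros; abel
    exact (h3 _ _ _) ▸ h2

theorem vl_mem (P : Frame G Λ) (δ : Λ) (d n : ℕ) {e : G} (he : e ∈ P.E δ n) :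
    P.vl δ d n e ∈ P.N δ := by
  have := add_mem (below_le P.mono δ (P.vl_sub_mem δ d n he)) (P.E_sub δ n he)
  simpa using this

theorem OC.vl_mem {P : Frame G Λ} {A : Set P.X} (hA : P.OC A) (δ : Λ) (d n : ℕ) {e : G}
    (he : e ∈ P.tw A δ n) : P.vl δ d n e ∈ P.Lg A (Set.Iic δ) := by
  induction d generalizing n e with
  | zero => exact P.mem_Lg (J := Set.Iic δ) (le_refl δ) he
  | succ d ih => exact linearCombination_mem (fun a ha => ih (n + 1) ha) (hA.x_mem δ n he)

namespace Piece

variable {P : Frame G Λ} (Q : P.Piece)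

open Classical in
/-- Values of the generators of a piece at finitely many blocks. -/
noncomputable def thFun (W : Set Λ) (ν : ℕ) (φ : G → Λ → (n : ℕ) → P.V n → ℤ) (v : P.X) : G ⧸ Q.L :=
  if v ∈ Q.DW W then
    match v with
    | .z => 0
    | .sym k ζ n y => if ν ≤ n then φ k ζ n y • QuotientAddGroup.mk' Q.L k else 0
    | .real δ n e => QuotientAddGroup.mk' Q.L (P.vl δ (ν - n) n e)
  else 0

/-- The linear extension of `thFun`. -/
noncomputable def th (W : Set Λ) (ν : ℕ) (φ : G → Λ → (n : ℕ) → P.V n → ℤ) :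
    (P.X →₀ ℤ) →+ G ⧸ Q.L :=
  (Finsupp.linearCombination ℤ (Q.thFun W ν φ)).toAddMonoidHom

theorem th_single (W : Set Λ) (ν : ℕ) (φ : G → Λ → (n : ℕ) → P.V n → ℤ) (v : P.X) (m : ℤ) :
    Q.th W ν φ (Finsupp.single v m) = m • Q.thFun W ν φ v := by
  simp [th]

theorem th_mapDomain (W : Set Λ) (ν : ℕ) (φ : G → Λ → (n : ℕ) → P.V n → ℤ) {α : Type*}
    (f : α → P.X) (c : α →₀ ℤ) :
    Q.th W ν φ (c.mapDomain f) = Finsupp.linearCombination ℤ (fun a => Q.thFun W ν φ (f a)) c := by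
  change Finsupp.linearCombination ℤ (Q.thFun W ν φ) _ = _
  rw [Finsupp.linearCombination_mapDomain]; rfl

theorem thFun_real {W : Set Λ} {ν : ℕ} {φ : G → Λ → (n : ℕ) → P.V n → ℤ} {δ n e} (hβ : δ ≤ Q.β)
    (hI : δ ∉ Q.I) (hS : δ ∈ P.S) (hW : δ ∈ W) (he : e ∈ P.tw Q.A' δ n) :
    Q.thFun W ν φ (Item.real δ n e) = QuotientAddGroup.mk' Q.L (P.vl δ (ν - n) n e) := by
  by_cases hD : Item.real δ n e ∈ Q.DW W
  · simp [thFun, hD]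
  · simp only [thFun, hD, if_false]
    symm
    rw [QuotientAddGroup.mk'_apply, QuotientAddGroup.eq_zero_iff]
    refine AddSubgroup.mem_sup_right (P.Lg_mono le_rfl (Set.Iic_subset_Iic.mpr hβ)
      (Q.hA.vl_mem δ (ν - n) n ?_))
    by_contra hcon
    exact hD (Q.real_mem_DW.mpr ⟨Q.real_mem_D.mpr ⟨⟨hβ, hI, hS⟩, he, hcon⟩, hW⟩)

theorem th_eq_zero {W : Finset Λ} {ν : ℕ} {φ : G → Λ → (n : ℕ) → P.V n → ℤ}
    (hφ : ∀ k ζ, ∀ n ≥ ν, ∀ δ ∈ W, Finsupp.linearCombination ℤ (φ k ζ n) (P.bd δ ζ n k) = 1)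
    (hν : ∀ δ ∈ W, δ ∈ P.S → δ ∉ Q.I → ∀ n ≥ ν, ∀ e ∈ P.E δ n, P.ζ δ n e ∈ Q.I →
      P.N (P.ζ δ n e) ≤ Q.R)
    {y : P.X →₀ ℤ} (hy : y ∈ P.sys.U (Q.DW W)) : Q.th W ν φ y = 0 := by
  classical
  change y ∈ (Q.th W ν φ).ker
  refine P.sys.U_le ?_ ?_ hy
  · intro v hv
    change Q.th W ν φ _ = 0
    rw [th_single]
    simp [thFun, hv]
  · intro v hv hR
    change Q.th W ν φ _ = 0
    obtain ⟨δ, n, e, rfl, hS, he⟩ := P.exists_real_of_mem_rset hR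
    obtain ⟨hvD, hW⟩ := Q.real_mem_DW.mp hv
    obtain ⟨⟨hβ, hI, -⟩, heA', -⟩ := Q.real_mem_D.mp hvD
    have hz : Q.thFun W ν φ Item.z = 0 := by
      have : Item.z ∉ Q.DW (W : Set Λ) := fun h => Q.z_not_mem_D h.1
      simp [thFun, this]
    have h1 : Finsupp.linearCombination ℤ
        (fun a => Q.thFun W ν φ (Item.real δ (n + 1) a)) (P.x δ n e) =
        QuotientAddGroup.mk' Q.L
          (Finsupp.linearCombination ℤ (P.vl δ (ν - (n + 1)) (n + 1)) (P.x δ n e)) := by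
      rw [linearCombination_congr (fun a ha => Q.thFun_real hβ hI hS hW ha)
        (Q.hA'.x_mem δ n heA')]
      exact (Finsupp.apply_linearCombination ℤ (QuotientAddGroup.mk' Q.L).toIntLinearMap
        (P.vl δ (ν - (n + 1)) (n + 1)) (P.x δ n e)).symm
    rw [rho_real, map_sub, map_add, map_add, th_mapDomain, th_mapDomain, th_single, th_single, hz,
      smul_zero, add_zero, one_smul, Q.thFun_real hβ hI hS hW heA', h1]
    rcases lt_or_ge n ν with hn | hn
    · have h2 : Finsupp.linearCombination ℤ
          (fun a => Q.thFun W ν φ (Item.sym (P.k δ n e) (P.ζ δ n e) n a))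
          (P.bd δ (P.ζ δ n e) n (P.k δ n e)) = 0 := by
        have : ∀ a, Q.thFun W ν φ (Item.sym (P.k δ n e) (P.ζ δ n e) n a) = 0 := by
          intro a
          simp [thFun, not_le.mpr hn]
        simp [this, Finsupp.linearCombination_apply]
      obtain ⟨d, rfl⟩ : ∃ d, ν = n + 1 + d := Nat.exists_eq_add_of_le hn
      have e1 : n + 1 + d - n = d + 1 := by omega
      have e2 : n + 1 + d - (n + 1) = d := by omega
      rw [h2, add_zero, e1, e2]
      exact sub_self _
    · have e1 : ν - n = 0 := by omega
      have e2 : ν - (n + 1) = 0 := by omega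
      rw [e1, e2]
      have h2 : ∀ a ∈ ((P.bd δ (P.ζ δ n e) n (P.k δ n e)).support : Set (P.V n)),
          Q.thFun W ν φ (Item.sym (P.k δ n e) (P.ζ δ n e) n a) =
            φ (P.k δ n e) (P.ζ δ n e) n a • QuotientAddGroup.mk' Q.L (P.k δ n e) := by
        intro a ha
        have hA' : Item.sym (P.k δ n e) (P.ζ δ n e) n a ∈ Q.A' := by
          refine Q.hA'.tail _ heA'.2 _ ?_
          rw [P.tail_real_sym]
          exact Finsupp.mem_support_iff.mp ha
        have hζ := P.ζ_lt δ hS n e he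
        have hk := P.ζ_mem δ hS n e he
        by_cases hD : Item.sym (P.k δ n e) (P.ζ δ n e) n a ∈ Q.D
        · have : Item.sym (P.k δ n e) (P.ζ δ n e) n a ∈ Q.DW (W : Set Λ) := Q.sym_mem_DW.mpr hD
          simp [thFun, this, hn]
        · have h3 : Item.sym (P.k δ n e) (P.ζ δ n e) n a ∉ Q.DW (W : Set Λ) := fun h => hD h.1
          have h4 : QuotientAddGroup.mk' Q.L (P.k δ n e) = 0 := by
            rw [QuotientAddGroup.mk'_apply, QuotientAddGroup.eq_zero_iff]
            by_cases hζI : P.ζ δ n e ∈ Q.I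
            · exact AddSubgroup.mem_sup_left (hν δ hW hS hI n hn e he hζI hk)
            · have h5 : Item.sym (P.k δ n e) (P.ζ δ n e) n a ∈ Q.A := by
                by_contra hcon
                exact hD ⟨⟨⟨hζ.le.trans hβ, hk⟩, fun h => hζI h.1⟩, hA', hcon⟩
              exact AddSubgroup.mem_sup_right (P.Lg_mono le_rfl
                (Set.Iic_subset_Iic.mpr (hζ.le.trans hβ)) (Q.hA.sym _ _ _ _ h5 hk))
          simp only [thFun, h3, if_false]
          rw [h4, smul_zero]
      rw [linearCombination_congr h2 (mem_suppS_iff_support.mpr le_rfl)]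
      have h3 : Finsupp.linearCombination ℤ
          (fun a => φ (P.k δ n e) (P.ζ δ n e) n a • QuotientAddGroup.mk' Q.L (P.k δ n e))
          (P.bd δ (P.ζ δ n e) n (P.k δ n e)) = QuotientAddGroup.mk' Q.L (P.k δ n e) := by
        have h4 := hφ (P.k δ n e) (P.ζ δ n e) n hn δ hW
        have h5 := congrArg (fun m : ℤ => m • QuotientAddGroup.mk' Q.L (P.k δ n e)) h4
        simp only [one_smul] at h5
        refine Eq.trans ?_ h5
        rw [Finsupp.linearCombination_apply, Finsupp.linearCombination_apply,
          Finsupp.sum, Finsupp.sum, Finset.sum_smul]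
        exact Finset.sum_congr rfl fun a _ => by rw [smul_eq_mul, mul_smul]
      rw [h3, ← map_add, ← map_sub]
      have h6 : P.vl δ 0 n e - (Finsupp.linearCombination ℤ (P.vl δ 0 (n + 1)) (P.x δ n e) +
          P.k δ n e) = 0 := by
        have : Finsupp.linearCombination ℤ (P.vl δ 0 (n + 1)) (P.x δ n e) = ev (P.x δ n e) := rfl
        rw [this]
        change e - (ev (P.x δ n e) + (e - ev (P.x δ n e))) = 0
        rw [add_sub_cancel, sub_self]
      rw [h6, map_zero]

end Piece

end Frame

namespace Frame

variable {G Λ : Type u} [AddCommGroup G] [LinearOrder Λ]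

namespace Piece

variable {P : Frame G Λ} (Q : P.Piece)

/-- Generators of rank at most an index. -/
def rankLE (P : Frame G Λ) (i : WithTop Λ) : Set P.X
  | .z => False
  | .sym k _ _ _ => ∃ γ : Λ, (γ : WithTop Λ) ≤ i ∧ k ∈ P.N γ
  | .real δ _ _ => (δ : WithTop Λ) ≤ i

/-- Generators in a piece of rank at most an index. -/
def RK (W : Set Λ) (i : WithTop Λ) : Set P.X := Q.DW W ∩ rankLE P i

/-- Gadget symbols whose rank is not smaller than an index. -/
def symNew (P : Frame G Λ) (i : WithTop Λ) : Set P.X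
  | .z => False
  | .sym k _ _ _ => ∀ γ : Λ, (γ : WithTop Λ) < i → k ∉ P.N γ
  | .real _ _ _ => False

theorem RK_mono (W : Set Λ) : Monotone (Q.RK W) := by
  intro i j hij v hv
  refine ⟨hv.1, ?_⟩
  match v, hv.2 with
  | .sym k _ _ _, ⟨γ, h1, h2⟩ => exact ⟨γ, h1.trans hij, h2⟩
  | .real δ _ _, h => exact le_trans (α := WithTop Λ) h hij

theorem cl_RK (W : Set Λ) (i : WithTop Λ) : P.sys.Cl (Q.RK W i) (Q.DW W) := by
  refine ⟨fun _ h => h.1, fun v hv hR u hu hne => ⟨hu, ?_⟩⟩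
  obtain ⟨δ, n, e, rfl, hS, he⟩ := P.exists_real_of_mem_rset hR
  have hδ : (δ : WithTop Λ) ≤ i := hv.2
  match u, hu, hne with
  | .z, hu, _ => exact Q.z_not_mem_D hu.1
  | .sym k ζ n' y, hu, hne =>
    obtain ⟨rfl, rfl⟩ := P.tail_real_sym_ne hne
    exact ⟨_, (WithTop.coe_le_coe.mpr (P.ζ_lt δ hS n e he).le).trans hδ, P.ζ_mem δ hS n e he⟩
  | .real δ' n' e', hu, hne =>
    obtain ⟨rfl, -, -⟩ := P.tail_real_real_ne hne
    exact hδ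

theorem symNew_vanish {W : Set Λ} {i : WithTop Λ} {u : P.X →₀ ℤ} (hu : u ∈ suppS (Q.RK W i))
    (hU : u ∈ P.sys.U (Q.DW W)) {x : P.X} (hx : x ∈ symNew P i) : u x = 0 := by
  classical
  by_cases hxR : x ∈ Q.RK W i
  swap
  · exact hu x hxR
  have h1 := P.sys.mem_U_of_closed (Q.cl_RK W i) hu hU
  change u ∈ (Finsupp.applyAddHom x : (P.X →₀ ℤ) →+ ℤ).ker
  refine P.sys.U_le ?_ ?_ h1
  · intro v hv
    exact Finsupp.single_eq_of_ne (by rintro rfl; exact hv hxR)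
  · intro v hv hR
    obtain ⟨δ, n, e, rfl, hS, he⟩ := P.exists_real_of_mem_rset hR
    change P.sys.rho _ x = 0
    match x, hx with
    | .sym k ζ n' y, hx =>
      rw [P.sys.rho_apply_of_ne (by intro h; cases h), neg_eq_zero]
      by_contra hne
      obtain ⟨rfl, rfl⟩ := P.tail_real_sym_ne hne
      refine hx _ (lt_of_lt_of_le (WithTop.coe_lt_coe.mpr (P.ζ_lt δ hS n e he)) hv.2)
        (P.ζ_mem δ hS n e he)

theorem mem_RK_lt_top {W : Set Λ} {v : P.X} (hv : v ∈ Q.DW W) : ∃ j < (⊤ : WithTop Λ), v ∈ Q.RK W j := by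
  match v, hv with
  | .z, hv => exact absurd hv.1 Q.z_not_mem_D
  | .sym k ζ n y, hv => exact ⟨ζ, WithTop.coe_lt_top _, hv, ζ, le_rfl, hv.1.1.1.2⟩
  | .real δ n e, hv => exact ⟨δ, WithTop.coe_lt_top _, hv, le_refl (α := WithTop Λ) _⟩

theorem mem_RK_lt {W : Set Λ} {γ : Λ} {v : P.X} (hv : v ∈ Q.RK W γ) (h1 : v ∉ symNew P γ)
    (h2 : v ∉ Q.block γ) : ∃ j < (γ : WithTop Λ), v ∈ Q.RK W j := by
  match v, hv, h1, h2 with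
  | .z, hv, _, _ => exact absurd hv.1.1 Q.z_not_mem_D
  | .sym k ζ n y, hv, h1, _ =>
    by_contra hcon
    refine h1 fun γ' hγ' hk => hcon ⟨γ', hγ', hv.1, γ', le_rfl, hk⟩
  | .real δ n e, hv, _, h2 =>
    refine ⟨δ, lt_of_le_of_ne hv.2 ?_, hv.1, le_refl (α := WithTop Λ) _⟩
    intro h
    rw [WithTop.coe_inj] at h
    subst h
    exact h2 ⟨hv.1.1, _, _, rfl⟩

theorem thFun_mem {W : Set Λ} {ν : ℕ} {φ : G → Λ → (n : ℕ) → P.V n → ℤ} {γ : Λ} {v : P.X}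
    (h : ∃ j < (γ : WithTop Λ), v ∈ Q.RK W j) :
    Q.thFun W ν φ v ∈ (below P.N γ).map (QuotientAddGroup.mk' Q.L) := by
  obtain ⟨j, hj, hv⟩ := h
  simp only [thFun, hv.1, if_true]
  match v, hv with
  | .z, hv => exact absurd hv.1.1 Q.z_not_mem_D
  | .sym k ζ n y, hv =>
    obtain ⟨γ', h1, h2⟩ := hv.2
    dsimp only
    split_ifs
    · refine zsmul_mem (AddSubgroup.mem_map_of_mem _ ?_) _
      exact le_below (WithTop.coe_lt_coe.mp (lt_of_le_of_lt h1 hj)) h2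
    · exact zero_mem _
  | .real δ n e, hv =>
    refine AddSubgroup.mem_map_of_mem _ ?_
    have h1 : δ < γ := WithTop.coe_lt_coe.mp (lt_of_le_of_lt hv.2 hj)
    exact le_below h1 (P.vl_mem δ _ n (Q.real_mem_D.mp hv.1.1).2.1.1)

theorem thFun_mem_N {W : Set Λ} {ν : ℕ} {φ : G → Λ → (n : ℕ) → P.V n → ℤ} {v : P.X}
    (hv : v ∈ Q.DW W) :
    Q.thFun W ν φ v ∈ (P.N Q.β).map (QuotientAddGroup.mk' Q.L) := by
  simp only [thFun, hv, if_true]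
  match v, hv with
  | .z, hv => exact absurd hv.1 Q.z_not_mem_D
  | .sym k ζ n y, hv =>
    dsimp only
    split_ifs
    · refine zsmul_mem (AddSubgroup.mem_map_of_mem _ ?_) _
      exact P.mono hv.1.1.1.1 hv.1.1.1.2
    · exact zero_mem _
  | .real δ n e, hv =>
    refine AddSubgroup.mem_map_of_mem _ ?_
    obtain ⟨⟨h1, -, -⟩, h2, -⟩ := Q.real_mem_D.mp hv.1
    exact P.mono h1 (P.vl_mem δ _ n h2.1)

theorem th_sub_mem {W : Set Λ} {ν : ℕ} {φ : G → Λ → (n : ℕ) → P.V n → ℤ} {γ : Λ}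
    {r : P.X →₀ ℤ} (hr : r ∈ suppS (Q.block γ ∩ Q.DW W)) :
    Q.th W ν φ r - QuotientAddGroup.mk' Q.L (evR P γ r) ∈
      (below P.N γ).map (QuotientAddGroup.mk' Q.L) := by
  have h0 : QuotientAddGroup.mk' Q.L (evR P γ r) =
      Finsupp.linearCombination ℤ (fun v => QuotientAddGroup.mk' Q.L (evFun P γ v)) r :=
    Finsupp.apply_linearCombination ℤ (QuotientAddGroup.mk' Q.L).toIntLinearMap (evFun P γ) r
  rw [h0]
  refine linearCombination_sub_mem ?_ hr
  rintro _ ⟨⟨hv, n, e, rfl⟩, hvW⟩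
  simp only [thFun, hvW, if_true, evFun]
  rw [← map_sub]
  exact AddSubgroup.mem_map_of_mem _ (P.vl_sub_mem γ _ n (Q.real_mem_D.mp hv).2.1.1)

theorem exists_lt_of_th_eq_zero [WellFoundedLT Λ] {W : Finset Λ} {ν : ℕ}
    {φ : G → Λ → (n : ℕ) → P.V n → ℤ}
    (hT : ∀ y ∈ P.sys.U (Q.DW W), Q.th W ν φ y = 0) {γ : Λ} {y : P.X →₀ ℤ}
    (hy : y ∈ suppS (Q.RK W γ)) (hθ : Q.th W ν φ y = 0) (hnew : ∀ x ∈ symNew P γ, y x = 0) :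
    y ∈ P.sys.U (Q.DW W) ∨ ∃ j < (γ : WithTop Λ), ∃ y' ∈ suppS (Q.RK W j),
      Q.th W ν φ y' = 0 ∧ y - y' ∈ P.sys.U (Q.DW W) := by
  classical
  set r := y.filter (· ∈ Q.block γ) with hrdef
  have hyr : y - r ∈ suppS {x | ∃ j < (γ : WithTop Λ), x ∈ Q.RK W j} := by
    intro x hx
    by_cases hxb : x ∈ Q.block γ
    · rw [Finsupp.sub_apply, hrdef, Finsupp.filter_apply_pos _ _ hxb, sub_self]
    · rw [Finsupp.sub_apply, hrdef, Finsupp.filter_apply_neg _ _ hxb, sub_zero]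
      by_cases hxR : x ∈ Q.RK W γ
      · by_cases hxn : x ∈ symNew P γ
        · exact hnew x hxn
        · exact absurd (Q.mem_RK_lt hxR hxn hxb) hx
      · exact hy x hxR
  suffices h : ∃ s ∈ suppS {x | ∃ j < (γ : WithTop Λ), x ∈ Q.RK W j},
      r - s ∈ P.sys.U (Q.DW W) by
    obtain ⟨s, hs, hrs⟩ := h
    have h1 : y - (y - r + s) ∈ P.sys.U (Q.DW W) := by
      convert hrs using 1; abel
    have h2 : Q.th W ν φ (y - r + s) = 0 := by
      have := hT _ h1
      rw [map_sub, hθ, zero_sub, neg_eq_zero] at this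
      exact this
    rcases mem_suppS_iUnion (Q.RK_mono (W : Set Λ)) (add_mem hyr hs) with h | ⟨j, hj, h⟩
    · left; rwa [h, sub_zero] at h1
    · exact Or.inr ⟨j, hj, _, h, h2, h1⟩
  by_cases hr0 : r = 0
  · exact ⟨0, zero_mem _, by rw [hr0, sub_zero]; exact zero_mem _⟩
  have hrb : r ∈ suppS (Q.block γ ∩ Q.DW W) := by
    intro x hx
    by_cases hxb : x ∈ Q.block γ
    · rw [hrdef, Finsupp.filter_apply_pos _ _ hxb]
      exact hy x fun h => hx ⟨hxb, h.1⟩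
    · rw [hrdef, Finsupp.filter_apply_neg _ _ hxb]
  obtain ⟨v, hv⟩ := Finsupp.support_nonempty_iff.mpr hr0
  obtain ⟨⟨hvD, n, e, rfl⟩, hvW⟩ := mem_suppS_iff_support.mp hrb hv
  have hW : γ ∈ (W : Set Λ) := (Q.real_mem_DW.mp hvW).2
  obtain ⟨⟨hβ, hI, hS⟩, -, -⟩ := Q.real_mem_D.mp hvD
  have h1 : Q.th W ν φ (y - r) ∈ (below P.N γ).map (QuotientAddGroup.mk' Q.L) :=
    linearCombination_mem (fun a ha => Q.thFun_mem ha) hyr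
  have h2 := Q.th_sub_mem (ν := ν) (φ := φ) hrb
  rw [map_sub, hθ, zero_sub] at h1
  have h3 : QuotientAddGroup.mk' Q.L (evR P γ r) ∈
      (below P.N γ).map (QuotientAddGroup.mk' Q.L) := by
    have := neg_mem (add_mem h1 h2)
    convert this using 1; abel
  obtain ⟨a, ha, hab⟩ := h3
  have h4 : evR P γ r ∈ below P.N γ ⊔ Q.L := by
    have h5 : evR P γ r - a ∈ Q.L := by
      rw [← QuotientAddGroup.eq_zero_iff]
      change QuotientAddGroup.mk' Q.L _ = 0
      rw [map_sub, hab, sub_self]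
    have := add_mem (AddSubgroup.mem_sup_left (T := Q.L) ha) (AddSubgroup.mem_sup_right h5)
    simpa using this
  obtain ⟨s, hs, u, hu, hsu⟩ := AddSubgroup.mem_sup.mp
    (Q.mem_of_evR_mem hW hS hI hβ (suppS_mono Set.inter_subset_left hrb) h4)
  refine ⟨s, suppS_mono ?_ hs, by rw [← hsu]; simpa using hu⟩
  rintro _ ⟨hv', k, ζ, n', y', rfl, γ', hγ', hk⟩
  exact ⟨γ', WithTop.coe_lt_coe.mpr hγ', Q.sym_mem_DW.mpr hv', γ', le_rfl, hk⟩

theorem free_DW [WellFoundedLT Λ] (W : Finset Λ) :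
    Module.Free ℤ ((P.X →₀ ℤ) ⧸ P.sys.U (Q.DW W)) := by
  classical
  have hfin : ∀ δ, ∃ ν, δ ∈ P.S → δ ∉ Q.I → ∀ n ≥ ν, ∀ e ∈ P.E δ n, P.ζ δ n e ∈ Q.I →
      P.N (P.ζ δ n e) ≤ Q.R := by
    intro δ
    by_cases h : δ ∈ P.S ∧ δ ∉ Q.I
    · obtain ⟨ν, hν⟩ := Q.fin δ h.1 h.2
      exact ⟨ν, fun _ _ => hν⟩
    · exact ⟨0, fun h1 h2 => absurd ⟨h1, h2⟩ h⟩
  choose νf hνf using hfin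
  let ν := max W.card (W.sup νf)
  have hφ : ∀ k ζ n, ∃ φ : P.V n → ℤ, ν ≤ n → ∀ δ ∈ W,
      Finsupp.linearCombination ℤ φ (P.bd δ ζ n k) = 1 := by
    intro k ζ n
    by_cases h : ν ≤ n
    · obtain ⟨φ, hφ⟩ := P.pot n k ζ W ((le_max_left _ _).trans h)
      exact ⟨φ, fun _ => hφ⟩
    · exact ⟨0, fun h' => absurd h' h⟩
  choose φ hφ using hφ
  have hT : ∀ y ∈ P.sys.U (Q.DW W), Q.th W ν φ y = 0 := fun y hy =>
    Q.th_eq_zero (fun k ζ n hn => hφ k ζ n hn) (fun δ hδ hS hI n hn =>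
      hνf δ hS hI n ((Finset.le_sup hδ).trans ((le_max_right _ _).trans hn))) hy
  let Np : WithTop Λ → AddSubgroup (P.X →₀ ℤ) := fun i =>
    suppS (Q.RK W i) ⊓ (if i = ⊤ then ⊤ else (Q.th W ν φ).ker)
  have hNp : ∀ γ : Λ, ∀ y, y ∈ Np γ ↔ y ∈ suppS (Q.RK W γ) ∧ Q.th W ν φ y = 0 := by
    intro γ y; simp [Np]
  have hNpt : ∀ y, y ∈ Np ⊤ ↔ y ∈ suppS (Q.RK W ⊤) := by
    intro y; simp [Np]
  have hlt : ∀ i < (⊤ : WithTop Λ), ∀ y, y ∈ Np i ↔ y ∈ suppS (Q.RK W i) ∧ Q.th W ν φ y = 0 := by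
    intro i hi y; simp [Np, hi.ne]
  let Pp : WithTop Λ → (P.X →₀ ℤ) →+ (P.X →₀ ℤ) × (G ⧸ Q.L) := fun i =>
    if i = ⊤ then (AddMonoidHom.inr _ _).comp (Q.th W ν φ)
    else (AddMonoidHom.inl _ _).comp (Finsupp.filterAddHom (· ∈ symNew P i))
  have hPt : ∀ y, Pp ⊤ y = (0, Q.th W ν φ y) := fun y => by simp [Pp]
  have hPγ : ∀ γ : Λ, ∀ y, Pp γ y = (y.filter (· ∈ symNew P γ), 0) := fun γ y => by
    simp [Pp, Finsupp.filterAddHom]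
  refine free_of_filtration (P.sys.U (Q.DW W)) Np ?_ Pp ?_ ?_ ?_
  · intro i j hij
    refine inf_le_inf (suppS_mono (Q.RK_mono (W : Set Λ) hij)) ?_
    by_cases hj : j = ⊤
    · simp [hj]
    · have hi : i ≠ ⊤ := fun h => hj (top_le_iff.mp (h ▸ hij))
      simp [hi, hj]
  · intro i
    induction i using WithTop.recTopCoe with
    | top =>
      have hle : ∀ w ∈ (Np ⊤).map (Pp ⊤), w.1 = 0 ∧
          w.2 ∈ (P.N Q.β).map (QuotientAddGroup.mk' Q.L) := by
        rintro _ ⟨y, hy, rfl⟩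
        rw [hPt]
        refine ⟨rfl, linearCombination_mem (fun a ha => Q.thFun_mem_N ha.1) ((hNpt y).mp hy)⟩
      refine free_of_injective Q.free
        (((AddMonoidHom.snd _ _).comp ((Np ⊤).map (Pp ⊤)).subtype).codRestrict _
          (fun w => (hle w w.2).2)) ?_
      intro a b hab
      have := congrArg Subtype.val hab
      exact Subtype.ext (Prod.ext ((hle a a.2).1.trans (hle b b.2).1.symm) this)
    | coe γ =>
      have hle : ∀ w ∈ (Np γ).map (Pp γ), w.2 = 0 := by
        rintro _ ⟨y, hy, rfl⟩
        rw [hPγ]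
      refine free_of_injective (B := P.X →₀ ℤ) inferInstance
        ((AddMonoidHom.fst _ _).comp ((Np γ).map (Pp γ)).subtype) ?_
      intro a b hab
      exact Subtype.ext (Prod.ext hab ((hle a a.2).trans (hle b b.2).symm))
  · intro i y hy
    induction i using WithTop.recTopCoe with
    | top =>
      rw [hPt]
      constructor
      · intro h
        have h1 : Q.th W ν φ y = 0 := (Prod.ext_iff.mp h).2
        have h2 : y ∈ suppS {x | ∃ j < (⊤ : WithTop Λ), x ∈ Q.RK W j} :=
          suppS_mono (fun x hx => Q.mem_RK_lt_top hx.1) ((hNpt y).mp hy)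
        rcases mem_suppS_iUnion (Q.RK_mono (W : Set Λ)) h2 with h | ⟨j, hj, h⟩
        · left; rw [h]; exact zero_mem _
        · right; exact ⟨j, hj, y, (hlt j hj y).mpr ⟨h, h1⟩, by rw [sub_self]; exact zero_mem _⟩
      · rintro (h | ⟨j, hj, y', hy', h⟩)
        · rw [hT y h]; rfl
        · have h1 := hT _ h
          rw [map_sub, ((hlt j hj y').mp hy').2, sub_zero] at h1
          rw [h1]; rfl
    | coe γ =>
      rw [hPγ]
      obtain ⟨hy1, hy2⟩ := (hNp γ y).mp hy
      constructor
      · intro h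
        have h1 : y.filter (· ∈ symNew P γ) = 0 := (Prod.ext_iff.mp h).1
        have h2 : ∀ x ∈ symNew P γ, y x = 0 := fun x hx => by
          have := DFunLike.congr_fun h1 x
          rwa [Finsupp.filter_apply_pos _ _ hx] at this
        rcases Q.exists_lt_of_th_eq_zero hT hy1 hy2 h2 with h | ⟨j, hj, y', h3, h4, h5⟩
        · exact Or.inl h
        · exact Or.inr ⟨j, hj, y', (hlt j (hj.trans (WithTop.coe_lt_top _)) y').mpr ⟨h3, h4⟩, h5⟩
      · intro h
        have h1 : ∀ x ∈ symNew P γ, y x = 0 := by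
          intro x hx
          rcases h with h | ⟨j, hj, y', hy', h⟩
          · exact Q.symNew_vanish hy1 h hx
          · have h3 := ((hlt j (hj.trans (WithTop.coe_lt_top _)) y').mp hy').1
            have h2 := Q.symNew_vanish (sub_mem hy1 (suppS_mono (Q.RK_mono (W : Set Λ) hj.le) h3))
              h hx
            have h4 : y' x = 0 := by
              refine h3 x fun hxR => ?_
              match x, hx, hxR with
              | .sym k _ _ _, hx, hxR =>
                obtain ⟨γ', h5, h6⟩ := hxR.2
                exact hx γ' (lt_of_le_of_lt h5 hj) h6
            rwa [Finsupp.sub_apply, h4, sub_zero] at h2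
        refine Prod.ext ?_ rfl
        ext x
        by_cases hx : x ∈ symNew P γ
        · simp [hx, h1 x hx]
        · simp [hx]
  · intro y
    refine ⟨⊤, y.filter (· ∈ Q.DW W), (hNpt _).mpr ?_, P.sys.sub_filter_mem_U _ _⟩
    refine suppS_mono ?_ (RelSys.filter_mem_suppS (Q.DW W) y)
    intro v hv
    obtain ⟨j, hj, h⟩ := Q.mem_RK_lt_top hv
    exact Q.RK_mono (W : Set Λ) hj.le h

end Piece

end Frame

theorem exists_countable_closed {X : Type*} (T : X → Set X) (hT : ∀ v, (T v).Finite) (x : X) :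
    ∃ C : Set X, x ∈ C ∧ C.Countable ∧ ∀ v ∈ C, T v ⊆ C := by
  let C : ℕ → Set X := fun n => Nat.rec {x} (fun _ s => ⋃ v ∈ s, T v) n
  refine ⟨⋃ n, C n, Set.mem_iUnion.mpr ⟨0, rfl⟩, Set.countable_iUnion fun n => ?_, ?_⟩
  · induction n with
    | zero => exact Set.countable_singleton x
    | succ n ih => exact ih.biUnion fun v _ => (hT v).countable
  · intro v hv u hu
    obtain ⟨n, hn⟩ := Set.mem_iUnion.mp hv
    exact Set.mem_iUnion.mpr ⟨n + 1, Set.mem_biUnion hn hu⟩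

namespace Frame

variable {G Λ : Type u} [AddCommGroup G] [LinearOrder Λ]

namespace Piece

variable {P : Frame G Λ} (Q : P.Piece)

theorem quotFun_eq_zero {δ : Λ} {v : P.X} (h : v ∉ Q.block δ) : Q.quotFun δ v = 0 := by
  classical
  by_cases hD : v ∈ Q.D
  · match v, h, hD with
    | .z, _, _ => simp [quotFun, evFun]
    | .sym _ _ _ _, _, _ => simp [quotFun, evFun]
    | .real δ' n e, h, hD =>
      have : δ' ≠ δ := by
        rintro rfl
        exact h ⟨hD, _, _, rfl⟩
      simp [quotFun, evFun, this]
  · simp [quotFun, hD]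

theorem linearCombination_quotFun_eq_zero {δ : Λ} {y : P.X →₀ ℤ} (hy : y ∈ suppS (Q.block δ)ᶜ) :
    Finsupp.linearCombination ℤ (Q.quotFun δ) y = 0 := by
  rw [linearCombination_congr (g := fun _ => 0) (fun a ha => Q.quotFun_eq_zero ha) hy]
  simp [Finsupp.linearCombination_apply]

theorem linearCombination_quotFun_block {δ : Λ} {y : P.X →₀ ℤ} (hy : y ∈ suppS (Q.block δ)) :
    Finsupp.linearCombination ℤ (Q.quotFun δ) y =
      QuotientAddGroup.mk' (below P.N δ ⊔ Q.L) (evR P δ y) := by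
  classical
  have h0 : QuotientAddGroup.mk' (below P.N δ ⊔ Q.L) (evR P δ y) = Finsupp.linearCombination ℤ
      (fun v => QuotientAddGroup.mk' (below P.N δ ⊔ Q.L) (evFun P δ v)) y :=
    Finsupp.apply_linearCombination ℤ
      (QuotientAddGroup.mk' (below P.N δ ⊔ Q.L)).toIntLinearMap (evFun P δ) y
  rw [h0]
  exact linearCombination_congr (fun a ha => by simp [quotFun, ha.1]) hy

theorem filter_block_mem [WellFoundedLT Λ] {W : Set Λ} {δ : Λ} (hδ : δ ∉ W) {m : ℤ} (hm : m ≠ 0)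
    {y w : P.X →₀ ℤ} (hw : w ∈ suppS (Q.DW W)) (hyw : m • y - w ∈ P.sys.U Q.D)
    {r : P.X →₀ ℤ} (hr : r ∈ suppS (Q.block δ)) (hyr : y - r ∈ suppS (Q.block δ)ᶜ) :
    r ∈ suppS (Q.DW W) ⊔ P.sys.U Q.D := by
  by_cases hr0 : r = 0
  · rw [hr0]; exact zero_mem _
  obtain ⟨v, hv⟩ := Finsupp.support_nonempty_iff.mpr hr0
  obtain ⟨hvD, n, e, rfl⟩ := mem_suppS_iff_support.mp hr hv
  obtain ⟨⟨hβ, hI, hS⟩, -, -⟩ := Q.real_mem_D.mp hvD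
  have h1 := Q.evR_mem_of_mem_U (δ := δ) hyw
  have h2 : Finsupp.linearCombination ℤ (Q.quotFun δ) w = 0 := by
    refine Q.linearCombination_quotFun_eq_zero (suppS_mono ?_ hw)
    rintro v ⟨-, hv⟩ ⟨-, n, e, rfl⟩
    exact hδ (hv _ _ _ rfl)
  have h3 : Finsupp.linearCombination ℤ (Q.quotFun δ) y =
      Finsupp.linearCombination ℤ (Q.quotFun δ) r := by
    have := Q.linearCombination_quotFun_eq_zero hyr
    rwa [map_sub, sub_eq_zero] at this
  rw [map_sub, h2, sub_zero, map_zsmul, h3, Q.linearCombination_quotFun_block hr, ← map_zsmul,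
    QuotientAddGroup.mk'_apply, QuotientAddGroup.eq_zero_iff] at h1
  have h4 : evR P δ r ∈ P.N δ := by
    refine linearCombination_mem ?_ hr
    rintro _ ⟨hv, n, e, rfl⟩
    simp only [evFun, if_true]
    exact P.E_sub δ n (Q.real_mem_D.mp hv).2.1.1
  have h5 := Q.mem_of_evR_mem (W := Set.univ) (Set.mem_univ δ) hS hI hβ hr
    (Q.hA.pure hβ (Q.R_below δ hS hI) hm h4 h1)
  rw [DW_univ] at h5
  refine (sup_le_sup_right (suppS_mono ?_) _) h5
  rintro _ ⟨hv, k, ζ, n, y, rfl, -⟩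
  exact Q.sym_mem_DW.mpr hv

theorem mem_sup_of_smul [WellFoundedLT Λ] {W : Set Λ} {m : ℤ} (hm : m ≠ 0)
    {y w : P.X →₀ ℤ} (hy : y ∈ suppS Q.D) (hw : w ∈ suppS (Q.DW W))
    (hyw : m • y - w ∈ P.sys.U Q.D) : y ∈ suppS (Q.DW W) ⊔ P.sys.U Q.D := by
  classical
  have key : ∀ T : Finset Λ, y.filter (· ∈ Q.DW (W ∪ T)) ∈ suppS (Q.DW W) ⊔ P.sys.U Q.D := by
    intro T
    induction T using Finset.induction with
    | empty =>
      refine AddSubgroup.mem_sup_left ?_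
      simpa using RelSys.filter_mem_suppS (Q.DW W) y
    | insert δ T hδT ih =>
      by_cases hδ : δ ∈ W
      · have : W ∪ ((insert δ T : Finset Λ) : Set Λ) = W ∪ T := by
          ext a
          simp only [Finset.coe_insert, Set.mem_union, Set.mem_insert_iff]
          constructor
          · rintro (h | rfl | h)
            exacts [Or.inl h, Or.inl hδ, Or.inr h]
          · rintro (h | h)
            exacts [Or.inl h, Or.inr (Or.inr h)]
        rwa [this]
      · have h1 : y.filter (· ∈ Q.block δ) ∈ suppS (Q.DW W) ⊔ P.sys.U Q.D := by
          refine Q.filter_block_mem hδ hm hw hyw (RelSys.filter_mem_suppS (Q.block δ) y) ?_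
          intro x hx
          rw [Finsupp.sub_apply, Finsupp.filter_apply_pos _ _ (not_not.mp hx), sub_self]
        have h2 := add_mem ih h1
        convert h2 using 1
        ext x
        rw [Finsupp.add_apply]
        by_cases hxD : x ∈ Q.D
        · match x, hxD with
          | .z, hxD => exact absurd hxD Q.z_not_mem_D
          | .sym k ζ n a, hxD =>
            have h3 : Item.sym k ζ n a ∉ Q.block δ := by rintro ⟨-, _, _, h⟩; cases h
            rw [Finsupp.filter_apply_pos _ _ (Q.sym_mem_DW.mpr hxD),
              Finsupp.filter_apply_pos _ _ (Q.sym_mem_DW.mpr hxD),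
              Finsupp.filter_apply_neg _ _ h3, add_zero]
          | .real δ' n e, hxD =>
            by_cases hδδ : δ' = δ
            · subst hδδ
              rw [Finsupp.filter_apply_pos _ _ (Q.real_mem_DW.mpr ⟨hxD, by simp⟩),
                Finsupp.filter_apply_pos (· ∈ Q.block δ') _ ⟨hxD, _, _, rfl⟩,
                Finsupp.filter_apply_neg, zero_add]
              rintro h
              rcases (Q.real_mem_DW.mp h).2 with h | h
              exacts [hδ h, hδT h]
            · have h3 : Item.real δ' n e ∉ Q.block δ := by
                rintro ⟨-, _, _, h⟩; injection h with h; exact hδδ h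
              rw [Finsupp.filter_apply_neg _ _ h3, add_zero]
              simp only [Finsupp.filter_apply, Q.real_mem_DW, Finset.coe_insert, Set.mem_union,
                Set.mem_insert_iff, hδδ, false_or]
        · rw [Finsupp.filter_apply_neg _ _ (fun h => hxD h.1),
            Finsupp.filter_apply_neg _ _ (fun h => hxD h.1),
            Finsupp.filter_apply_neg _ _ (fun h => hxD h.1), add_zero]
  let lv : P.X → Finset Λ := fun v =>
    match v with
    | .z => ∅
    | .sym _ _ _ _ => ∅
    | .real δ _ _ => {δ}
  have h1 := key (y.support.biUnion lv)
  rwa [Finsupp.filter_eq_self_iff .. |>.mpr] at h1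
  intro x hx
  refine ⟨mem_suppS_iff_support.mp hy (Finsupp.mem_support_iff.mpr hx), ?_⟩
  rintro δ n e rfl
  right
  simp only [Finset.coe_biUnion, Set.mem_iUnion]
  exact ⟨_, Finsupp.mem_support_iff.mpr hx, by simp [lv]⟩

theorem free_of_countable [WellFoundedLT Λ] (hD : Q.D.Countable) :
    Module.Free ℤ ((P.X →₀ ℤ) ⧸ P.sys.U Q.D) := by
  classical
  have hrep : ∀ q : (P.X →₀ ℤ) ⧸ P.sys.U Q.D, ∃ y ∈ suppS Q.D,
      QuotientAddGroup.mk' (P.sys.U Q.D) y = q := by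
    intro q
    obtain ⟨y, rfl⟩ := QuotientAddGroup.mk'_surjective _ q
    refine ⟨y.filter (· ∈ Q.D), RelSys.filter_mem_suppS _ y, ?_⟩
    rw [eq_comm, ← sub_eq_zero, ← map_sub, QuotientAddGroup.mk'_apply, QuotientAddGroup.eq_zero_iff]
    exact P.sys.sub_filter_mem_U Q.D y
  choose rep hrepD hrep using hrep
  have : Countable Q.D := hD
  have hcount : Countable ((P.X →₀ ℤ) ⧸ P.sys.U Q.D) := by
    refine Function.Surjective.countable (f := fun c : Q.D →₀ ℤ =>
      QuotientAddGroup.mk' (P.sys.U Q.D) (c.mapDomain Subtype.val)) fun q => ?_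
    refine ⟨(rep q).comapDomain Subtype.val Subtype.val_injective.injOn, ?_⟩
    change QuotientAddGroup.mk' (P.sys.U Q.D) _ = q
    rw [Finsupp.mapDomain_comapDomain _ Subtype.val_injective, hrep]
    rw [Subtype.range_coe]
    exact mem_suppS_iff_support.mp (hrepD q)
  let lv : P.X → Finset Λ := fun v =>
    match v with
    | .z => ∅
    | .sym _ _ _ _ => ∅
    | .real δ _ _ => {δ}
  refine _root_.free_of_countable fun s => ?_
  let W : Finset Λ := s.biUnion fun q => (rep q).support.biUnion lv
  refine ⟨(suppS (Q.DW W)).map (QuotientAddGroup.mk' (P.sys.U Q.D)), ?_,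
    P.sys.free_image_of_closed (Q.cl_DW W) (Q.free_DW W), ?_⟩
  · intro q hq
    refine ⟨rep q, ?_, hrep q⟩
    change rep q ∈ suppS _
    rw [mem_suppS_iff_support]
    intro v hv
    refine ⟨mem_suppS_iff_support.mp (hrepD q) hv, ?_⟩
    rintro δ n e rfl
    simp only [W, Finset.coe_biUnion, Set.mem_iUnion]
    exact ⟨q, hq, _, hv, by simp [lv]⟩
  · intro m hm q hq
    obtain ⟨w, hw, hwq⟩ := hq
    have h1 : m • rep q - w ∈ P.sys.U Q.D := by
      rw [← QuotientAddGroup.eq_zero_iff]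
      change QuotientAddGroup.mk' (P.sys.U Q.D) _ = 0
      rw [map_sub, map_zsmul, hrep, hwq, sub_self]
    obtain ⟨a, ha, u, hu, hau⟩ := AddSubgroup.mem_sup.mp (Q.mem_sup_of_smul hm (hrepD q) hw h1)
    refine ⟨a, ha, ?_⟩
    rw [← hrep q, ← hau, map_add]
    have : QuotientAddGroup.mk' (P.sys.U Q.D) u = 0 := by
      rwa [QuotientAddGroup.mk'_apply, QuotientAddGroup.eq_zero_iff]
    rw [this, add_zero]

end Piece

/-- A pair of killed levels and killed subgroup below a bound. -/
structure Good (P : Frame G Λ) (I : Set Λ) (R : AddSubgroup G) (β : Λ) : Prop where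
  lower : IsLowerSet I
  le : R ≤ P.N β
  free : Module.Free ℤ ((P.N β).map (QuotientAddGroup.mk' R))
  R_below : ∀ δ ∈ P.S, δ ∉ I → R ≤ below P.N δ
  fin : ∀ δ ∈ P.S, δ ∉ I → ∃ ν, ∀ n ≥ ν, ∀ e ∈ P.E δ n, P.ζ δ n e ∈ I → P.N (P.ζ δ n e) ≤ R

theorem exists_closing [WellFoundedLT Λ] (P : Frame G Λ) {ι : Type*} (β : Λ)
    (f : P.N β →+ (ι →₀ ℤ)) (b : ι → P.N β) :
    ∃ T : P.X → Set P.X, (∀ v, (T v).Finite) ∧ ∀ A : Set P.X, (∀ v ∈ A, T v ⊆ A) → P.OC A ∧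
      ∀ γ ≤ β, ∀ n, ∀ e (he : e ∈ P.N β), e ∈ P.tw A γ n → ∀ i, f ⟨e, he⟩ i ≠ 0 →
        (b i : G) ∈ P.Lg A (Set.Iic β) := by
  classical
  have h1 : ∀ v : P.X, ∃ T : Set P.X, T.Finite ∧ (∀ u, P.tail v u ≠ 0 → u ∈ T) ∧
      (∀ γ n e, v = Item.real γ n e → e ∈ P.E γ n → P.k γ n e ∈ P.Lg T (Set.Iio γ)) ∧
      (∀ k ζ n y, v = Item.sym k ζ n y → k ∈ P.N ζ → k ∈ P.Lg T (Set.Iic ζ)) ∧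
      ∀ γ n e (he : e ∈ P.N β), v = Item.real γ n e → ∀ i, f ⟨e, he⟩ i ≠ 0 →
        (b i : G) ∈ P.Lg T (Set.Iic β) := by
    intro v
    match v with
    | .z => exact ⟨∅, Set.finite_empty, fun u h => absurd rfl h, fun _ _ _ h => (by cases h),
        fun _ _ _ _ h => (by cases h), fun _ _ _ _ h => (by cases h)⟩
    | .sym k ζ n y =>
      by_cases hk : k ∈ P.N ζ
      · obtain ⟨T, hT, h⟩ := P.exists_finite_Lg hk
        refine ⟨T, hT, fun u h => absurd rfl h, fun _ _ _ h => (by cases h), ?_,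
          fun _ _ _ _ h => (by cases h)⟩
        rintro k' ζ' n' y' h' -
        injection h' with h1 h2
        subst h1 h2
        exact h
      · refine ⟨∅, Set.finite_empty, fun u h => absurd rfl h, fun _ _ _ h => (by cases h), ?_,
          fun _ _ _ _ h => (by cases h)⟩
        rintro k' ζ' n' y' h' h''
        injection h' with h1 h2
        subst h1 h2
        exact absurd h'' hk
    | .real δ n e =>
      have h2 : ∃ T : Set P.X, T.Finite ∧ (e ∈ P.E δ n → P.k δ n e ∈ P.Lg T (Set.Iio δ)) := by
        by_cases he : e ∈ P.E δ n
        · rcases (mem_below P.mono).mp (P.x_mem δ n e he) with h | ⟨γ, hγ, h⟩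
          · refine ⟨∅, Set.finite_empty, fun _ => ?_⟩
            change e - ev (P.x δ n e) ∈ _
            rw [h]; exact zero_mem _
          · obtain ⟨T, hT, h'⟩ := P.exists_finite_Lg h
            exact ⟨T, hT, fun _ => P.Lg_mono le_rfl (Set.Iic_subset_Iio.mpr hγ) h'⟩
        · exact ⟨∅, Set.finite_empty, fun h => absurd h he⟩
      obtain ⟨T1, hT1, h3⟩ := h2
      have h4 : ∀ i, ∃ T : Set P.X, T.Finite ∧ (b i : G) ∈ P.Lg T (Set.Iic β) := fun i =>
        P.exists_finite_Lg (b i).2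
      choose Tb hTb h5 using h4
      let T2 : Set P.X := if he : e ∈ P.N β then ⋃ i ∈ (f ⟨e, he⟩).support, Tb i else ∅
      have hT2 : T2.Finite := by
        by_cases he : e ∈ P.N β
        · simp only [T2, he, dif_pos]
          exact (f ⟨e, he⟩).support.finite_toSet.biUnion fun i _ => hTb i
        · simp [T2, he]
      refine ⟨(P.tail (Item.real δ n e)).support ∪ (T1 ∪ T2),
        (Finset.finite_toSet _).union (hT1.union hT2),
        fun u h => Or.inl (Finsupp.mem_support_iff.mpr h), ?_, fun _ _ _ _ h => (by cases h), ?_⟩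
      · rintro γ n' e' h he
        injection h with e1 e2 e3
        subst e1 e2 e3
        exact P.Lg_mono (Set.subset_union_left.trans Set.subset_union_right) le_rfl (h3 he)
      · rintro γ n' e' he h i hi
        injection h with e1 e2 e3
        subst e1 e2 e3
        refine P.Lg_mono (Set.Subset.trans ?_
          (Set.subset_union_right.trans Set.subset_union_right)) le_rfl (h5 i)
        simp only [T2, he, dif_pos]
        exact Set.subset_biUnion_of_mem (u := Tb) (Finsupp.mem_support_iff.mpr hi)
  choose T hT h2 h3 h4 h5 using h1
  refine ⟨T, hT, fun A hA => ⟨⟨fun v hv u hu => hA v hv (h2 v u hu), ?_, ?_⟩, ?_⟩⟩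
  · intro γ n e he
    exact P.Lg_mono (hA _ he.2) le_rfl (h3 _ _ _ _ rfl he.1)
  · intro k ζ n y hv hk
    exact P.Lg_mono (hA _ hv) le_rfl (h4 _ _ _ _ _ rfl hk)
  · intro γ _ n e he heA i hi
    exact P.Lg_mono (hA _ heA.2) le_rfl (h5 _ _ _ _ he rfl i hi)

theorem Good.free_quotient [WellFoundedLT Λ] {P : Frame G Λ} {I : Set Λ} {R : AddSubgroup G}
    {β : Λ} (h : P.Good I R β) :
    Module.Free ℤ ((P.X →₀ ℤ) ⧸ P.sys.U (P.items (Set.Iic β) \ P.items I)) := by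
  classical
  have := h.free
  let B := (P.N β).map (QuotientAddGroup.mk' R)
  let ι := Module.Free.ChooseBasisIndex ℤ B
  let b0 : Module.Basis ι ℤ B := Module.Free.chooseBasis ℤ B
  let p : P.N β →+ B := (QuotientAddGroup.mk' R).addSubgroupMap (P.N β)
  have hp : Function.Surjective p := (QuotientAddGroup.mk' R).addSubgroupMap_surjective _
  let f : P.N β →+ (ι →₀ ℤ) := b0.repr.toLinearMap.toAddMonoidHom.comp p
  have hf : ∀ a, f a = 0 ↔ (a : G) ∈ R := by
    intro a
    have h1 : f a = 0 ↔ p a = 0 := b0.repr.map_eq_zero_iff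
    rw [h1, ← QuotientAddGroup.eq_zero_iff, Subtype.ext_iff]
    rfl
  choose b hb0 using fun i => hp (b0 i)
  have hb : ∀ i, f (b i) = Finsupp.single i 1 := by
    intro i
    change b0.repr (p (b i)) = _
    rw [hb0, b0.repr_self]
  obtain ⟨T, hT, hOC⟩ := P.exists_closing β f b
  choose cl hx hc hclosed using exists_countable_closed T hT
  obtain ⟨_, _⟩ := exists_wellFoundedLT P.X
  have : Nonempty P.X := ⟨Item.z⟩
  set D0 := P.items (Set.Iic β) \ P.items I with hD0
  have hle : ∀ x : P.X, ∀ v ∈ ⋃ y : Set.Iic x, cl y, T v ⊆ ⋃ y : Set.Iic x, cl y := by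
    intro x v hv
    obtain ⟨y, hy⟩ := Set.mem_iUnion.mp hv
    exact (hclosed y v hy).trans (Set.subset_iUnion (fun y : Set.Iic x => cl y) y)
  have hlt : ∀ x : P.X, ∀ v ∈ ⋃ y : Set.Iio x, cl y, T v ⊆ ⋃ y : Set.Iio x, cl y := by
    intro x v hv
    obtain ⟨y, hy⟩ := Set.mem_iUnion.mp hv
    exact (hclosed y v hy).trans (Set.subset_iUnion (fun y : Set.Iio x => cl y) y)
  refine P.sys.free_of_closed_filtration D0 (fun x : P.X => D0 ∩ ⋃ y : Set.Iic x, cl y) ?_ ?_ ?_ ?_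
  · intro x x' hxx' v hv
    obtain ⟨y, hy⟩ := Set.mem_iUnion.mp hv.2
    exact ⟨hv.1, Set.mem_iUnion.mpr ⟨⟨y, y.2.trans hxx'⟩, hy⟩⟩
  · refine Set.Subset.antisymm ?_ (Set.iUnion_subset fun x => Set.inter_subset_left)
    intro v hv
    exact Set.mem_iUnion.mpr ⟨v, hv, Set.mem_iUnion.mpr ⟨⟨v, le_refl v⟩, hx v⟩⟩
  · intro x
    exact ⟨Set.inter_subset_left, fun v hv _ u hu hne => ⟨hu, (hOC _ (hle x)).1.tail v hv.2 u hne⟩⟩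
  · intro x
    let Q : P.Piece :=
      { I := I, R := R, β := β, A := ⋃ y : Set.Iio x, cl y, A' := ⋃ y : Set.Iic x, cl y
        R_below := h.R_below
        fin := h.fin
        hA := (hOC _ (hlt x)).1
        hA' := (hOC _ (hle x)).1
        free := free_map_of_basis h.le f hf b hb _ (hOC _ (hlt x)).2 }
    have hQD : (D0 ∩ ⋃ y : Set.Iic x, cl y) \ ⋃ j : Set.Iio x, D0 ∩ ⋃ y : Set.Iic (j : P.X), cl y =
        Q.D := by
      ext v
      constructor
      · rintro ⟨⟨h1, h2⟩, h3⟩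
        refine ⟨h1, h2, fun h4 => h3 ?_⟩
        obtain ⟨y, hy⟩ := Set.mem_iUnion.mp h4
        exact Set.mem_iUnion.mpr ⟨y, h1, Set.mem_iUnion.mpr ⟨⟨y, le_refl (y : P.X)⟩, hy⟩⟩
      · rintro ⟨h1, h2, h3⟩
        refine ⟨⟨h1, h2⟩, fun h4 => h3 ?_⟩
        obtain ⟨j, -, hj⟩ := Set.mem_iUnion.mp h4
        obtain ⟨y, hy⟩ := Set.mem_iUnion.mp hj
        exact Set.mem_iUnion.mpr ⟨⟨y, lt_of_le_of_lt (Set.mem_Iic.mp y.2) j.2⟩, hy⟩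
    rw [hQD]
    refine Q.free_of_countable ((hc x).mono ?_)
    rintro v ⟨-, h2, h3⟩
    obtain ⟨y, hy⟩ := Set.mem_iUnion.mp h2
    rcases lt_or_eq_of_le (show (y : P.X) ≤ x from y.2) with h4 | h4
    · exact absurd (Set.mem_iUnion.mpr ⟨⟨y, h4⟩, hy⟩) h3
    · rwa [h4] at hy

end Frame

theorem IsKappaFree.of_injective {lam : Cardinal.{u}} {A B : Type u} [AddCommGroup A]
    [AddCommGroup B] (hB : IsKappaFree lam B) (f : A →+ B) (hf : Function.Injective f) :
    IsKappaFree lam A := by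
  intro K hK
  have h1 : Module.Free ℤ (K.map f) := by
    refine hB (K.map f) (lt_of_le_of_lt ?_ hK)
    exact mk_le_of_surjective (f.addSubgroupMap_surjective K)
  refine free_of_injective h1 (f.addSubgroupMap K) ?_
  intro a b hab
  exact Subtype.ext (hf (congrArg Subtype.val hab))

/-- If a subgroup is the kernel of a map to a `κ`-free group, then the quotient is `κ`-free. -/
theorem IsKappaFree.quotient_of_ker {lam : Cardinal.{u}} {A B : Type u} [AddCommGroup A]
    [AddCommGroup B] (hB : IsKappaFree lam B) (f : A →+ B) (K : AddSubgroup A)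
    (hK : ∀ a, f a = 0 ↔ a ∈ K) : IsKappaFree lam (A ⧸ K) := by
  refine hB.of_injective (QuotientAddGroup.lift K f fun a ha => (hK a).mpr ha) ?_
  rw [injective_iff_map_eq_zero]
  intro a
  induction a using QuotientAddGroup.induction_on with
  | H a =>
    intro h
    rw [QuotientAddGroup.eq_zero_iff]
    exact (hK a).mp h

theorem mk_suppS_le {μ : Cardinal.{u}} (hinf : ℵ₀ ≤ μ) {X : Type u} {C : Set X} (hC : #C ≤ μ) :
    #(suppS C) ≤ μ := by
  classical
  have h1 : #(suppS C) ≤ #(C →₀ ℤ) := by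
    refine mk_le_of_injective (f := fun y : suppS C => (y : X →₀ ℤ).subtypeDomain (· ∈ C)) ?_
    intro a b hab
    refine Subtype.ext (Finsupp.ext fun x => ?_)
    by_cases hx : x ∈ C
    · exact DFunLike.congr_fun hab ⟨x, hx⟩
    · rw [a.2 x hx, b.2 x hx]
  refine h1.trans ?_
  rcases isEmpty_or_nonempty C with h | h
  · have : #(C →₀ ℤ) = 1 := by
      rw [eq_one_iff_unique]
      exact ⟨⟨fun a b => Finsupp.ext fun x => h.elim x⟩, ⟨0⟩⟩
    rw [this]
    exact one_le_aleph0.trans hinf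
  · rw [mk_finsupp_lift_of_infinite']
    simp only [mk_eq_aleph0, lift_aleph0, lift_uzero]
    exact max_le hC hinf

namespace RelSys

variable {X : Type u} (P : RelSys X)

theorem Cl.diff {A D : Set X} (h : P.Cl A D) (B : Set X) : P.Cl (A \ B) (D \ B) :=
  ⟨Set.sdiff_subset_sdiff_left h.1,
    fun v hv hR u hu hne => ⟨h.2 v hv.1 hR u hu.1 hne, hu.2⟩⟩

/-- The map killing a closed set of generators. -/
noncomputable def kill {A D : Set X} (h : P.Cl A D) :
    (X →₀ ℤ) ⧸ P.U D →+ (X →₀ ℤ) ⧸ P.U (D \ A) :=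
  QuotientAddGroup.map _ _ (AddMonoidHom.id _) (P.U_le_diff h)

theorem kill_eq_zero {A D : Set X} (h : P.Cl A D) (q : (X →₀ ℤ) ⧸ P.U D) :
    P.kill h q = 0 ↔ q ∈ (suppS A).map (QuotientAddGroup.mk' (P.U D)) := by
  classical
  induction q using QuotientAddGroup.induction_on with
  | H y =>
    change (QuotientAddGroup.mk y : (X →₀ ℤ) ⧸ P.U (D \ A)) = 0 ↔ _
    rw [QuotientAddGroup.eq_zero_iff]
    constructor
    · rintro ⟨c, hc, hcy⟩
      have hcD : c ∈ suppS (D ∩ P.R) :=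
        suppS_mono (Set.inter_subset_inter_left _ Set.sdiff_subset) hc
      refine ⟨(y - P.rel c).filter (· ∈ A), filter_mem_suppS _ _, ?_⟩
      rw [QuotientAddGroup.mk'_apply, QuotientAddGroup.eq]
      refine ⟨c, hcD, fun x hx => ?_⟩
      by_cases hxA : x ∈ A
      · simp [Finsupp.filter_apply_pos _ _ hxA]
      · have := hcy x ⟨hx, hxA⟩
        simpa [Finsupp.filter_apply_neg _ _ hxA] using this
    · rintro ⟨y', hy', h'⟩
      rw [QuotientAddGroup.mk'_apply, QuotientAddGroup.eq] at h'
      have h1 := P.U_le_diff h h'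
      have h2 : y' ∈ P.U (D \ A) := P.mem_U_of_vanish fun x hx => hy' x hx.2
      simpa using add_mem h2 h1

end RelSys

namespace Frame

variable {G Λ : Type u} [AddCommGroup G] [LinearOrder Λ] (P : Frame G Λ)

theorem cl_items {I : Set Λ} (hI : IsLowerSet I) : P.sys.Cl (P.items I) (P.items Set.univ) := by
  refine ⟨P.items_mono (Set.subset_univ _), ?_⟩
  intro v hv hR u hu hne
  obtain ⟨δ, n, e, rfl, hδ, he⟩ := P.exists_real_of_mem_rset hR
  obtain ⟨hδI, -, -⟩ := P.real_mem_items.mp hv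
  match u, hu, hne with
  | .z, _, _ => trivial
  | .sym k ζ m y, hu, hne =>
    obtain ⟨-, rfl⟩ := P.tail_real_sym_ne hne
    exact ⟨hI (P.ζ_lt δ hδ n e he).le hδI, hu.2⟩
  | .real δ' n' e', hu, hne =>
    obtain ⟨rfl, -, -⟩ := P.tail_real_real_ne hne
    exact ⟨hδI, hδ, hu.2.2⟩

/-- The group of a frame. -/
abbrev Grp := (P.X →₀ ℤ) ⧸ P.sys.U (P.items Set.univ)

/-- The distinguished element. -/
noncomputable def zG : P.Grp := QuotientAddGroup.mk (Finsupp.single Item.z 1)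

theorem exists_bound [Nonempty Λ] (y : P.X →₀ ℤ) :
    ∃ β, ∀ v, y v ≠ 0 → v ∈ P.items Set.univ → v ∈ P.items (Set.Iic β) := by
  classical
  induction y using Finsupp.induction_linear with
  | zero => exact ⟨Classical.arbitrary Λ, fun v h => absurd rfl h⟩
  | add f g hf hg =>
    obtain ⟨β, h1⟩ := hf
    obtain ⟨β', h2⟩ := hg
    refine ⟨max β β', fun v hv hva => ?_⟩
    by_cases h : f v = 0
    · have h' : g v ≠ 0 := by
        intro h'; exact hv (by rw [Finsupp.add_apply, h, h', add_zero])
      exact P.items_mono (Set.Iic_subset_Iic.mpr (le_max_right _ _)) (h2 v h' hva)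
    · exact P.items_mono (Set.Iic_subset_Iic.mpr (le_max_left _ _)) (h1 v h hva)
  | single u n =>
    match u with
    | .z => exact ⟨Classical.arbitrary Λ, fun v h _ => by
        rw [Finsupp.single_apply] at h
        split_ifs at h with h'
        · subst h'; trivial
        · exact absurd rfl h⟩
    | .sym k ζ m y => exact ⟨ζ, fun v h hva => by
        rw [Finsupp.single_apply] at h
        split_ifs at h with h'
        · subst h'; exact ⟨le_refl ζ, hva.2⟩
        · exact absurd rfl h⟩
    | .real δ m e => exact ⟨δ, fun v h hva => by
        rw [Finsupp.single_apply] at h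
        split_ifs at h with h'
        · subst h'; exact ⟨le_refl δ, hva.2⟩
        · exact absurd rfl h⟩

theorem isKappaFree_quotient [WellFoundedLT Λ] [Nonempty Λ] {lam : Cardinal.{u}}
    (hbdd : ∀ (A : Type u) (f : A → Λ), #A < lam → ∃ β, ∀ a, f a ≤ β) {I : Set Λ}
    {R : AddSubgroup G} {β0 : Λ} (hgood : ∀ β ≥ β0, P.Good I R β) :
    IsKappaFree lam ((P.X →₀ ℤ) ⧸ P.sys.U (P.items Set.univ \ P.items I)) := by
  classical
  intro K hK
  choose b hb using P.exists_bound
  choose r hr using QuotientAddGroup.mk_surjective (s := P.sys.U (P.items Set.univ \ P.items I))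
  obtain ⟨β1, hβ1⟩ := hbdd K (fun q => b (r q)) hK
  let β := max β0 β1
  have h1 : P.sys.Cl (P.items (Set.Iic β) \ P.items I) (P.items Set.univ \ P.items I) :=
    RelSys.Cl.diff _ (P.cl_items (isLowerSet_Iic β)) _
  have h2 := P.sys.free_image_of_closed h1 (hgood β (le_max_left _ _)).free_quotient
  refine free_subgroup_mono ?_ h2
  intro q hq
  set y := r q with hy
  have hyq : (QuotientAddGroup.mk y : (P.X →₀ ℤ) ⧸ _) = q := hr q
  refine ⟨y.filter (· ∈ P.items (Set.Iic β) \ P.items I), RelSys.filter_mem_suppS _ _, ?_⟩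
  rw [← hyq, QuotientAddGroup.mk'_apply, QuotientAddGroup.eq]
  refine P.sys.mem_U_of_vanish fun x hx => ?_
  by_cases hxy : y x = 0
  · have : y.filter (· ∈ P.items (Set.Iic β) \ P.items I) x = 0 := by
      rw [Finsupp.filter_apply]; split_ifs <;> simp [hxy]
    rw [Finsupp.add_apply, Finsupp.neg_apply, this, hxy, neg_zero, add_zero]
  · have h3 : x ∈ P.items (Set.Iic β) := by
      refine P.items_mono (Set.Iic_subset_Iic.mpr ?_) (hb y x hxy hx.1)
      exact (hβ1 ⟨q, hq⟩).trans (le_max_right _ _)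
    rw [Finsupp.add_apply, Finsupp.neg_apply,
      Finsupp.filter_apply_pos (· ∈ P.items (Set.Iic β) \ P.items I) y ⟨h3, hx.2⟩, neg_add_cancel]

/-- The image of the generators at indices in a set. -/
noncomputable def sub (I : Set Λ) : AddSubgroup P.Grp :=
  (suppS (P.items I)).map (QuotientAddGroup.mk' _)

theorem isKappaFree_quotient_sub [WellFoundedLT Λ] [Nonempty Λ] {lam : Cardinal.{u}}
    (hbdd : ∀ (A : Type u) (f : A → Λ), #A < lam → ∃ β, ∀ a, f a ≤ β) {I : Set Λ}
    {R : AddSubgroup G} {β0 : Λ} (hgood : ∀ β ≥ β0, P.Good I R β) :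
    IsKappaFree lam (P.Grp ⧸ P.sub I) :=
  (P.isKappaFree_quotient hbdd hgood).quotient_of_ker
    (P.sys.kill (P.cl_items (hgood β0 le_rfl).lower)) _ fun q => P.sys.kill_eq_zero _ q

theorem suppS_items_empty {y : P.X →₀ ℤ} (hy : y ∈ suppS (P.items ∅)) :
    y = Finsupp.single Item.z (y Item.z) := by
  classical
  ext v
  match v with
  | .z => simp
  | .sym k ζ m w =>
    rw [hy _ (fun h => (P.sym_mem_items.mp h).1), Finsupp.single_eq_of_ne (by intro h; cases h)]
  | .real δ m e =>
    rw [hy _ (fun h => (P.real_mem_items.mp h).1), Finsupp.single_eq_of_ne (by intro h; cases h)]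

theorem zG_mem_sub (I : Set Λ) : P.zG ∈ P.sub I :=
  ⟨_, single_mem_suppS (P.z_mem_items I) 1, rfl⟩

theorem sub_empty : P.sub ∅ = AddSubgroup.zmultiples P.zG := by
  apply le_antisymm
  · rintro q ⟨y, hy, rfl⟩
    rw [AddSubgroup.mem_zmultiples_iff]
    refine ⟨y Item.z, ?_⟩
    conv_rhs => rw [P.suppS_items_empty hy]
    rw [zG, ← QuotientAddGroup.mk_zsmul, Finsupp.smul_single, smul_eq_mul, mul_one]
    rfl
  · exact AddSubgroup.zmultiples_le_of_mem (P.zG_mem_sub ∅)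

theorem zsmul_zG_ne {m : ℤ} (hm : m ≠ 0) : m • P.zG ≠ 0 := by
  intro h
  rw [zG, ← QuotientAddGroup.mk_zsmul, Finsupp.smul_single, smul_eq_mul, mul_one,
    QuotientAddGroup.eq_zero_iff] at h
  have h1 := P.sys.mem_U_of_closed (P.cl_items isLowerSet_empty)
    (single_mem_suppS (P.z_mem_items ∅) m) h
  obtain ⟨c, hc, hcy⟩ := h1
  have hc0 : c = 0 := by
    ext v
    refine hc v ?_
    rintro ⟨h1, h2⟩
    obtain ⟨δ, n, e, rfl, hδ, he⟩ := P.exists_real_of_mem_rset h2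
    exact h1.1
  have := hcy Item.z (P.z_mem_items ∅)
  simp [hc0] at this
  exact hm this

theorem mk_items_le {μ : Cardinal.{u}} (hinf : ℵ₀ ≤ μ) (hΛ : ∀ α : Λ, #(Set.Iic α) ≤ μ)
    (hN : ∀ γ, #(P.N γ) ≤ μ) (hV : ∀ n, #(P.V n) ≤ μ) (α : Λ) :
    #(P.items (Set.Iic α)) ≤ μ := by
  let Y := Option (((P.N α × Set.Iic α) × (Σ n : ULift.{u} ℕ, P.V n.down)) ⊕
    ((Set.Iic α × ULift.{u} ℕ) × P.N α))
  let f : Y → P.X := fun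
    | none => Item.z
    | some (.inl ((k, ζ), ⟨n, y⟩)) => Item.sym k ζ n.down y
    | some (.inr ((δ, n), e)) => Item.real δ n.down e
  have hsub : P.items (Set.Iic α) ⊆ Set.range f := by
    intro v hv
    match v, hv with
    | .z, _ => exact ⟨none, rfl⟩
    | .sym k ζ n y, hv =>
      exact ⟨some (.inl ((⟨k, P.mono hv.1 hv.2⟩, ⟨ζ, hv.1⟩), ⟨⟨n⟩, y⟩)), rfl⟩
    | .real δ n e, hv =>
      exact ⟨some (.inr ((⟨δ, hv.1⟩, ⟨n⟩), ⟨e, P.mono hv.1 (P.E_sub δ n hv.2.2)⟩)), rfl⟩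
  refine (mk_le_mk_of_subset hsub).trans (mk_range_le.trans ?_)
  have hω : #(ULift.{u} ℕ) ≤ μ := by simpa using hinf
  have hσ : #(Σ n : ULift.{u} ℕ, P.V n.down) ≤ μ := by
    rw [mk_sigma]
    refine (sum_le_mk_mul_iSup _).trans (mul_le_of_le hinf hω ?_)
    exact ciSup_le' fun n => hV _
  rw [mk_option]
  refine add_le_of_le hinf ?_ (one_le_aleph0.trans hinf)
  rw [mk_sum, lift_id, lift_id, mk_prod, mk_prod, mk_prod, mk_prod]
  simp only [lift_id]
  exact add_le_of_le hinf (mul_le_of_le hinf (mul_le_of_le hinf (hN _) (hΛ _)) hσ)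
    (mul_le_of_le hinf (mul_le_of_le hinf (hΛ _) hω) (hN _))

theorem mk_sub_le {μ : Cardinal.{u}} (hinf : ℵ₀ ≤ μ) (hΛ : ∀ α : Λ, #(Set.Iic α) ≤ μ)
    (hN : ∀ γ, #(P.N γ) ≤ μ) (hV : ∀ n, #(P.V n) ≤ μ) (α : Λ) :
    #(P.sub (Set.Iic α)) ≤ μ :=
  (mk_le_of_surjective ((QuotientAddGroup.mk' _).addSubgroupMap_surjective _)).trans
    (mk_suppS_le hinf (P.mk_items_le hinf hΛ hN hV α))

theorem exists_le_sub [Nonempty Λ] {lam : Cardinal.{u}}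
    (hbdd : ∀ (A : Type u) (f : A → Λ), #A < lam → ∃ β, ∀ a, f a ≤ β) (A : AddSubgroup P.Grp)
    (hA : #A < lam) : ∃ β, A ≤ P.sub (Set.Iic β) := by
  classical
  choose b hb using P.exists_bound
  choose r hr using QuotientAddGroup.mk_surjective (s := P.sys.U (P.items Set.univ))
  obtain ⟨β, hβ⟩ := hbdd A (fun q => b (r q)) hA
  refine ⟨β, fun q hq => ?_⟩
  set y := r q with hy
  have hyq : (QuotientAddGroup.mk y : P.Grp) = q := hr q
  refine ⟨y.filter (· ∈ P.items (Set.Iic β)), RelSys.filter_mem_suppS _ _, ?_⟩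
  rw [← hyq, QuotientAddGroup.mk'_apply, QuotientAddGroup.eq]
  refine P.sys.mem_U_of_vanish fun x hx => ?_
  by_cases hxy : y x = 0
  · have : y.filter (· ∈ P.items (Set.Iic β)) x = 0 := by
      rw [Finsupp.filter_apply]; split_ifs <;> simp [hxy]
    simp [this, hxy]
  · have h3 : x ∈ P.items (Set.Iic β) :=
      P.items_mono (Set.Iic_subset_Iic.mpr (hβ ⟨q, hq⟩)) (hb y x hxy hx)
    simp [Finsupp.filter_apply_pos (· ∈ P.items (Set.Iic β)) y h3]

theorem mk_grp_le {lam : Cardinal.{u}} (hinf : ℵ₀ ≤ lam) (hG : #G ≤ lam) (hΛ : #Λ ≤ lam)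
    (hV : ∀ n, #(P.V n) ≤ lam) : #P.Grp ≤ lam := by
  let Y := Option (((G × Λ) × (Σ n : ULift.{u} ℕ, P.V n.down)) ⊕ ((Λ × ULift.{u} ℕ) × G))
  let f : Y → P.X := fun
    | none => Item.z
    | some (.inl ((k, ζ), ⟨n, y⟩)) => Item.sym k ζ n.down y
    | some (.inr ((δ, n), e)) => Item.real δ n.down e
  have hf : Function.Surjective f := by
    intro v
    match v with
    | .z => exact ⟨none, rfl⟩
    | .sym k ζ n y => exact ⟨some (.inl ((k, ζ), ⟨⟨n⟩, y⟩)), rfl⟩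
    | .real δ n e => exact ⟨some (.inr ((δ, ⟨n⟩), e)), rfl⟩
  have hω : #(ULift.{u} ℕ) ≤ lam := by simpa using hinf
  have hσ : #(Σ n : ULift.{u} ℕ, P.V n.down) ≤ lam := by
    rw [mk_sigma]
    refine (sum_le_mk_mul_iSup _).trans (mul_le_of_le hinf hω ?_)
    exact ciSup_le' fun n => hV _
  have hX : #P.X ≤ lam := by
    refine (mk_le_of_surjective hf).trans ?_
    rw [mk_option]
    refine add_le_of_le hinf ?_ (one_le_aleph0.trans hinf)
    rw [mk_sum, lift_id, lift_id, mk_prod, mk_prod, mk_prod, mk_prod]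
    simp only [lift_id]
    exact add_le_of_le hinf (mul_le_of_le hinf (mul_le_of_le hinf hG hΛ) hσ)
      (mul_le_of_le hinf (mul_le_of_le hinf hΛ hω) hG)
  have : Nonempty P.X := ⟨Item.z⟩
  refine (mk_le_of_surjective (QuotientAddGroup.mk'_surjective _)).trans ?_
  rw [mk_finsupp_lift_of_infinite']
  simp only [mk_eq_aleph0, lift_aleph0, lift_uzero]
  exact max_le hX hinf

end Frame

theorem exists_addSubgroup_le {μ : Cardinal.{u}} (hinf : ℵ₀ ≤ μ) {H : Type u} [AddCommGroup H]
    (s : Set H) (hs : #s ≤ μ) : ∃ B : AddSubgroup H, s ⊆ B ∧ #B ≤ μ := by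
  refine ⟨(suppS s).map ev, fun h hh => ⟨_, single_mem_suppS hh 1, by simp [ev_single]⟩, ?_⟩
  exact (mk_le_of_surjective (ev.addSubgroupMap_surjective _)).trans (mk_suppS_le hinf hs)

theorem exists_hom_eq_one {A : Type*} [AddCommGroup A] (f : A →+ ℤ) (hf : f ≠ 0) :
    ∃ (g : A →+ ℤ) (a : A), g a = 1 := by
  obtain ⟨d, hd⟩ := Int.subgroup_cyclic f.range
  have hd' : f.range = AddSubgroup.zmultiples d := by
    rw [hd, AddSubgroup.zmultiples_eq_closure]
  have hdvd : ∀ a, d ∣ f a := by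
    intro a
    have : f a ∈ AddSubgroup.zmultiples d := hd' ▸ ⟨a, rfl⟩
    exact Int.mem_zmultiples_iff.mp this
  have hd0 : d ≠ 0 := by
    rintro rfl
    exact hf (AddMonoidHom.ext fun a => by simpa using hdvd a)
  obtain ⟨a, ha⟩ : d ∈ f.range := by rw [hd']; exact AddSubgroup.mem_zmultiples d
  refine ⟨AddMonoidHom.mk' (fun x => f x / d) ?_, a, ?_⟩
  · intro x y
    rw [map_add, Int.add_ediv_of_dvd_left (hdvd x)]
  · simp only [AddMonoidHom.mk'_apply]
    rw [ha, Int.ediv_self hd0]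

theorem exists_hom_ne_zero {A : Type*} [AddCommGroup A] (hA : Module.Free ℤ A) [Nontrivial A] :
    ∃ f : A →+ ℤ, f ≠ 0 := by
  by_contra hcon
  push Not at hcon
  obtain ⟨a, ha⟩ := exists_ne (0 : A)
  let b := Module.Free.chooseBasis ℤ A
  refine ha (b.repr.map_eq_zero_iff.mp (Finsupp.ext fun i => ?_))
  exact DFunLike.congr_fun (hcon (b.coord i).toAddMonoidHom) a

namespace Telescope

variable {I H : Type u} [AddCommGroup H]

/-- Elements with support in a set and coordinates in a subgroup. -/
def box (J : Set I) (B : AddSubgroup H) : AddSubgroup (I →₀ H) where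
  carrier := {y | (∀ j, y j ∈ B) ∧ ∀ j ∉ J, y j = 0}
  add_mem' := fun {a b} ha hb => ⟨fun j => add_mem (ha.1 j) (hb.1 j), fun j hj => by
    rw [Finsupp.add_apply, ha.2 j hj, hb.2 j hj, add_zero]⟩
  zero_mem' := ⟨fun _ => zero_mem _, fun _ _ => rfl⟩
  neg_mem' := fun {a} ha => ⟨fun j => neg_mem (ha.1 j), fun j hj => by
    rw [Finsupp.neg_apply, ha.2 j hj, neg_zero]⟩

theorem single_mem_box {J : Set I} {B : AddSubgroup H} {i : I} {h : H} (hi : i ∈ J) (hh : h ∈ B) :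
    Finsupp.single i h ∈ box J B := by
  classical
  refine ⟨fun j => ?_, fun j hj => ?_⟩
  · rw [Finsupp.single_apply]; split_ifs
    · exact hh
    · exact zero_mem _
  · rw [Finsupp.single_apply, if_neg]
    rintro rfl
    exact hj hi

theorem mk_box_le {μ : Cardinal.{u}} (hinf : ℵ₀ ≤ μ) {J : Set I} {B : AddSubgroup H}
    (hJ : #J ≤ μ) (hB : #B ≤ μ) : #(box J B) ≤ μ := by
  obtain ⟨C, hsC, hC⟩ := exists_addSubgroup_le hinf
    (Set.range fun p : J × B => Finsupp.single (p.1 : I) (p.2 : H)) (by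
      refine mk_range_le.trans ?_
      rw [mk_prod, lift_id, lift_id]
      exact mul_le_of_le hinf hJ hB)
  refine le_trans (mk_le_mk_of_subset ?_) hC
  intro y hy
  have : y = ∑ j ∈ y.support, Finsupp.single j (y j) := (Finsupp.sum_single y).symm
  rw [this]
  refine sum_mem fun j hj => ?_
  have hjJ : j ∈ J := by
    by_contra h
    exact Finsupp.mem_support_iff.mp hj (hy.2 j h)
  exact hsC ⟨(⟨j, hjJ⟩, ⟨y j, hy.1 j⟩), rfl⟩

variable (z : H) (w : I → (I →₀ H))

/-- The relations `single i z = w i`. -/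
noncomputable def rel : (I →₀ ℤ) →+ (I →₀ H) :=
  (Finsupp.linearCombination ℤ fun i => Finsupp.single i z - w i).toAddMonoidHom

theorem rel_single (i : I) (m : ℤ) : rel z w (Finsupp.single i m) =
    m • (Finsupp.single i z - w i) := by simp [rel]

theorem rel_apply_of_top [LinearOrder I] (hw : ∀ i j, w i j ≠ 0 → j < i) (c : I →₀ ℤ) (j : I)
    (hc : ∀ i, j < i → c i = 0) : rel z w c j = c j • z := by
  classical
  have h1 : rel z w c j = ∑ i ∈ c.support, c i • ((Finsupp.single i z - w i) j) := by
    simp [rel, Finsupp.linearCombination_apply, Finsupp.sum, Finsupp.finsetSum_apply]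
  have hjj : w j j = 0 := by
    by_contra h
    exact lt_irrefl _ (hw j j h)
  rw [h1, Finset.sum_eq_single j]
  · rw [Finsupp.sub_apply, hjj, Finsupp.single_eq_same, sub_zero]
  · intro i hi hij
    have hwij : w i j = 0 := by
      by_contra h
      exact Finsupp.mem_support_iff.mp hi (hc i (hw i j h))
    rw [Finsupp.sub_apply, hwij, Finsupp.single_eq_of_ne' hij, sub_zero, smul_zero]
  · intro h
    rw [Finsupp.notMem_support_iff.mp h, zero_smul]

/-- Impose the relations outside `J` and kill a subgroup on the coordinates in `J`. -/
noncomputable def U (J : Set I) (K : AddSubgroup H) : AddSubgroup (I →₀ H) :=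
  (suppS Jᶜ).map (rel z w) ⊔ box J K

variable {z w}

theorem coeff_of_mem_U [LinearOrder I] (hz : ∀ m : ℤ, m ≠ 0 → m • z ≠ 0)
    (hw : ∀ i j, w i j ≠ 0 → j < i) {J : Set I} {K : AddSubgroup H} {y : I →₀ H}
    (hy : y ∈ U z w J K) {i : I} (hi : ∀ j, i < j → y j = 0) :
    (i ∈ J → y i ∈ K) ∧ (i ∉ J → y i ∈ AddSubgroup.zmultiples z) := by
  classical
  obtain ⟨_, ⟨c, hc, rfl⟩, k, hk, rfl⟩ := AddSubgroup.mem_sup.mp hy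
  have htop : ∀ j, i < j → c j = 0 := by
    by_contra hcon
    push Not at hcon
    obtain ⟨j0, hj0, hcj0⟩ := hcon
    let T := c.support.filter (i < ·)
    have hT : T.Nonempty := ⟨j0, Finset.mem_filter.mpr ⟨Finsupp.mem_support_iff.mpr hcj0, hj0⟩⟩
    obtain ⟨hj1, hj2⟩ := Finset.mem_filter.mp (T.max'_mem hT)
    set j := T.max' hT
    have h1 := rel_apply_of_top z w hw c j fun l hl => by
      by_contra hne
      exact (T.le_max' l (Finset.mem_filter.mpr
        ⟨Finsupp.mem_support_iff.mpr hne, hj2.trans hl⟩)).not_gt hl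
    have h2 := hi j hj2
    have hjJ : j ∉ J := fun h => Finsupp.mem_support_iff.mp hj1 (hc j (fun h' => h' h))
    rw [Finsupp.add_apply, h1, hk.2 j hjJ, add_zero] at h2
    exact hz _ (Finsupp.mem_support_iff.mp hj1) h2
  have h1 := rel_apply_of_top z w hw c i htop
  rw [Finsupp.add_apply, h1]
  constructor
  · intro h
    rw [hc i (fun h' => h' h), zero_smul, zero_add]
    exact hk.1 i
  · intro h
    rw [hk.2 i h, add_zero]
    exact AddSubgroup.zsmul_mem_zmultiples z _

theorem exists_closed_set {μ : Cardinal.{u}} (hinf : ℵ₀ ≤ μ) (w : I → (I →₀ H)) (J₀ : Set I)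
    (hJ₀ : #J₀ ≤ μ) : ∃ J : Set I, J₀ ⊆ J ∧ #J ≤ μ ∧ ∀ i ∈ J, ∀ j, w i j ≠ 0 → j ∈ J := by
  choose cl h1 h2 h3 using exists_countable_closed (fun i : I => ((w i).support : Set I))
    (fun i => (w i).support.finite_toSet)
  refine ⟨⋃ i : J₀, cl i, fun i hi => Set.mem_iUnion.mpr ⟨⟨i, hi⟩, h1 i⟩, ?_, ?_⟩
  · refine (mk_iUnion_le_sum_mk).trans ((sum_le_mk_mul_iSup _).trans (mul_le_of_le hinf hJ₀ ?_))
    exact ciSup_le' fun i => (le_aleph0_iff_set_countable.mpr (h2 i)).trans hinf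
  · intro i hi j hij
    obtain ⟨i', hi'⟩ := Set.mem_iUnion.mp hi
    exact Set.mem_iUnion.mpr ⟨i', h3 i' i hi' (Finsupp.mem_support_iff.mpr hij)⟩

theorem exists_closed_box {μ : Cardinal.{u}} (hinf : ℵ₀ ≤ μ) (z : H) (w : I → (I →₀ H))
    {Y : Type u} (hY : #Y ≤ μ) (r : Y → (I →₀ H)) :
    ∃ (J : Set I) (B : AddSubgroup H), #J ≤ μ ∧ #B ≤ μ ∧ z ∈ B ∧ (∀ q, r q ∈ box J B) ∧
      ∀ i ∈ J, w i ∈ box J B := by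
  obtain ⟨J, hJ0, hJ, hJcl⟩ := exists_closed_set hinf w (⋃ q, ((r q).support : Set I)) (by
    refine (mk_iUnion_le_sum_mk).trans ((sum_le_mk_mul_iSup _).trans (mul_le_of_le hinf hY ?_))
    exact ciSup_le' fun q => (lt_aleph0_of_finite _).le.trans hinf)
  have hJ' : #(Set.range fun p : J × J => w p.1 p.2) ≤ μ := by
    refine mk_range_le.trans ?_
    rw [mk_prod, lift_id]
    exact mul_le_of_le hinf hJ hJ
  have hY' : #(Set.range fun p : Y × J => r p.1 p.2) ≤ μ := by
    refine mk_range_le.trans ?_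
    rw [mk_prod, lift_id, lift_id]
    exact mul_le_of_le hinf hY hJ
  obtain ⟨B, hsB, hB⟩ := exists_addSubgroup_le hinf
    (({z} ∪ Set.range fun p : J × J => w p.1 p.2) ∪ Set.range fun p : Y × J => r p.1 p.2)
    ((mk_union_le _ _).trans (add_le_of_le hinf ((mk_union_le _ _).trans
      (add_le_of_le hinf (by rw [mk_singleton]; exact one_le_aleph0.trans hinf) hJ')) hY'))
  refine ⟨J, B, hJ, hB, hsB (Or.inl (Or.inl rfl)), fun q => ?_, fun i hi => ?_⟩
  · have h0 : ∀ j ∉ J, r q j = 0 := by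
      intro j hj
      by_contra h
      exact hj (hJ0 (Set.mem_iUnion.mpr ⟨q, Finsupp.mem_support_iff.mpr h⟩))
    refine ⟨fun j => ?_, h0⟩
    by_cases hj : j ∈ J
    · exact hsB (Or.inr ⟨(q, ⟨j, hj⟩), rfl⟩)
    · rw [h0 j hj]; exact zero_mem _
  · have h0 : ∀ j ∉ J, w i j = 0 := by
      intro j hj
      by_contra h
      exact hj (hJcl i hi j h)
    refine ⟨fun j => ?_, h0⟩
    by_cases hj : j ∈ J
    · exact hsB (Or.inl (Or.inr ⟨(⟨i, hi⟩, ⟨j, hj⟩), rfl⟩))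
    · rw [h0 j hj]; exact zero_mem _

theorem box_mono {J J' : Set I} {B B' : AddSubgroup H} (hJ : J ⊆ J') (hB : B ≤ B') :
    box J B ≤ box J' B' :=
  fun _ hy => ⟨fun j => hB (hy.1 j), fun j hj => hy.2 j fun h => hj (hJ h)⟩

theorem U_mono {J : Set I} {K : AddSubgroup H} (hzK : z ∈ K) (hwK : ∀ i ∈ J, w i ∈ box J K) :
    U z w ∅ ⊥ ≤ U z w J K := by
  refine sup_le ?_ ?_
  · rintro _ ⟨c, hc, rfl⟩
    refine suppS_induction (p := fun c => rel z w c ∈ U z w J K) (by simp) ?_ ?_ hc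
    · intro a b ha hb; rw [map_add]; exact add_mem ha hb
    · intro i _ m
      by_cases hi : i ∈ J
      · rw [rel_single]
        refine (le_sup_right : box J K ≤ _) ((box J K).zsmul_mem (sub_mem ?_ (hwK i hi)) m)
        exact single_mem_box hi hzK
      · exact (le_sup_left : (suppS Jᶜ).map (rel z w) ≤ _) ⟨_, single_mem_suppS hi m, rfl⟩
  · refine le_trans (fun y hy => ?_) le_sup_right
    exact ⟨fun j => by rw [hy.2 j (fun h => h)]; exact zero_mem _, fun j _ => hy.2 j (fun h => h)⟩

theorem isKappaFree_quotient [LinearOrder I] [WellFoundedLT I] [Nonempty I]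
    {μ lam : Cardinal.{u}} (hinf : ℵ₀ ≤ μ) (hlam : lam = Order.succ μ)
    (hz : ∀ m : ℤ, m ≠ 0 → m • z ≠ 0) (hw : ∀ i j, w i j ≠ 0 → j < i)
    (hb : IsKappaFree lam (H ⧸ AddSubgroup.zmultiples z)) {J : Set I} {K : AddSubgroup H}
    (hzK : z ∈ K) (hwK : ∀ i ∈ J, w i ∈ box J K) (hK : IsKappaFree lam (H ⧸ K)) :
    IsKappaFree lam ((I →₀ H) ⧸ U z w J K) := by
  classical
  intro A hA
  have hA' : #A ≤ μ := by rwa [hlam, Order.lt_succ_iff] at hA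
  choose r hr using QuotientAddGroup.mk_surjective (s := U z w J K)
  obtain ⟨D, B, hD, hB, hzB, hrB, hwB⟩ := exists_closed_box hinf z w hA' (fun q : A => r q)
  have hBlt : #B < lam := by rw [hlam, Order.lt_succ_iff]; exact hB
  let F := box D B
  have hfree : Module.Free ℤ (F ⧸ (U z w J K).addSubgroupOf F) := by
    let p : ∀ i, (I →₀ H) →+ H ⧸ (if i ∈ J then K else AddSubgroup.zmultiples z) := fun i =>
      (QuotientAddGroup.mk' _).comp (Finsupp.applyAddHom i)
    have hp : ∀ i y, p i y = 0 ↔ (i ∈ J → y i ∈ K) ∧ (i ∉ J → y i ∈ AddSubgroup.zmultiples z) := by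
      intro i y
      change (QuotientAddGroup.mk (y i) : H ⧸ (if i ∈ J then K else AddSubgroup.zmultiples z)) = 0
        ↔ _
      rw [QuotientAddGroup.eq_zero_iff]
      by_cases hi : i ∈ J <;> simp [hi]
    have hzz : ∀ m : ℤ, m • z ∈ B := fun m => B.zsmul_mem hzB m
    refine free_of_filtration ((U z w J K).addSubgroupOf F)
      (fun i => (box (Set.Iic i) ⊤).addSubgroupOf F) ?_ (fun i => (p i).comp F.subtype) ?_ ?_ ?_
    · intro i j hij y hy
      exact box_mono (Set.Iic_subset_Iic.mpr hij) le_rfl hy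
    · intro i
      have h1 : Module.Free ℤ
          (B.map (QuotientAddGroup.mk' (if i ∈ J then K else AddSubgroup.zmultiples z))) := by
        have hL : ∀ L : AddSubgroup H, L = K ∨ L = AddSubgroup.zmultiples z →
            IsKappaFree lam (H ⧸ L) := by
          rintro L (rfl | rfl)
          · exact hK
          · exact hb
        exact hL _ (by split_ifs <;> simp) _ (lt_of_le_of_lt (mk_le_of_surjective (AddMonoidHom.addSubgroupMap_surjective _ _))
          hBlt)
      refine free_subgroup_mono ?_ h1
      rintro _ ⟨y, -, rfl⟩
      exact ⟨(y : I →₀ H) i, y.2.1 i, rfl⟩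
    · intro i y hy
      change p i y = 0 ↔ _
      rw [hp]
      have hprev : ∀ y' : F, (∀ j, i ≤ j → (y' : I →₀ H) j = 0) →
          y' = 0 ∨ ∃ j < i, y' ∈ (box (Set.Iic j) (⊤ : AddSubgroup H)).addSubgroupOf F := by
        intro y' h
        by_cases h0 : (y' : I →₀ H) = 0
        · exact Or.inl (Subtype.ext h0)
        · right
          have hne := Finsupp.support_nonempty_iff.mpr h0
          refine ⟨(y' : I →₀ H).support.max' hne, ?_, fun _ => trivial, fun j hj => ?_⟩
          · by_contra hcon
            exact Finsupp.mem_support_iff.mp ((y' : I →₀ H).support.max'_mem hne)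
              (h _ (not_lt.mp hcon))
          · by_contra hne'
            exact hj ((y' : I →₀ H).support.le_max' j (Finsupp.mem_support_iff.mpr hne'))
      constructor
      · rintro ⟨h1, h2⟩
        have : ∃ y' : F, (∀ j, i ≤ j → (y' : I →₀ H) j = 0) ∧
            y - y' ∈ (U z w J K).addSubgroupOf F := by
          have hyi : ∀ j, i < j → (y : I →₀ H) j = 0 := fun j hj => hy.2 j (not_le.mpr hj)
          by_cases hiD : i ∈ D
          · by_cases hi : i ∈ J
            · refine ⟨y - ⟨Finsupp.single i ((y : I →₀ H) i), single_mem_box hiD (y.2.1 i)⟩,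
                fun j hj => ?_, ?_⟩
              · rcases hj.eq_or_lt with rfl | hj
                · simp
                · simp [hyi j hj, Finsupp.single_eq_of_ne' hj.ne]
              · rw [sub_sub_cancel]
                exact (le_sup_right : box J K ≤ _) (single_mem_box hi (h1 hi))
            · obtain ⟨m, hm⟩ := AddSubgroup.mem_zmultiples_iff.mp (h2 hi)
              have hmem : m • (Finsupp.single i z - w i) ∈ F :=
                F.zsmul_mem (sub_mem (single_mem_box hiD hzB) (hwB i hiD)) m
              refine ⟨y - ⟨_, hmem⟩, fun j hj => ?_, ?_⟩
              · have hwj : w i j = 0 := by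
                  by_contra h
                  exact (hw i j h).not_ge hj
                rcases hj.eq_or_lt with rfl | hj
                · simp [hwj, hm]
                · simp [hyi j hj, Finsupp.single_eq_of_ne' hj.ne, hwj]
              · rw [sub_sub_cancel]
                exact (le_sup_left : (suppS Jᶜ).map (rel z w) ≤ _)
                  ⟨_, single_mem_suppS hi m, rel_single z w i m⟩
          · refine ⟨y, fun j hj => ?_, by rw [sub_self]; exact zero_mem _⟩
            rcases hj.eq_or_lt with rfl | hj
            · exact y.2.2 _ hiD
            · exact hyi j hj
        obtain ⟨y', h3, h4⟩ := this
        rcases hprev y' h3 with rfl | ⟨j, hj, hyj⟩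
        · left; simpa using h4
        · exact Or.inr ⟨j, hj, y', hyj, h4⟩
      · rintro (h | ⟨j, hj, y', hy', h⟩)
        · exact coeff_of_mem_U hz hw h fun j hj => hy.2 j (not_le.mpr hj)
        · have h0 : ∀ l, i ≤ l → (y' : I →₀ H) l = 0 :=
            fun l hl => hy'.2 l (not_le.mpr (hj.trans_le hl))
          have := coeff_of_mem_U hz hw (i := i) h fun l hl => by
            have h3 : (y : I →₀ H) l = 0 := hy.2 l (not_le.mpr hl)
            simp [h3, h0 l hl.le]
          simpa [h0 i le_rfl] using this
    · intro y
      by_cases h0 : (y : I →₀ H) = 0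
      · exact ⟨Classical.arbitrary I, 0, zero_mem _, by
          have : y = 0 := Subtype.ext h0
          simp [this, zero_mem]⟩
      · refine ⟨(y : I →₀ H).support.max' (Finsupp.support_nonempty_iff.mpr h0), y,
          ⟨fun _ => trivial, fun j hj => ?_⟩, by simp [zero_mem]⟩
        by_contra hne'
        exact hj ((y : I →₀ H).support.le_max' j (Finsupp.mem_support_iff.mpr hne'))
  have h1 := free_range_of_ker ((QuotientAddGroup.mk' (U z w J K)).comp F.subtype)
    (QuotientAddGroup.mk' ((U z w J K).addSubgroupOf F)) (fun x => by
      change (QuotientAddGroup.mk (x : I →₀ H) : (I →₀ H) ⧸ U z w J K) = 0 ↔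
        (QuotientAddGroup.mk x : F ⧸ (U z w J K).addSubgroupOf F) = 0
      rw [QuotientAddGroup.eq_zero_iff, QuotientAddGroup.eq_zero_iff]
      rfl) hfree
  refine free_subgroup_mono ?_ h1
  intro q hq
  exact ⟨⟨r q, hrB ⟨q, hq⟩⟩, hr q⟩

end Telescope

namespace Telescope

/-- A telescope over a group in which a distinguished element is not mapped to one has no
nonzero homomorphism to the integers. -/
theorem exists_strongly_free {μ lam : Cardinal.{u}} (hinf : ℵ₀ ≤ μ) (hlam : lam = Order.succ μ)
    {H : Type u} [AddCommGroup H] (z : H) (hz : ∀ m : ℤ, m ≠ 0 → m • z ≠ 0)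
    (hb : IsKappaFree lam (H ⧸ AddSubgroup.zmultiples z))
    (hc : ∀ A : AddSubgroup H, #A < lam →
      ∃ K : AddSubgroup H, A ≤ K ∧ z ∈ K ∧ #K < lam ∧ IsKappaFree lam (H ⧸ K))
    (hd : ∀ f : H →+ ℤ, f z ≠ 1) (he : #H ≤ lam) :
    ∃ (G : Type u) (inst : AddCommGroup G),
      #G = lam ∧ @IsStronglyKappaFree lam G inst ∧ ∀ f : G →+ ℤ, f = 0 := by
  classical
  have hμ : μ < lam := hlam ▸ Order.lt_succ μ
  have hinf' : ℵ₀ ≤ lam := hinf.trans hμ.le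
  let L := lam.out
  have hL : #L = lam := mk_out lam
  obtain ⟨_, _⟩ := exists_wellFoundedLT L
  have : Nonempty L := by
    rw [← mk_ne_zero_iff, hL]
    exact (aleph0_pos.trans_le hinf').ne'
  let I := ℕ ×ₗ L
  have hI : #I ≤ lam := by
    have : #I = #(ℕ × L) := rfl
    rw [this, mk_prod, hL]
    simp only [mk_eq_aleph0, lift_aleph0, lift_uzero]
    exact mul_le_of_le hinf' hinf' le_rfl
  have : Nonempty I := ⟨toLex (0, Classical.arbitrary L)⟩
  have hzne : z ≠ 0 := by simpa using hz 1 one_ne_zero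
  have : Nontrivial H := ⟨z, 0, hzne⟩
  have hF : #(I →₀ H) ≤ lam := by
    have : Infinite I := Infinite.of_injective (fun n : ℕ => (toLex (n, Classical.arbitrary L) : I))
      (fun a b h => (Prod.ext_iff.mp (toLex.injective h)).1)
    rw [mk_finsupp_of_infinite]
    exact max_le hI he
  obtain ⟨e, hesurj⟩ : ∃ e : L → (I →₀ H), Function.Surjective e := by
    have : #(I →₀ H) ≤ #L := hL.symm ▸ hF
    obtain ⟨g⟩ := this
    exact ⟨Function.invFun g, Function.invFun_surjective g.injective⟩
  let w : I → (I →₀ H) := fun i =>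
    if ∀ j, e (ofLex i).2 j ≠ 0 → (ofLex j).1 < (ofLex i).1 then e (ofLex i).2 else 0
  have hw : ∀ i j, w i j ≠ 0 → j < i := by
    intro i j h
    simp only [w] at h
    split_ifs at h with h'
    · rw [Prod.Lex.lt_iff]
      exact Or.inl (h' j h)
    · exact absurd rfl h
  let Q := (I →₀ H) ⧸ U z w ∅ ⊥
  have hsurj : ∀ q : Q, ∃ i, q = QuotientAddGroup.mk (Finsupp.single i z) := by
    intro q
    obtain ⟨y, rfl⟩ := QuotientAddGroup.mk_surjective q
    obtain ⟨ξ, hξ⟩ := hesurj y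
    let n := y.support.sup (fun j => (ofLex j).1) + 1
    refine ⟨toLex (n, ξ), ?_⟩
    have hwi : w (toLex (n, ξ)) = y := by
      simp only [w, ofLex_toLex, hξ]
      rw [if_pos]
      intro j hj
      exact Nat.lt_succ_of_le
        (Finset.le_sup (f := fun j => (ofLex j).1) (Finsupp.mem_support_iff.mpr hj))
    rw [QuotientAddGroup.eq]
    refine (le_sup_left : (suppS ∅ᶜ).map (rel z w) ≤ _)
      ⟨_, single_mem_suppS (Set.mem_compl (Set.notMem_empty (toLex (n, ξ)))) 1, ?_⟩
    rw [rel_single, hwi, one_smul]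
    abel
  have hone : ∀ (f : Q →+ ℤ) (q : Q), f q ≠ 1 := by
    intro f q h
    obtain ⟨i, rfl⟩ := hsurj q
    exact hd ((f.comp (QuotientAddGroup.mk' _)).comp (Finsupp.singleAddHom i)) h
  have hzero : ∀ f : Q →+ ℤ, f = 0 := by
    intro f
    by_contra hne
    obtain ⟨g, a, hga⟩ := exists_hom_eq_one f hne
    exact hone g a hga
  have hfree : IsKappaFree lam Q := by
    have h1 : IsKappaFree lam ((I →₀ H) ⧸ U z w ∅ (⊤ : AddSubgroup H)) := by
      refine isKappaFree_quotient hinf hlam hz hw hb trivial (fun i hi => absurd hi id) ?_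
      intro A _
      have : Subsingleton (H ⧸ (⊤ : AddSubgroup H)) := QuotientAddGroup.subsingleton_quotient_top
      change Module.Free ℤ A
      infer_instance
    have h2 : U z w ∅ (⊤ : AddSubgroup H) = U z w ∅ ⊥ := by
      have : box ∅ (⊤ : AddSubgroup H) = box (∅ : Set I) ⊥ := by
        ext y
        constructor
        · intro h
          exact ⟨fun j => h.2 j (fun h => h), h.2⟩
        · intro h
          exact ⟨fun j => trivial, h.2⟩
      rw [U, U, this]
    rw [h2] at h1
    exact h1
  have hnontriv : Nontrivial Q := by
    by_contra hcon
    rw [not_nontrivial_iff_subsingleton] at hcon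
    have hall : ∀ h : H, h ∈ AddSubgroup.zmultiples z := by
      intro h
      let i := Classical.arbitrary I
      have h1 : Finsupp.single i h ∈ U z w ∅ ⊥ := by
        rw [← QuotientAddGroup.eq_zero_iff]
        exact Subsingleton.elim _ _
      have := (coeff_of_mem_U hz hw h1 (i := i)
        fun j hj => Finsupp.single_eq_of_ne' hj.ne).2 (fun h => h)
      simpa using this
    have hbij : Function.Bijective (zmultiplesHom H z) := by
      constructor
      · rw [injective_iff_map_eq_zero]
        intro m hm
        by_contra h
        exact hz m h (by simpa using hm)
      · intro h
        obtain ⟨m, hm⟩ := AddSubgroup.mem_zmultiples_iff.mp (hall h)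
        exact ⟨m, by simpa using hm⟩
    refine hd (AddEquiv.ofBijective _ hbij).symm.toAddMonoidHom ?_
    change (AddEquiv.ofBijective _ hbij).symm z = 1
    rw [AddEquiv.symm_apply_eq]
    simp
  have hcard : #Q = lam := by
    refine le_antisymm ((mk_le_of_surjective (QuotientAddGroup.mk'_surjective _)).trans hF) ?_
    by_contra hcon
    have h1 : Module.Free ℤ (⊤ : AddSubgroup Q) := by
      refine hfree ⊤ (lt_of_le_of_lt ?_ (not_le.mp hcon))
      exact mk_subtype_le _
    have h2 : Module.Free ℤ Q := free_of_addEquiv AddSubgroup.topEquiv h1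
    obtain ⟨f, hf⟩ := exists_hom_ne_zero h2
    exact hf (hzero f)
  refine ⟨Q, inferInstance, hcard, ⟨hfree, ?_⟩, hzero⟩
  intro A hA
  have hA' : #A ≤ μ := by rwa [hlam, Order.lt_succ_iff] at hA
  choose r hr using QuotientAddGroup.mk_surjective (s := U z w ∅ (⊥ : AddSubgroup H))
  obtain ⟨J, B, hJ, hB, hzB, hrB, hwB⟩ := exists_closed_box hinf z w hA' (fun q : A => r q)
  obtain ⟨K, hBK, hzK, hK, hKfree⟩ := hc B (by rw [hlam, Order.lt_succ_iff]; exact hB)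
  have hK' : #K ≤ μ := by rwa [hlam, Order.lt_succ_iff] at hK
  have hwK : ∀ i ∈ J, w i ∈ box J K := fun i hi => box_mono le_rfl hBK (hwB i hi)
  refine ⟨(box J K).map (QuotientAddGroup.mk' _), ?_, ?_, ?_⟩
  · intro q hq
    exact ⟨r q, box_mono le_rfl hBK (hrB ⟨q, hq⟩), hr q⟩
  · rw [hlam, Order.lt_succ_iff]
    exact (mk_le_of_surjective (AddMonoidHom.addSubgroupMap_surjective _ _)).trans
      (mk_box_le hinf hJ hK')
  · have h1 := isKappaFree_quotient hinf hlam hz hw hb hzK hwK hKfree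
    have hU := U_mono hzK hwK
    refine h1.quotient_of_ker (QuotientAddGroup.map _ _ (AddMonoidHom.id _) hU) _ fun q => ?_
    obtain ⟨y, rfl⟩ := QuotientAddGroup.mk_surjective q
    change (QuotientAddGroup.mk y : (I →₀ H) ⧸ U z w J K) = 0 ↔ _
    rw [QuotientAddGroup.eq_zero_iff]
    constructor
    · intro hy
      obtain ⟨_, ⟨c, hc, rfl⟩, k, hk, rfl⟩ := AddSubgroup.mem_sup.mp hy
      refine ⟨k, hk, ?_⟩
      rw [QuotientAddGroup.mk'_apply, QuotientAddGroup.eq]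
      refine (le_sup_left : (suppS ∅ᶜ).map (rel z w) ≤ _) ⟨c, fun x hx => ?_, by abel⟩
      exact absurd (Set.mem_compl (Set.notMem_empty x)) hx
    · rintro ⟨k, hk, hky⟩
      rw [QuotientAddGroup.mk'_apply, QuotientAddGroup.eq] at hky
      have := add_mem ((le_sup_right : box J K ≤ U z w J K) hk) (hU hky)
      rwa [add_neg_cancel_left] at this

end Telescope

namespace Frame

variable {G Λ : Type u} [AddCommGroup G] [LinearOrder Λ] (P : Frame G Λ)

theorem exists_strongly_free [WellFoundedLT Λ] [Nonempty Λ] {μ lam : Cardinal.{u}} (hinf : ℵ₀ ≤ μ)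
    (hlam : lam = Order.succ μ)
    (hbdd : ∀ (A : Type u) (f : A → Λ), #A < lam → ∃ β, ∀ a, f a ≤ β)
    (hΛ : ∀ α : Λ, #(Set.Iic α) ≤ μ) (hN : ∀ γ, #(P.N γ) ≤ μ) (hV : ∀ n, #(P.V n) ≤ μ)
    (hG : #G ≤ lam) (hΛ' : #Λ ≤ lam) (hempty : ∃ R β0, ∀ β ≥ β0, P.Good ∅ R β)
    (hgood : ∀ α, ∃ R β0, ∀ β ≥ β0, P.Good (Set.Iic α) R β) (hd : ∀ f : P.Grp →+ ℤ, f P.zG ≠ 1) :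
    ∃ (G : Type u) (inst : AddCommGroup G),
      #G = lam ∧ @IsStronglyKappaFree lam G inst ∧ ∀ f : G →+ ℤ, f = 0 := by
  have hμ : μ ≤ lam := hlam ▸ (Order.lt_succ μ).le
  refine Telescope.exists_strongly_free hinf hlam P.zG (fun m => P.zsmul_zG_ne) ?_ ?_ hd
    (P.mk_grp_le (hinf.trans hμ) hG hΛ' fun n => (hV n).trans hμ)
  · obtain ⟨R, β0, h⟩ := hempty
    rw [← P.sub_empty]
    exact P.isKappaFree_quotient_sub hbdd h
  · intro A hA
    obtain ⟨α, hα⟩ := P.exists_le_sub hbdd A hA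
    obtain ⟨R, β0, h⟩ := hgood α
    refine ⟨_, hα, P.zG_mem_sub _, ?_, P.isKappaFree_quotient_sub hbdd h⟩
    rw [hlam, Order.lt_succ_iff]
    exact P.mk_sub_le hinf hΛ hN hV α

end Frame

theorem aleph0_lt_of_singular (μ : Cardinal.{u}) (hsing : μ.ord.cof < μ)
    (hstrong : ∀ θ < μ, (2 : Cardinal.{u}) ^ θ < μ) : ℵ₀ < μ := by
  refine (aleph0_le_of_singular μ hsing hstrong).lt_of_ne ?_
  rintro rfl
  rw [isRegular_aleph0.cof_ord] at hsing
  exact lt_irrefl _ hsing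

theorem mk_Iic_toType_ord_lt {μ : Cardinal.{u}} (hinf : ℵ₀ ≤ μ) (k : μ.ord.ToType) :
    #(Set.Iic k) < μ := by
  rw [← Set.Iio_insert]
  refine (mk_insert_le).trans_lt (add_lt_of_lt hinf ?_ (one_lt_aleph0.trans_le hinf))
  have := mk_Iio_lt k (by simp)
  rwa [mk_ord_toType] at this

theorem exists_coloring {μ : Cardinal.{u}} (hinf : ℵ₀ ≤ μ) (hsing : μ.ord.cof < μ) :
    ∃ K : Type u, #K < μ ∧ Nonempty K ∧
      ∀ X : Type u, #X ≤ μ → ∃ a : X → K, ∀ k, #{x // a x = k} < μ := by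
  obtain ⟨s, hs, hcard⟩ := Order.exists_cof_eq μ.ord.ToType
  rw [Ordinal.cof_toType] at hcard
  have hpos : 0 < μ := aleph0_pos.trans_le hinf
  refine ⟨s, by rwa [hcard], ?_, fun X hX => ?_⟩
  · have : Nonempty μ.ord.ToType := by
      rw [← mk_ne_zero_iff, mk_ord_toType]; exact hpos.ne'
    obtain ⟨x⟩ := this
    obtain ⟨y, hy, -⟩ := hs x
    exact ⟨⟨y, hy⟩⟩
  · rw [← mk_ord_toType μ] at hX
    obtain ⟨f⟩ := hX
    choose c hc hle using hs
    refine ⟨fun x => ⟨c (f x), hc _⟩, fun k => ?_⟩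
    have h2 : ∀ x : {x // (⟨c (f x), hc _⟩ : s) = k}, f x.1 ≤ k.1 := fun x =>
      (hle (f x.1)).trans (congrArg Subtype.val x.2).le
    refine lt_of_le_of_lt (mk_le_of_injective (f := fun x => (⟨f x.1, h2 x⟩ : Set.Iic k.1)) ?_)
      (mk_Iic_toType_ord_lt hinf k.1)
    intro x y h
    exact Subtype.ext (f.injective (congrArg Subtype.val h))

theorem exists_gad_eq_zero {μ : Cardinal.{u}} (hinf : ℵ₀ < μ)
    (hstrong : ∀ θ < μ, (2 : Cardinal.{u}) ^ θ < μ) {C : Type u} (hC : μ ≤ #C) (n : ℕ)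
    {P : Type u} (hP : #P < μ) {J : Type u} (hJ : #J < μ) (φ : P → J → GadV C n → ℤ) :
    ∃ w : GadW C n, ∀ p j, Finsupp.linearCombination ℤ (φ p j) (gadBd C n w) = 0 := by
  have hΘ : #(P → J → ULift.{u} ℤ) < μ := by
    rw [← power_def, ← power_def]
    exact power_lt_of_strongLimit hinf.le hstrong
      (power_lt_of_strongLimit hinf.le hstrong (by simpa using hinf) hJ) hP
  obtain ⟨S, -, hS⟩ := exists_monochromatic hinf.le hstrong C hC n _ hΘ
  obtain ⟨w, -, hw⟩ := hS fun y p j => ⟨φ p j y⟩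
  refine ⟨w, fun p j => ?_⟩
  have h := Finsupp.linearCombination_mapDomain ℤ (v' := fun θ : P → J → ULift.{u} ℤ => (θ p j).down)
    (fun y p j => (⟨φ p j y⟩ : ULift.{u} ℤ)) (l := gadBd C n w)
  rw [hw, map_zero] at h
  exact h.symm

theorem exists_guess {μ : Cardinal.{u}} (hinf : ℵ₀ < μ) (hsing : μ.ord.cof < μ)
    (hstrong : ∀ θ < μ, (2 : Cardinal.{u}) ^ θ < μ) {G Λ : Type u} [LinearOrder Λ]
    (N : Λ → Set G) (hN : ∀ ζ, #(N ζ) ≤ μ) (hΛ : (2 : Cardinal.{u}) ^ μ ≤ #Λ)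
    (hIio : ∀ δ : Λ, #(Set.Iio δ) ≤ μ) (S : Set Λ) (D : Λ → Set Λ)
    (σ : Cardinal.{u}) (hσ : σ < μ)
    (hguess : ∀ e : Λ → Λ, ∃ δ ∈ S, (∀ γ < δ, e γ < δ) ∧ #(D δ) ≤ σ)
    (hD : ∀ δ, ∀ ζ ∈ D δ, ζ < δ) {C : Type u} (hC : #C = μ) :
    ∃ (J : Type u) (w : J → Λ → Λ → (n : ℕ) → G → GadW C n),
      ∀ F : J → G → Λ → (n : ℕ) → GadV C n → ℤ, ∃ δ ∈ S, ∃ j, ∀ ζ ∈ D δ, ∀ k ∈ N ζ, ∀ n,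
        Finsupp.linearCombination ℤ (F j k ζ n) (gadBd C n (w j δ ζ n k)) = 0 := by
  obtain ⟨K, hK, ⟨k0⟩, hcol⟩ := exists_coloring hinf.le hsing
  choose a ha using fun δ : Λ => hcol (Set.Iio δ) (hIio δ)
  have hi : ∀ δ, ∃ i : Λ → Option σ.out, #(D δ) ≤ σ → Set.InjOn i (D δ) := fun δ => by
    by_cases h : #(D δ) ≤ σ
    · rw [← mk_out σ] at h
      obtain ⟨f⟩ := h
      classical
      refine ⟨fun ζ => if hζ : ζ ∈ D δ then some (f ⟨ζ, hζ⟩) else none, fun _ x hx y hy hxy => ?_⟩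
      simp only [dif_pos hx, dif_pos hy, Option.some.injEq] at hxy
      exact congrArg Subtype.val (f.injective hxy)
    · exact ⟨fun _ => none, fun h' => absurd h' h⟩
  choose i hi using hi
  have hJ : #(Option σ.out → K) < μ := by
    rw [← power_def]
    refine power_lt_of_strongLimit hinf.le hstrong hK ?_
    rw [mk_option, mk_out]
    exact add_lt_of_lt hinf.le hσ (one_lt_aleph0.trans hinf)
  have henc : ∀ ζ : Λ, Nonempty (((N ζ × (Σ n : ULift.{u} ℕ, GadV C n.down)) ×
      (Option σ.out → K) → ℤ) ↪ Λ) := fun ζ => by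
    rw [← le_def]
    refine le_trans ?_ hΛ
    have h1 : #((N ζ × (Σ n : ULift.{u} ℕ, GadV C n.down)) × (Option σ.out → K)) ≤ μ := by
      rw [mk_prod, lift_id, lift_id, mk_prod, lift_id, lift_id]
      refine mul_le_of_le hinf.le (mul_le_of_le hinf.le (hN ζ) ?_) hJ.le
      rw [mk_sigma]
      refine (sum_le_mk_mul_iSup _).trans (mul_le_of_le hinf.le ?_ ?_)
      · simpa using hinf.le
      · exact ciSup_le' fun n => (mk_gad_le hinf.le C hC.le _).2
    rw [mk_pi]
    simp only [prod_const, mk_int, lift_aleph0, lift_uzero]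
    calc ℵ₀ ^ _ ≤ (2 ^ μ) ^ μ := (power_le_power_left aleph0_ne_zero h1).trans
          (power_le_power_right (hinf.le.trans (cantor μ).le))
      _ = 2 ^ μ := by rw [← power_mul, mul_eq_self hinf.le]
  let enc := fun ζ => Classical.choice (henc ζ)
  have hw : ∀ (j : Option σ.out → K) (δ ζ : Λ) (n : ℕ) (k : G), ∃ w : GadW C n,
      ∀ hk : k ∈ N ζ, ∀ f, (h : enc ζ f < δ) → a δ ⟨enc ζ f, h⟩ = j (i δ ζ) → ∀ j',
        Finsupp.linearCombination ℤ (fun y => f ((⟨k, hk⟩, ⟨⟨n⟩, y⟩), j')) (gadBd C n w) = 0 := by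
    intro j δ ζ n k
    by_cases hk : k ∈ N ζ
    · have hP : #{f // ∃ h : enc ζ f < δ, a δ ⟨enc ζ f, h⟩ = j (i δ ζ)} < μ := by
        refine lt_of_le_of_lt (mk_le_of_injective (f := fun f =>
          (⟨⟨enc ζ f.1, f.2.1⟩, f.2.2⟩ : {x // a δ x = j (i δ ζ)})) ?_) (ha δ _)
        intro f f' h
        exact Subtype.ext ((enc ζ).injective (congrArg (fun x => x.1.1) h))
      obtain ⟨w, hw⟩ := exists_gad_eq_zero hinf hstrong hC.ge n hP hJ
        (fun f j' y => f.1 ((⟨k, hk⟩, ⟨⟨n⟩, y⟩), j'))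
      exact ⟨w, fun hk f h h' j' => hw ⟨f, h, h'⟩ j'⟩
    · have hP : #PEmpty.{u + 1} < μ := by rw [mk_pempty]; exact aleph0_pos.trans hinf
      obtain ⟨w, -⟩ := exists_gad_eq_zero hinf hstrong hC.ge n hP hP (fun p => p.elim)
      exact ⟨w, fun h => absurd h hk⟩
  choose w hw using hw
  refine ⟨_, w, fun F => ?_⟩
  let f := fun (ζ : Λ) (p : (N ζ × (Σ n : ULift.{u} ℕ, GadV C n.down)) × (Option σ.out → K)) =>
    F p.2 p.1.1 ζ p.1.2.1.down p.1.2.2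
  obtain ⟨δ, hδS, hδ, hcard⟩ := hguess fun ζ => enc ζ (f ζ)
  classical
  let b : D δ → K := fun ζ => a δ ⟨enc ζ.1 (f ζ.1), hδ _ (hD δ _ ζ.2)⟩
  have hinj : Function.Injective fun ζ : D δ => i δ ζ.1 := fun x y h =>
    Subtype.ext (hi δ hcard x.2 y.2 h)
  refine ⟨δ, hδS, Function.extend (fun ζ : D δ => i δ ζ.1) b fun _ => k0, fun ζ hζ k hk n => ?_⟩
  exact hw _ δ ζ n k hk (f ζ) (hδ _ (hD δ _ hζ)) (hinj.extend_apply b _ ⟨ζ, hζ⟩).symm _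

theorem exists_unsolvable {lam : Cardinal.{u}}
    (hsmallnotW : ∀ (θ : Cardinal.{u}), Cardinal.aleph0 ≤ θ → θ < lam →
      ∀ (G : Type u) (inst : AddCommGroup G),
        Cardinal.mk G = θ → @IsKappaFree θ G inst → ¬ @IsFreeAbelian G inst →
          ¬ @IsWhitehead G inst)
    {G : Type u} [AddCommGroup G] {M L : AddSubgroup G} (E : ℕ → Set G) (x : ℕ → G → (G →₀ ℤ))
    (E_sub : ∀ n, E n ⊆ L) (E_ind : ∀ n, ∀ c ∈ suppS (E n), ev c ∈ M → c = 0)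
    (x_supp : ∀ n, ∀ e ∈ E n, x n e ∈ suppS (E (n + 1)))
    (x_mem : ∀ n, ∀ e ∈ E n, e - ev (x n e) ∈ M)
    (E_span : ∀ a ∈ L, ∃ n, ∃ c ∈ suppS (E n), a - ev c ∈ M)
    (hL : #L < lam) (hpure : ∀ m : ℤ, m ≠ 0 → ∀ y ∈ L, m • y ∈ M → y ∈ M)
    (hnf : ¬ Module.Free ℤ (L.map (QuotientAddGroup.mk' M))) :
    ∃ g : ℕ → G → ℤ, ∀ t : ℕ → G → ℤ,
      ∃ n, ∃ e ∈ E n, t n e - Finsupp.linearCombination ℤ (t (n + 1)) (x n e) ≠ g n e := by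
  classical
  let ι := {p : ℕ × G // p.2 ∈ E p.1}
  let s : ℕ → G → (ι →₀ ℤ) := fun n e =>
    if h : e ∈ E n then Finsupp.single ⟨(n, e), h⟩ 1 else 0
  let ρ : ℕ → G → (ι →₀ ℤ) := fun n e => s n e - Finsupp.linearCombination ℤ (s (n + 1)) (x n e)
  let π₀ : (ι →₀ ℤ) →+ G ⧸ M :=
    (Finsupp.linearCombination ℤ (fun p : ι => (QuotientAddGroup.mk p.1.2 : G ⧸ M))).toAddMonoidHom
  have hs : ∀ n, ∀ e ∈ E n, π₀ (s n e) = QuotientAddGroup.mk e := fun n e he => by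
    simp [π₀, s, dif_pos he]
  have hlin : ∀ (A : Type u) [AddCommGroup A] (f : (ι →₀ ℤ) →+ A) (r : G → A) (n : ℕ)
      (_ : ∀ e ∈ E n, f (s n e) = r e) (c : G →₀ ℤ), c ∈ suppS (E n) →
      f (Finsupp.linearCombination ℤ (s n) c) = Finsupp.linearCombination ℤ r c := by
    intro A _ f r n hr c hc
    refine suppS_induction (p := fun c => f (Finsupp.linearCombination ℤ (s n) c) =
      Finsupp.linearCombination ℤ r c) (by simp) (fun a b ha hb => by simp [ha, hb])
      (fun e he m => ?_) hc
    simp [hr e he]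
  have hmk : ∀ c : G →₀ ℤ, Finsupp.linearCombination ℤ
      (fun e => (QuotientAddGroup.mk e : G ⧸ M)) c = QuotientAddGroup.mk (ev c) := fun c =>
    (Finsupp.apply_linearCombination ℤ (QuotientAddGroup.mk' M).toIntLinearMap id c).symm
  have hsc : ∀ n, ∀ c ∈ suppS (E n),
      π₀ (Finsupp.linearCombination ℤ (s n) c) = QuotientAddGroup.mk (ev c) := fun n c hc =>
    (hlin _ π₀ _ n (hs n) c hc).trans (hmk c)
  have hρ : ∀ n, ∀ e ∈ E n, π₀ (ρ n e) = 0 := fun n e he => by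
    simp only [ρ, map_sub, hs n e he, hsc (n + 1) _ (x_supp n e he)]
    rw [← QuotientAddGroup.mk_sub, QuotientAddGroup.eq_zero_iff]
    exact x_mem n e he
  have hrange : π₀.range = L.map (QuotientAddGroup.mk' M) := by
    apply le_antisymm
    · rintro _ ⟨y, rfl⟩
      induction y using Finsupp.induction_linear with
      | zero => rw [map_zero]; exact zero_mem _
      | add a b ha hb => rw [map_add]; exact add_mem ha hb
      | single p m =>
        refine ⟨m • p.1.2, zsmul_mem (E_sub _ p.2) m, ?_⟩
        simp [π₀]
    · rintro _ ⟨a, ha, rfl⟩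
      obtain ⟨n, c, hc, h⟩ := E_span a ha
      refine ⟨Finsupp.linearCombination ℤ (s n) c, ?_⟩
      rw [hsc n c hc, QuotientAddGroup.mk'_apply, QuotientAddGroup.eq, neg_add_eq_sub]
      exact h
  have hcard : #π₀.range < lam := by
    rw [hrange]
    exact (mk_le_of_surjective (AddMonoidHom.addSubgroupMap_surjective _ _)).trans_lt hL
  have htf : ∀ m : ℤ, m ≠ 0 → ∀ y : π₀.range, m • y = 0 → y = 0 := by
    rintro m hm ⟨y, hy⟩ h0
    have h1 : m • y = 0 := congrArg Subtype.val h0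
    apply Subtype.ext
    change y = 0
    rw [hrange] at hy
    obtain ⟨a, ha, rfl⟩ := hy
    rw [← map_zsmul, QuotientAddGroup.mk'_apply, QuotientAddGroup.eq_zero_iff] at h1
    rw [QuotientAddGroup.mk'_apply, QuotientAddGroup.eq_zero_iff]
    exact hpure m hm a ha h1
  obtain ⟨κ, hκ⟩ := exists_not_extend hsmallnotW π₀.rangeRestrict π₀.rangeRestrict_surjective
    inferInstance hcard htf (by rwa [hrange])
  have hker : ∀ y, y ∈ π₀.rangeRestrict.ker ↔ π₀ y = 0 := fun y => by
    rw [AddMonoidHom.ker_rangeRestrict, AddMonoidHom.mem_ker]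
  refine ⟨fun n e => if h : ρ n e ∈ π₀.rangeRestrict.ker then κ ⟨ρ n e, h⟩ else 0, fun t => ?_⟩
  by_contra hcon
  push Not at hcon
  let f : (ι →₀ ℤ) →+ ℤ :=
    (Finsupp.linearCombination ℤ (fun p : ι => t p.1.1 p.1.2)).toAddMonoidHom
  have hfs : ∀ n, ∀ e ∈ E n, f (s n e) = t n e := fun n e he => by
    simp [f, s, dif_pos he]
  have hlinf : ∀ n, ∀ c ∈ suppS (E n),
      f (Finsupp.linearCombination ℤ (s n) c) = Finsupp.linearCombination ℤ (t n) c := by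
    intro n c hc
    refine suppS_induction (p := fun c => f (Finsupp.linearCombination ℤ (s n) c) =
      Finsupp.linearCombination ℤ (t n) c) (by simp) (fun a b ha hb => by simp [ha, hb])
      (fun e he m => ?_) hc
    simp [hfs n e he]
  let K : AddSubgroup (ι →₀ ℤ) := AddSubgroup.closure {w | ∃ n, ∃ e ∈ E n, w = ρ n e}
  have hK : ∀ y ∈ K, ∃ h : y ∈ π₀.rangeRestrict.ker, f y = κ ⟨y, h⟩ := by
    intro y hy
    induction hy using AddSubgroup.closure_induction with
    | mem w hw =>
      obtain ⟨n, e, he, rfl⟩ := hw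
      have h := (hker _).mpr (hρ n e he)
      refine ⟨h, ?_⟩
      have h1 := hcon n e he
      rw [dif_pos h] at h1
      rw [← h1]
      simp only [ρ, map_sub, hfs n e he, hlinf _ _ (x_supp n e he)]
    | zero => exact ⟨zero_mem _, by rw [map_zero]; exact (map_zero κ).symm⟩
    | add a b _ _ ha hb =>
      obtain ⟨ha, ha'⟩ := ha
      obtain ⟨hb, hb'⟩ := hb
      exact ⟨add_mem ha hb, by rw [map_add, ha', hb', ← map_add]; rfl⟩
    | neg a _ ha =>
      obtain ⟨ha, ha'⟩ := ha
      exact ⟨neg_mem ha, by rw [map_neg, ha', ← map_neg]; rfl⟩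
  obtain ⟨y, hy⟩ := hκ f
  apply hy
  have hgen : ∀ y : ι →₀ ℤ, y ∈ AddSubgroup.closure ({w | ∃ n, ∃ e ∈ E n, w = s n e} ∪ K) := by
    intro y
    induction y using Finsupp.induction_linear with
    | zero => exact zero_mem _
    | add a b ha hb => exact add_mem ha hb
    | single p m =>
      have h : s p.1.1 p.1.2 ∈ AddSubgroup.closure ({w | ∃ n, ∃ e ∈ E n, w = s n e} ∪ K) :=
        AddSubgroup.subset_closure (Or.inl ⟨p.1.1, p.1.2, p.2, rfl⟩)
      have h1 : Finsupp.single p m = m • s p.1.1 p.1.2 := by simp [s, dif_pos p.2]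
      rw [h1]
      exact zsmul_mem h m
  obtain ⟨n, c, hc, h⟩ := exists_normal (K := K) x_supp
    (fun n e he => AddSubgroup.subset_closure ⟨n, e, he, rfl⟩) (hgen y.1)
  have h1 := (hker _).mp (hK _ h).1
  rw [map_sub, (hker _).mp y.2, zero_sub, neg_eq_zero, hsc n c hc,
    QuotientAddGroup.eq_zero_iff] at h1
  rw [E_ind n c hc h1, map_zero, sub_zero] at h
  exact (hK _ h).2

theorem isPure_below {G Λ : Type*} [AddCommGroup G] [LinearOrder Λ] {N : Λ → AddSubgroup G}
    (hN : Monotone N) (htf : ∀ m : ℤ, m ≠ 0 → ∀ y : G, m • y = 0 → y = 0)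
    (hpure : ∀ γ, IsPure (N γ)) (δ : Λ) : IsPure (below N δ) := by
  intro m hm y hy
  rcases (mem_below hN).mp hy with h | ⟨γ, hγ, h⟩
  · rw [htf m hm y h]; exact zero_mem _
  · exact le_below hγ (hpure γ m hm y h)

theorem Frame.exists_frame {μ lam : Cardinal.{u}} (hinf : ℵ₀ < μ) (hsing : μ.ord.cof < μ)
    (hstrong : ∀ θ < μ, (2 : Cardinal.{u}) ^ θ < μ) (hlam : lam = Order.succ μ)
    (hsmallnotW : ∀ (θ : Cardinal.{u}), Cardinal.aleph0 ≤ θ → θ < lam →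
      ∀ (G : Type u) (inst : AddCommGroup G),
        Cardinal.mk G = θ → @IsKappaFree θ G inst → ¬ @IsFreeAbelian G inst →
          ¬ @IsWhitehead G inst)
    {G Λ : Type u} [AddCommGroup G] [LinearOrder Λ] [Nonempty Λ]
    (htf : ∀ m : ℤ, m ≠ 0 → ∀ y : G, m • y = 0 → y = 0)
    (N : Λ → AddSubgroup G) (hmono : Monotone N) (hpure : ∀ γ, IsPure (N γ))
    (hN : ∀ ζ, #(N ζ) ≤ μ) (hΛ : (2 : Cardinal.{u}) ^ μ ≤ #Λ)
    (hIio : ∀ δ : Λ, #(Set.Iio δ) ≤ μ) (S : Set Λ)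
    (hnf : ∀ δ ∈ S, ¬ Module.Free ℤ ((N δ).map (QuotientAddGroup.mk' (below N δ))))
    (D : Λ → ℕ → Set Λ) (hD0 : ∀ δ n, D δ n ⊆ D δ 0) (hDlt : ∀ δ, ∀ ζ ∈ D δ 0, ζ < δ)
    (hDne : ∀ δ ∈ S, ∀ n, (D δ n).Nonempty)
    (hDcof : ∀ δ ∈ S, ∀ n, ∀ γ < δ, ∃ ζ ∈ D δ n, γ ≤ ζ)
    (σ : Cardinal.{u}) (hσ : σ < μ)
    (hguess : ∀ e : Λ → Λ, ∃ δ ∈ S, (∀ γ < δ, e γ < δ) ∧ #(D δ 0) ≤ σ) :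
    ∃ P : Frame G Λ, P.N = N ∧ P.S = S ∧ (∀ δ ∈ S, ∀ n, ∀ e ∈ P.E δ n, P.ζ δ n e ∈ D δ n) ∧
      (∀ n, #(P.V n) ≤ μ) ∧ ∀ f : P.Grp →+ ℤ, f P.zG ≠ 1 := by
  have hC : #μ.out = μ := mk_out μ
  obtain ⟨J, w, hw⟩ := exists_guess hinf hsing hstrong (fun ζ => (N ζ : Set G)) hN hΛ hIio S
    (fun δ => D δ 0) σ hσ hguess hDlt hC
  have hpb := isPure_below hmono htf hpure
  choose E hE_sub hE_ind hE_x hE_span using fun δ =>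
    exists_tower (below N δ) (N δ) fun m hm y _ h => hpb δ m hm y h
  choose! x hx_supp hx_mem using hE_x
  have E_ind : ∀ δ n, ∀ c ∈ suppS (E δ n), ev c ∈ below N δ → c = 0 := fun δ n c hc =>
    hE_ind δ n c (mem_suppS_iff_support.mp hc)
  have x_supp : ∀ δ n, ∀ e ∈ E δ n, x δ n e ∈ suppS (E δ (n + 1)) := fun δ n e he =>
    mem_suppS_iff_support.mpr (hx_supp δ n e he)
  have E_span : ∀ δ, ∀ a ∈ N δ, ∃ n, ∃ c ∈ suppS (E δ n), a - ev c ∈ below N δ := fun δ a ha => by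
    obtain ⟨n, c, hc, h⟩ := hE_span δ a ha
    exact ⟨n, c, mem_suppS_iff_support.mpr hc, h⟩
  have hζ : ∀ δ ∈ S, ∀ n, ∀ e ∈ E δ n, ∃ ζ ∈ D δ n, e - ev (x δ n e) ∈ N ζ := by
    intro δ hδ n e he
    rcases (mem_below hmono).mp (hx_mem δ n e he) with h | ⟨γ, hγ, h⟩
    · obtain ⟨ζ, hζ⟩ := hDne δ hδ n
      exact ⟨ζ, hζ, by rw [h]; exact zero_mem _⟩
    · obtain ⟨ζ, hζ, hle⟩ := hDcof δ hδ n γ hγ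
      exact ⟨ζ, hζ, hmono hle h⟩
  choose! ζ hζD hζN using hζ
  have hg : ∀ δ ∈ S, ∃ g : ℕ → G → ℤ, ∀ t : ℕ → G → ℤ, ∃ n, ∃ e ∈ E δ n,
      t n e - Finsupp.linearCombination ℤ (t (n + 1)) (x δ n e) ≠ g n e := fun δ hδ =>
    exists_unsolvable hsmallnotW (E δ) (x δ) (hE_sub δ) (E_ind δ) (x_supp δ) (hx_mem δ) (E_span δ)
      (by rw [hlam, Order.lt_succ_iff]; exact hN δ) (fun m hm y _ h => hpb δ m hm y h) (hnf δ hδ)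
  choose! g hg using hg
  let Pj : J → Frame G Λ := fun j =>
    { N := N
      mono := hmono
      S := S
      E := E
      x := x
      V := GadV μ.out
      ζ := ζ
      bd := fun δ ζ n k => gadBd μ.out n (w j δ ζ n k)
      g := g
      E_sub := hE_sub
      E_ind := E_ind
      x_supp := x_supp
      x_mem := hx_mem
      E_span := E_span
      ζ_lt := fun δ hδ n e he => hDlt δ _ (hD0 δ n (hζD δ hδ n e he))
      ζ_mem := hζN
      pot := fun n k ζ T hT => by
        classical
        obtain ⟨φ, hφ⟩ := exists_potential μ.out n (T.image fun δ => w j δ ζ n k)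
          (Finset.card_image_le.trans hT)
        exact ⟨φ, fun δ hδ => hφ _ (Finset.mem_image_of_mem _ hδ)⟩ }
  suffices h : ∃ j, ∀ f : (Pj j).Grp →+ ℤ, f (Pj j).zG ≠ 1 by
    obtain ⟨j, hj⟩ := h
    exact ⟨Pj j, rfl, rfl, hζD, fun n => (mk_gad_le hinf.le _ hC.le n).2, hj⟩
  by_contra hcon
  push Not at hcon
  choose f hf using hcon
  let F : ∀ j, Item G Λ (GadV μ.out) → ℤ := fun j v => f j (QuotientAddGroup.mk (Finsupp.single v 1))
  obtain ⟨δ, hδ, j, hj⟩ := hw fun j k ζ n y => F j (Item.sym k ζ n y)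
  obtain ⟨n, e, he, hne⟩ := hg δ hδ fun n e => F j (Item.real δ n e)
  apply hne
  have hlin : ∀ c : (Pj j).X →₀ ℤ, f j (QuotientAddGroup.mk c) =
      Finsupp.linearCombination ℤ (F j) c := by
    intro c
    induction c using Finsupp.induction_linear with
    | zero => rw [map_zero]; exact map_zero (f j)
    | add a b ha hb => rw [map_add, ← ha, ← hb, ← map_add]; rfl
    | single v m =>
      rw [Finsupp.linearCombination_single, ← map_zsmul, ← QuotientAddGroup.mk_zsmul,
        Finsupp.smul_single, smul_eq_mul, mul_one]
  have hmem := (Pj j).sys.rho_mem_U (D := (Pj j).items Set.univ) (v := Item.real δ n e) ?_ ?_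
  · have h0 : f j (QuotientAddGroup.mk ((Pj j).sys.rho (Item.real δ n e))) = 0 := by
      rw [(QuotientAddGroup.eq_zero_iff _).mpr hmem, map_zero]
    rw [hlin] at h0
    have h1 := hj (ζ δ n e) (hD0 δ n (hζD δ hδ n e he)) (e - ev (x δ n e)) (hζN δ hδ n e he) n
    have h2 : (Pj j).sys.rho (Item.real δ n e) = Finsupp.single (Item.real δ n e) 1 -
      ((x δ n e).mapDomain (Item.real δ (n + 1)) +
        (gadBd μ.out n (w j δ (ζ δ n e) n (e - ev (x δ n e)))).mapDomain
          (Item.sym (e - ev (x δ n e)) (ζ δ n e) n) + Finsupp.single Item.z (g δ n e)) := rfl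
    have h3 : F j Item.z = 1 := hf j
    rw [h2, map_sub, map_add, map_add, Finsupp.linearCombination_mapDomain,
      Finsupp.linearCombination_mapDomain, Finsupp.linearCombination_single,
      Finsupp.linearCombination_single, h3] at h0
    rw [show Finsupp.linearCombination ℤ (F j ∘ Item.sym (e - ev (x δ n e)) (ζ δ n e) n)
      (gadBd μ.out n (w j δ (ζ δ n e) n (e - ev (x δ n e)))) = 0 from h1] at h0
    simp only [smul_eq_mul, mul_one, add_zero] at h0
    change F j _ - Finsupp.linearCombination ℤ (F j ∘ Item.real δ (n + 1)) _ = _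
    linarith
  · exact ⟨trivial, hδ, he⟩
  · exact ⟨hδ, he⟩

theorem exists_filtration {μ : Cardinal.{u}} (hinf : ℵ₀ ≤ μ) {G Λ : Type u} [AddCommGroup G]
    [LinearOrder Λ] [WellFoundedLT Λ] (hIio : ∀ δ : Λ, #(Set.Iio δ) ≤ μ) (en : Λ → G)
    (Φ : AddSubgroup G → AddSubgroup G → Prop)
    (hstep : ∀ B : AddSubgroup G, #B ≤ μ → ∀ g, ∃ K, B ≤ K ∧ g ∈ K ∧ #K ≤ μ ∧ Φ B K) :
    ∃ N : Λ → AddSubgroup G, Monotone N ∧ (∀ γ, #(N γ) ≤ μ) ∧ (∀ γ, en γ ∈ N γ) ∧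
      ∀ γ, Φ (below N γ) (N γ) := by
  choose! st hle hmem hcard hΦ using hstep
  let N : Λ → AddSubgroup G := (wellFounded_lt (α := Λ)).fix fun γ r =>
    st (⨆ γ' : Set.Iio γ, r γ'.1 γ'.2) (en γ)
  have hN : ∀ γ, N γ = st (below N γ) (en γ) := fun γ => WellFounded.fix_eq _ _ γ
  have key : ∀ γ, #(below N γ) ≤ μ ∧ #(N γ) ≤ μ := by
    intro γ
    induction γ using WellFoundedLT.induction with
    | _ γ ih =>
      have h1 : #(below N γ) ≤ μ := by
        obtain ⟨B, hB, hBμ⟩ := exists_addSubgroup_le hinf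
          (⋃ γ' : Set.Iio γ, (N γ' : Set G)) (by
            refine (mk_iUnion_le_sum_mk).trans ((sum_le_mk_mul_iSup _).trans
              (mul_le_of_le hinf (hIio γ) ?_))
            exact ciSup_le' fun γ' => (ih γ'.1 γ'.2).2)
        refine le_trans (mk_le_mk_of_subset (t := (B : Set G)) ?_) hBμ
        have : below N γ ≤ B := iSup_le fun γ' => (Set.subset_iUnion _ γ').trans hB
        exact this
      exact ⟨h1, by rw [hN]; exact hcard _ h1 _⟩
  refine ⟨N, fun γ δ h => ?_, fun γ => (key γ).2, fun γ => ?_, fun γ => ?_⟩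
  · rcases h.eq_or_lt with rfl | h
    · exact le_rfl
    · rw [hN δ]
      exact (le_below h).trans (hle _ (key δ).1 _)
  · rw [hN]; exact hmem _ (key γ).1 _
  · rw [hN γ]; exact hΦ _ (key γ).1 _

theorem exists_small_pure {μ : Cardinal.{u}} (hinf : ℵ₀ ≤ μ) {G : Type u} [AddCommGroup G]
    (htf : ∀ m : ℤ, m ≠ 0 → ∀ y : G, m • y = 0 → y = 0) (s : Set G) (hs : #s ≤ μ) :
    ∃ K : AddSubgroup G, s ⊆ K ∧ #K ≤ μ ∧ IsPure K := by
  obtain ⟨B, hB, hBμ⟩ := exists_addSubgroup_le hinf s hs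
  refine ⟨pureClosure B, hB.trans (le_pureClosure B), ?_, isPure_pureClosure B⟩
  choose m hm hmB using fun y : pureClosure B => mem_pureClosure.mp y.2
  have hinj : Function.Injective fun y => ((⟨m y⟩ : ULift.{u} ℤ), (⟨m y • (y : G), hmB y⟩ : B)) := by
    intro y y' h
    simp only [Prod.mk.injEq, ULift.up.injEq, Subtype.mk.injEq] at h
    have h1 := h.2
    rw [← h.1, ← sub_eq_zero, ← smul_sub] at h1
    exact Subtype.ext (sub_eq_zero.mp (htf _ (hm y) _ h1))
  refine (mk_le_of_injective hinj).trans ?_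
  rw [mk_prod, lift_id, lift_id]
  exact mul_le_of_le hinf (by simpa using hinf) hBμ

theorem torsionFree_of_isKappaFree {lam : Cardinal.{u}} (hlam : ℵ₀ < lam) {G : Type u}
    [AddCommGroup G] (hG : IsKappaFree lam G) :
    ∀ m : ℤ, m ≠ 0 → ∀ y : G, m • y = 0 → y = 0 := by
  intro m hm y h
  have hfree : Module.Free ℤ (AddSubgroup.zmultiples y) := hG _ (by
    refine lt_of_le_of_lt ?_ hlam
    exact mk_le_aleph0)
  have h1 : m • (⟨y, AddSubgroup.mem_zmultiples y⟩ : AddSubgroup.zmultiples y) = 0 :=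
    Subtype.ext h
  exact congrArg Subtype.val ((smul_eq_zero.mp h1).resolve_left hm)

theorem isPure_of_isKappaFree {lam : Cardinal.{u}} (hlam : ℵ₀ < lam) {G : Type u}
    [AddCommGroup G] {K : AddSubgroup G} (hG : IsKappaFree lam (G ⧸ K)) : IsPure K := by
  intro m hm y h
  rw [← QuotientAddGroup.eq_zero_iff] at h ⊢
  exact torsionFree_of_isKappaFree hlam hG m hm _ h

theorem exists_closed_ladder {Λ : Type u} [LinearOrder Λ] [WellFoundedLT Λ] [NoMaxOrder Λ]
    {μ lam : Cardinal.{u}} (hinf : ℵ₀ ≤ μ) (hlam : lam = Order.succ μ)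
    (hbdd : ∀ (A : Type u) (f : A → Λ), #A < lam → ∃ β, ∀ a, f a ≤ β)
    (hIic : ∀ α : Λ, #(Set.Iic α) ≤ μ) (e : Λ → Λ) (γ : Λ) :
    ∃ (δ : Λ) (a : ℕ → Λ), StrictMono a ∧ a 0 = γ ∧ (∀ n, a n < δ) ∧ (∀ γ' < δ, ∃ n, γ' ≤ a n) ∧
      ∀ γ' < δ, e γ' < δ := by
  have h1 : ∀ α, ∃ β, α < β ∧ ∀ γ' ≤ α, e γ' ≤ β := by
    intro α
    obtain ⟨β, hβ⟩ := hbdd (Set.Iic α) (fun x => e x) (by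
      rw [hlam, Order.lt_succ_iff]; exact hIic α)
    obtain ⟨β', hβ'⟩ := exists_gt (max α β)
    exact ⟨β', (le_max_left _ _).trans_lt hβ',
      fun γ' h => (hβ ⟨γ', h⟩).trans ((le_max_right _ _).trans hβ'.le)⟩
  choose nx hnx hnx' using h1
  let a : ℕ → Λ := fun n => nx^[n] γ
  have ha : ∀ n, a (n + 1) = nx (a n) := fun n => Function.iterate_succ_apply' nx n γ
  have hmono : StrictMono a := strictMono_nat_of_lt_succ fun n => by rw [ha]; exact hnx _
  have hne : {δ | ∀ n, a n < δ}.Nonempty := by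
    obtain ⟨β, hβ⟩ := hbdd (ULift.{u} ℕ) (fun n => a n.down) (by
      rw [hlam, Order.lt_succ_iff]; simpa using hinf)
    obtain ⟨β', hβ'⟩ := exists_gt β
    exact ⟨β', fun n => (hβ ⟨n⟩).trans_lt hβ'⟩
  let δ := (wellFounded_lt (α := Λ)).min _ hne
  have hδ : ∀ n, a n < δ := (wellFounded_lt (α := Λ)).min_mem _ hne
  have hδ' : ∀ γ' < δ, ∃ n, γ' ≤ a n := fun γ' h => by
    by_contra hcon
    push Not at hcon
    exact (wellFounded_lt (α := Λ)).not_lt_min _ (show γ' ∈ {δ | ∀ n, a n < δ} from hcon) h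
  refine ⟨δ, a, hmono, rfl, hδ, hδ', fun γ' h => ?_⟩
  obtain ⟨n, hn⟩ := hδ' γ' h
  refine lt_of_le_of_lt ?_ (hδ (n + 1))
  rw [ha]
  exact hnx' _ _ hn

theorem exists_uniform_bound {Λ : Type u} [LinearOrder Λ] {μ lam : Cardinal.{u}} (hμ : μ < lam)
    (hbdd : ∀ (A : Type u) (f : A → Λ), #A < lam → ∃ β, ∀ a, f a ≤ β) (S : Set Λ)
    (d : Λ → Cardinal.{u}) (hd : ∀ δ ∈ S, d δ < μ)
    (hcl : ∀ e : Λ → Λ, ∃ δ ∈ S, ∀ γ < δ, e γ < δ) :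
    ∃ σ < μ, ∀ e : Λ → Λ, ∃ δ ∈ S, (∀ γ < δ, e γ < δ) ∧ d δ ≤ σ := by
  by_contra hcon
  push Not at hcon
  let c : μ.ord.ToType → Cardinal.{u} := fun x =>
    (Ordinal.typein (α := μ.ord.ToType) (· < ·) x).card
  have hc : ∀ x, c x < μ := fun x => lt_ord.mp (Ordinal.typein_lt_self x)
  choose e he using fun x => hcon (c x) (hc x)
  choose E hE using fun γ => hbdd μ.ord.ToType (fun x => e x γ) (by rwa [mk_ord_toType])
  obtain ⟨δ, hδ, hcl⟩ := hcl E
  have h1 : (d δ).ord < Ordinal.type (α := μ.ord.ToType) (· < ·) := by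
    rw [Ordinal.type_toType]; exact ord_lt_ord.mpr (hd δ hδ)
  have h2 := he (Ordinal.enum (α := μ.ord.ToType) (· < ·) ⟨_, h1⟩) δ hδ
    fun γ h => (hE γ _).trans_lt (hcl γ h)
  simp only [c, Ordinal.typein_enum, card_ord] at h2
  exact lt_irrefl _ h2

theorem exists_cofinal_lt {Λ : Type u} [LinearOrder Λ] [WellFoundedLT Λ] {μ : Cardinal.{u}}
    (hsing : μ.ord.cof < μ) (δ : Λ) (hδ : #(Set.Iio δ) ≤ μ) :
    ∃ C : Set Λ, #C < μ ∧ (∀ ζ ∈ C, ζ < δ) ∧ ∀ γ < δ, ∃ ζ ∈ C, γ ≤ ζ := by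
  obtain ⟨s, hs, hcard⟩ := Order.exists_cof_eq (Set.Iio δ)
  refine ⟨Subtype.val '' s, ?_, ?_, ?_⟩
  · refine mk_image_le.trans_lt ?_
    rw [hcard]
    refine ((Order.cof_le_cardinalMk _).trans hδ).lt_of_ne fun h => ?_
    have := Order.cof_ord_cof (Set.Iio δ)
    rw [h] at this
    exact hsing.ne this
  · rintro _ ⟨ζ, -, rfl⟩
    exact ζ.2
  · intro γ hγ
    obtain ⟨ζ, hζ, h⟩ := hs ⟨γ, hγ⟩
    exact ⟨ζ, ⟨ζ, hζ, rfl⟩, h⟩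

theorem exists_closed_not_free {Λ : Type u} [LinearOrder Λ] [WellFoundedLT Λ]
    {G : Type u} [AddCommGroup G] (N : Λ → AddSubgroup G)
    (hmono : Monotone N) (hcov : ∀ g, ∃ γ, g ∈ N γ) (hnf : ¬ Module.Free ℤ G)
    (hfree : ∀ γ δ, γ < δ → Module.Free ℤ ((N δ).map (QuotientAddGroup.mk' (N γ))))
    (hub : ∀ (e : Λ → Λ) (γ : Λ), ∃ δ, γ < δ ∧ ∀ γ' < δ, e γ' < δ) (e : Λ → Λ) :
    ∃ δ, ¬ Module.Free ℤ ((N δ).map (QuotientAddGroup.mk' (below N δ))) ∧ ∀ γ < δ, e γ < δ := by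
  by_contra hcon
  push Not at hcon
  replace hcon : ∀ δ, (∀ γ < δ, e γ < δ) →
      Module.Free ℤ ((N δ).map (QuotientAddGroup.mk' (below N δ))) := fun δ h => by
    by_contra h'
    obtain ⟨γ, h1, h2⟩ := hcon δ h'
    exact absurd (h γ h1) (not_lt.mpr h2)
  apply hnf
  let Cl := {δ : Λ // ∀ γ < δ, e γ < δ}
  let N' : Cl → AddSubgroup G := fun δ => N δ.1
  have hN' : Monotone N' := fun a b h => hmono h
  have h0 : Module.Free ℤ (G ⧸ (⊥ : AddSubgroup G)) := by
    refine free_of_filtration ⊥ N' hN' (fun δ => QuotientAddGroup.mk' (below N' δ)) ?_ ?_ ?_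
    · intro δ
      suffices h : ∃ B, below N' δ = B ∧
          Module.Free ℤ ((N δ.1).map (QuotientAddGroup.mk' B)) by
        obtain ⟨_, rfl, h⟩ := h
        exact h
      by_cases hlim : ∀ γ < δ.1, ∃ j : Cl, j < δ ∧ γ < j.1
      · refine ⟨_, le_antisymm ?_ ?_, hcon δ.1 δ.2⟩
        · exact iSup_le fun j => le_below (N := N) j.2
        · refine iSup_le fun γ => ?_
          obtain ⟨j, hj, hγ⟩ := hlim γ.1 γ.2
          exact (hmono hγ.le).trans (le_below (N := N') hj)
      · push Not at hlim
        let s := (wellFounded_lt (α := Λ)).min {γ | γ < δ.1 ∧ ∀ j : Cl, j < δ → j.1 ≤ γ} hlim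
        have hs : s < δ.1 ∧ ∀ j : Cl, j < δ → j.1 ≤ s :=
          (wellFounded_lt (α := Λ)).min_mem {γ | γ < δ.1 ∧ ∀ j : Cl, j < δ → j.1 ≤ γ} hlim
        have hsc : ∀ γ < s, e γ < s := fun γ hγ => by
          have h1 : γ ∉ {γ | γ < δ.1 ∧ ∀ j : Cl, j < δ → j.1 ≤ γ} := fun h =>
            (wellFounded_lt (α := Λ)).not_lt_min _ h hγ
          simp only [Set.mem_ofPred_eq, not_and, not_forall, not_le] at h1
          obtain ⟨j, hj, h2⟩ := h1 (hγ.trans hs.1)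
          exact (j.2 γ h2).trans_le (hs.2 j hj)
        refine ⟨_, le_antisymm ?_ ?_, hfree s δ.1 hs.1⟩
        · exact iSup_le fun j => hmono (hs.2 j.1 j.2)
        · exact le_below (N := N') (γ := ⟨s, hsc⟩) hs.1
    · intro δ y _
      rw [QuotientAddGroup.mk'_apply, QuotientAddGroup.eq_zero_iff, mem_below hN',
        AddSubgroup.mem_bot]
      refine or_congr Iff.rfl (exists_congr fun j => and_congr_right fun _ => ?_)
      constructor
      · exact fun h => ⟨y, h, by simp⟩
      · rintro ⟨y', h, h'⟩
        rw [AddSubgroup.mem_bot, sub_eq_zero] at h'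
        rwa [h']
    · intro y
      obtain ⟨γ, hγ⟩ := hcov y
      obtain ⟨δ, h, hδ⟩ := hub e γ
      exact ⟨⟨δ, hδ⟩, y, hmono h.le hγ, by simp⟩
  exact free_of_addEquiv (QuotientAddGroup.quotientBot (G := G)) h0

theorem exists_strongly_free_of_filtration {μ lam : Cardinal.{u}} (hsing : μ.ord.cof < μ)
    (hstrong : ∀ θ < μ, (2 : Cardinal.{u}) ^ θ < μ) (hlam : lam = Order.succ μ)
    (hsmallnotW : ∀ (θ : Cardinal.{u}), Cardinal.aleph0 ≤ θ → θ < lam →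
      ∀ (G : Type u) (inst : AddCommGroup G),
        Cardinal.mk G = θ → @IsKappaFree θ G inst → ¬ @IsFreeAbelian G inst →
          ¬ @IsWhitehead G inst)
    {G Λ : Type u} [AddCommGroup G] [LinearOrder Λ] [WellFoundedLT Λ] [Nonempty Λ]
    (hGfree : IsKappaFree lam G) (hG : #G = lam) (hΛc : #Λ = lam)
    (hΛ : (2 : Cardinal.{u}) ^ μ = lam)
    (hbdd : ∀ (A : Type u) (f : A → Λ), #A < lam → ∃ β, ∀ a, f a ≤ β)
    (hIic : ∀ α : Λ, #(Set.Iic α) ≤ μ)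
    (N : Λ → AddSubgroup G) (hmono : Monotone N) (hpure : ∀ γ, IsPure (N γ))
    (hN : ∀ ζ, #(N ζ) ≤ μ) (S : Set Λ)
    (hnf : ∀ δ ∈ S, ¬ Module.Free ℤ ((N δ).map (QuotientAddGroup.mk' (below N δ))))
    (D : Λ → ℕ → Set Λ) (hD0 : ∀ δ n, D δ n ⊆ D δ 0) (hDlt : ∀ δ, ∀ ζ ∈ D δ 0, ζ < δ)
    (hDne : ∀ δ ∈ S, ∀ n, (D δ n).Nonempty)
    (hDcof : ∀ δ ∈ S, ∀ n, ∀ γ < δ, ∃ ζ ∈ D δ n, γ ≤ ζ)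
    (σ : Cardinal.{u}) (hσ : σ < μ)
    (hguess : ∀ e : Λ → Λ, ∃ δ ∈ S, (∀ γ < δ, e γ < δ) ∧ #(D δ 0) ≤ σ)
    (hR : ∀ α, ∃ R β, R ≤ N β ∧ IsKappaFree lam (G ⧸ R) ∧
      (∀ δ ∈ S, α < δ → R ≤ below N δ) ∧
      ∀ δ ∈ S, α < δ → ∃ ν, ∀ n ≥ ν, ∀ ζ ∈ D δ n, ζ ≤ α → N ζ ≤ R) :
    ∃ (G : Type u) (inst : AddCommGroup G),
      #G = lam ∧ @IsStronglyKappaFree lam G inst ∧ ∀ f : G →+ ℤ, f = 0 := by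
  have hinf := aleph0_lt_of_singular μ hsing hstrong
  have hμ : μ < lam := hlam ▸ Order.lt_succ μ
  have htf := torsionFree_of_isKappaFree (hinf.trans hμ) hGfree
  obtain ⟨P, hPN, hPS, hPζ, hPV, hPf⟩ := Frame.exists_frame hinf hsing hstrong hlam hsmallnotW htf N
    hmono hpure hN (hΛ.trans hΛc.symm).le
    (fun δ => (mk_le_mk_of_subset Set.Iio_subset_Iic_self).trans (hIic δ))
    S hnf D hD0 hDlt hDne hDcof σ hσ hguess
  subst hPN hPS
  have hfree : ∀ R : AddSubgroup G, IsKappaFree lam (G ⧸ R) → ∀ β,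
      Module.Free ℤ ((P.N β).map (QuotientAddGroup.mk' R)) := fun R h β => by
    refine h _ (lt_of_le_of_lt ?_ hμ)
    exact (mk_le_of_surjective (AddMonoidHom.addSubgroupMap_surjective _ _)).trans (hN β)
  have hbot : IsKappaFree lam (G ⧸ (⊥ : AddSubgroup G)) :=
    hGfree.of_injective (QuotientAddGroup.quotientBot (G := G)).toAddMonoidHom
      (QuotientAddGroup.quotientBot (G := G)).injective
  refine P.exists_strongly_free hinf.le hlam hbdd hIic hN hPV hG.le hΛc.le ?_ ?_ hPf
  · refine ⟨⊥, Classical.arbitrary Λ, fun β _ => ⟨isLowerSet_empty, bot_le, hfree _ hbot β,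
      fun _ _ _ => bot_le, fun _ _ _ => ⟨0, fun _ _ _ _ h => absurd h (Set.notMem_empty _)⟩⟩⟩
  · intro α
    obtain ⟨R, β0, h1, h2, h3, h4⟩ := hR α
    refine ⟨R, β0, fun β hβ => ⟨isLowerSet_Iic α, h1.trans (hmono hβ), hfree R h2 β,
      fun δ hδ hα => h3 δ hδ (not_le.mp hα), fun δ hδ hα => ?_⟩⟩
    obtain ⟨ν, hν⟩ := h4 δ hδ (not_le.mp hα)
    exact ⟨ν, fun n hn e he h => hν n hn _ (hPζ δ hδ n e he) h⟩

theorem exists_strongly_free_of_isKappaFree {μ lam : Cardinal.{u}} (hsing : μ.ord.cof < μ)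
    (hstrong : ∀ θ < μ, (2 : Cardinal.{u}) ^ θ < μ) (hlam : lam = Order.succ μ)
    (hsmallnotW : ∀ (θ : Cardinal.{u}), Cardinal.aleph0 ≤ θ → θ < lam →
      ∀ (G : Type u) (inst : AddCommGroup G),
        Cardinal.mk G = θ → @IsKappaFree θ G inst → ¬ @IsFreeAbelian G inst →
          ¬ @IsWhitehead G inst)
    {G Λ : Type u} [AddCommGroup G] [LinearOrder Λ] [WellFoundedLT Λ] [NoMaxOrder Λ] [Nonempty Λ]
    (hGfree : IsKappaFree lam G) (hGnf : ¬ Module.Free ℤ G) (hG : #G = lam) (hΛc : #Λ = lam)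
    (hΛ : (2 : Cardinal.{u}) ^ μ = lam)
    (hbdd : ∀ (A : Type u) (f : A → Λ), #A < lam → ∃ β, ∀ a, f a ≤ β)
    (hIic : ∀ α : Λ, #(Set.Iic α) ≤ μ) :
    ∃ (G : Type u) (inst : AddCommGroup G),
      #G = lam ∧ @IsStronglyKappaFree lam G inst ∧ ∀ f : G →+ ℤ, f = 0 := by
  have hinf := aleph0_lt_of_singular μ hsing hstrong
  have hμ : μ < lam := hlam ▸ Order.lt_succ μ
  have htf := torsionFree_of_isKappaFree (hinf.trans hμ) hGfree
  have hIio : ∀ δ : Λ, #(Set.Iio δ) ≤ μ := fun δ =>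
    (mk_le_mk_of_subset Set.Iio_subset_Iic_self).trans (hIic δ)
  obtain ⟨en⟩ := Cardinal.eq.mp (hΛc.trans hG.symm)
  have hjoin : ∀ (A B : AddSubgroup G) (s : Set G), #A ≤ μ → #B ≤ μ → #s ≤ μ →
      ∃ K : AddSubgroup G, A ≤ K ∧ B ≤ K ∧ s ⊆ K ∧ #K ≤ μ ∧ IsPure K := by
    intro A B s hA hB hs
    obtain ⟨K, h1, h2, h3⟩ := exists_small_pure hinf.le htf ((A : Set G) ∪ B ∪ s) (by
      refine (mk_union_le _ _).trans (add_le_of_le hinf.le ?_ hs)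
      exact (mk_union_le _ _).trans (add_le_of_le hinf.le hA hB))
    exact ⟨K, fun x hx => h1 (Or.inl (Or.inl hx)), fun x hx => h1 (Or.inl (Or.inr hx)),
      fun x hx => h1 (Or.inr hx), h2, h3⟩
  have hsingle : ∀ g : G, #({g} : Set G) ≤ μ := fun g => by
    rw [mk_singleton]; exact (one_lt_aleph0.trans hinf).le
  have hbotcard : #(⊥ : AddSubgroup G) ≤ μ := by
    simpa using (one_lt_aleph0.trans hinf).le
  by_cases hcase : ∀ A : AddSubgroup G, #A ≤ μ →
      ∃ K, A ≤ K ∧ #K ≤ μ ∧ IsKappaFree lam (G ⧸ K)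
  · obtain ⟨N, hmono, hN, hen, hΦ⟩ := exists_filtration hinf.le hIio en
      (fun _ K => IsKappaFree lam (G ⧸ K)) fun B hB g => by
        obtain ⟨K, h1, -, h2, h3, -⟩ := hjoin B ⊥ {g} hB hbotcard (hsingle g)
        obtain ⟨K', h4, h5, h6⟩ := hcase K h3
        exact ⟨K', h1.trans h4, h4 (h2 rfl), h5, h6⟩
    have hcov : ∀ g, ∃ γ, g ∈ N γ := fun g => ⟨en.symm g, by simpa using hen (en.symm g)⟩
    choose C hC hClt hCcof using fun δ : Λ => exists_cofinal_lt hsing δ (hIio δ)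
    let S : Set Λ := {δ | ¬ Module.Free ℤ ((N δ).map (QuotientAddGroup.mk' (below N δ)))}
    have hcl : ∀ e : Λ → Λ, ∃ δ ∈ S, ∀ γ < δ, e γ < δ := by
      refine exists_closed_not_free N hmono hcov hGnf ?_ ?_
      · intro γ δ _
        refine hΦ γ _ (lt_of_le_of_lt ?_ hμ)
        exact (mk_le_of_surjective (AddMonoidHom.addSubgroupMap_surjective _ _)).trans (hN δ)
      · intro e γ
        obtain ⟨δ, a, -, rfl, h, -, h'⟩ := exists_closed_ladder hinf.le hlam hbdd hIic e γ
        exact ⟨δ, h 0, h'⟩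
    obtain ⟨σ, hσ, hguess⟩ := exists_uniform_bound hμ hbdd S (fun δ => #(C δ)) (fun δ _ => hC δ) hcl
    refine exists_strongly_free_of_filtration hsing hstrong hlam hsmallnotW hGfree hG hΛc hΛ hbdd
      hIic N hmono (fun γ => isPure_of_isKappaFree (hinf.trans hμ) (hΦ γ)) hN S (fun δ hδ => hδ)
      (fun δ _ => C δ) (fun δ _ => le_rfl) hClt ?_ (fun δ _ _ => hCcof δ) σ hσ hguess ?_
    · intro δ hδ _
      by_contra hne
      apply hδ
      have h1 : ¬ ∃ γ, γ < δ := by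
        rintro ⟨γ, hγ⟩
        obtain ⟨ζ, hζ, -⟩ := hCcof δ γ hγ
        exact hne ⟨ζ, hζ⟩
      have h2 : ∀ y : G, (QuotientAddGroup.mk y : G ⧸ below N δ) = 0 → y = 0 := fun y hy => by
        rw [QuotientAddGroup.eq_zero_iff, mem_below hmono] at hy
        rcases hy with hy | ⟨γ, hγ, -⟩
        · exact hy
        · exact absurd ⟨γ, hγ⟩ h1
      have h3 : Module.Free ℤ (N δ) := hGfree _ ((hN δ).trans_lt hμ)
      exact free_of_addEquiv (AddSubgroup.equivMapOfInjective (N δ)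
        (QuotientAddGroup.mk' (below N δ)) ((injective_iff_map_eq_zero _).mpr h2)) h3
    · exact fun α => ⟨N α, α, le_rfl, hΦ α, fun δ _ h => le_below h,
        fun δ _ _ => ⟨0, fun _ _ ζ _ h => hmono h⟩⟩
  · push Not at hcase
    obtain ⟨A, hA, hAK⟩ := hcase
    obtain ⟨N, hmono, hN, -, hΦ⟩ := exists_filtration hinf.le hIio en
      (fun B K => A ≤ K ∧ IsPure K ∧
        (A ≤ B → ¬ Module.Free ℤ (K.map (QuotientAddGroup.mk' B)))) fun B hB g => by
        by_cases hAB : A ≤ B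
        · have h1 := hAK B hAB hB
          simp only [IsKappaFree, not_forall] at h1
          obtain ⟨H, hH, hHnf⟩ := h1
          have hH' : #H ≤ μ := by rwa [hlam, Order.lt_succ_iff] at hH
          choose r hr using QuotientAddGroup.mk_surjective (s := B)
          obtain ⟨K, h2, h3, h4, h5, h6⟩ := hjoin B A (r '' H ∪ {g}) hB hA (by
            refine (mk_union_le _ _).trans (add_le_of_le hinf.le ?_ (hsingle g))
            exact mk_image_le.trans hH')
          refine ⟨K, h2, h4 (Or.inr rfl), h5, h3, h6, fun _ hf => hHnf ?_⟩
          refine free_subgroup_mono (fun q hq => ?_) hf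
          exact ⟨r q, h4 (Or.inl ⟨q, hq, rfl⟩), hr q⟩
        · obtain ⟨K, h2, h3, h4, h5, h6⟩ := hjoin B A {g} hB hA (hsingle g)
          exact ⟨K, h2, h4 rfl, h5, h3, h6, fun h => absurd h hAB⟩
    let S : Set Λ := {δ | ∃ a : ℕ → Λ, StrictMono a ∧ (∀ n, a n < δ) ∧ ∀ γ < δ, ∃ n, γ ≤ a n}
    have hS : ∀ δ, ∃ a : ℕ → Λ, δ ∈ S →
        StrictMono a ∧ (∀ n, a n < δ) ∧ ∀ γ < δ, ∃ n, γ ≤ a n := fun δ => by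
      by_cases h : δ ∈ S
      · obtain ⟨a, ha⟩ := h
        exact ⟨a, fun _ => ha⟩
      · exact ⟨fun _ => δ, fun h' => absurd h' h⟩
    choose a ha using hS
    let D : Λ → ℕ → Set Λ := fun δ n => {ζ | ζ < δ ∧ ∃ m ≥ n, ζ = a δ m}
    refine exists_strongly_free_of_filtration hsing hstrong hlam hsmallnotW hGfree hG hΛc hΛ hbdd
      hIic N hmono (fun γ => (hΦ γ).2.1) hN S ?_ D ?_ (fun δ ζ h => h.1) ?_ ?_ ℵ₀ hinf ?_ ?_
    · intro δ hδ
      exact (hΦ δ).2.2 ((hΦ (a δ 0)).1.trans (le_below ((ha δ hδ).2.1 0)))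
    · rintro δ n ζ ⟨h, m, -, hm⟩
      exact ⟨h, m, Nat.zero_le _, hm⟩
    · exact fun δ hδ n => ⟨a δ n, (ha δ hδ).2.1 n, n, le_rfl, rfl⟩
    · intro δ hδ n γ hγ
      obtain ⟨m, hm⟩ := (ha δ hδ).2.2 γ hγ
      exact ⟨a δ (max n m), ⟨(ha δ hδ).2.1 _, _, le_max_left _ _, rfl⟩,
        hm.trans ((ha δ hδ).1.monotone (le_max_right _ _))⟩
    · intro e
      obtain ⟨δ, b, h1, -, h2, h3, h4⟩ := exists_closed_ladder hinf.le hlam hbdd hIic e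
        (Classical.arbitrary Λ)
      refine ⟨δ, ⟨b, h1, h2, h3⟩, h4, ?_⟩
      have h5 : D δ 0 ⊆ Set.range (a δ) := fun ζ ⟨_, m, _, hm⟩ => ⟨m, hm.symm⟩
      exact ((Set.countable_range (a δ)).mono h5).le_aleph0
    · intro α
      refine ⟨⊥, α, bot_le, ?_, fun _ _ _ => bot_le, fun δ hδ hα => ?_⟩
      · exact hGfree.of_injective (QuotientAddGroup.quotientBot (G := G)).toAddMonoidHom
          (QuotientAddGroup.quotientBot (G := G)).injective
      · obtain ⟨ν, hν⟩ := (ha δ hδ).2.2 α hα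
        refine ⟨ν + 1, fun n hn ζ ⟨_, m, hm, hζ⟩ h => ?_⟩
        have h1 : a δ ν < a δ m := (ha δ hδ).1 (by omega)
        rw [← hζ] at h1
        exact absurd (h1.trans_le h) (not_lt.mpr hν)

theorem stmt14
    (gch : ∀ ν : Cardinal.{u}, Cardinal.aleph0 ≤ ν → (2 : Cardinal.{u}) ^ ν = Order.succ ν)
    (μ : Cardinal.{u}) (hsing : μ.ord.cof < μ)
    (hstrong : ∀ θ < μ, (2 : Cardinal.{u}) ^ θ < μ)
    (lam : Cardinal.{u}) (hlam : lam = Order.succ μ)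
    (hex : ∃ (G : Type u) (inst : AddCommGroup G),
      Cardinal.mk G = lam ∧ @IsKappaFree lam G inst ∧ ¬ @IsFreeAbelian G inst)
    (hsmallnotW : ∀ (θ : Cardinal.{u}), Cardinal.aleph0 ≤ θ → θ < lam →
      ∀ (G : Type u) (inst : AddCommGroup G),
        Cardinal.mk G = θ → @IsKappaFree θ G inst → ¬ @IsFreeAbelian G inst →
          ¬ @IsWhitehead G inst) :
    ∃ (G : Type u) (inst : AddCommGroup G),
      Cardinal.mk G = lam ∧ @IsStronglyKappaFree lam G inst ∧
        ∀ f : G →+ ℤ, f = 0 := by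

  have hinf := aleph0_lt_of_singular μ hsing hstrong
  have hreg : lam.IsRegular := hlam ▸ isRegular_succ hinf.le
  have hΛ : (2 : Cardinal.{u}) ^ μ = lam := (gch μ hinf.le).trans hlam.symm
  obtain ⟨G, _, hG, hGfree, hGnf⟩ := hex
  have : Nonempty lam.ord.ToType := by
    rw [← mk_ne_zero_iff, mk_ord_toType]; exact hreg.pos.ne'
  have : NoMaxOrder lam.ord.ToType := Cardinal.noMaxOrder hreg.aleph0_le
  refine exists_strongly_free_of_isKappaFree (Λ := lam.ord.ToType) hsing hstrong hlam hsmallnotW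
    hGfree hGnf hG (mk_ord_toType lam) hΛ ?_ ?_
  · intro A f hA
    by_contra hcon
    push Not at hcon
    have h1 : IsCofinal (Set.range f) := fun β => by
      obtain ⟨a, ha⟩ := hcon β
      exact ⟨f a, ⟨a, rfl⟩, ha.le⟩
    have h2 := (Order.cof_le h1).trans mk_range_le
    rw [Ordinal.cof_toType, hreg.cof_ord] at h2
    exact absurd hA (not_lt.mpr h2)
  · intro α
    exact Order.lt_succ_iff.mp ((mk_Iic_toType_ord_lt hreg.aleph0_le α).trans_eq hlam)
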